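/- Let f = Σ_{λ∈Λ} Σ_k p_k(λ) D^k δ_λ (k ∈ (ℕ∪{0})^d) be a tempered distribution on ℝ^d whose support Λ is uniformly discrete and whose spectrum Γ = supp f̂ has bounded density. Suppose there exist constants 0 < c ≤ C < ∞ such that c ≤ sup_k |p_k(λ)| ≤ C for every λ ∈ Λ. Then there exist J ∈ ℕ, full-rank lattices L_1, …, L_J, points λ_1, …, λ_J ∈ ℝ^d, a finite set of pairs (k, ω) with k ∈ (ℕ∪{0})^d and ω ∈ ℝ^d, and complex numbers c(j,k,ω) such that f = Σ_{j=1}^J Σ_{λ ∈ λ_j + L_j} Σ_{(k,ω)} c(j,k,ω) e^{2πi⟨λ,ω⟩} D^k δ_λ. -/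

import Mathlib

open MeasureTheory SchwartzMap Metric Set
open scoped Pointwise RealInnerProductSpace ENNReal NNReal

noncomputable section

/-- Euclidean space `ℝ^d`. -/
abbrev Rd (d : ℕ) : Type := EuclideanSpace ℝ (Fin d)

/-- The space `S*(ℝ^d)` of tempered distributions: continuous linear functionals
on the Schwartz space `S(ℝ^d)`. -/
abbrev TemperedDist (d : ℕ) : Type := SchwartzMap (Rd d) ℂ →L[ℂ] ℂ

/-- The Fourier transform of a tempered distribution: `f̂(φ) = f(φ̂)`. -/
def fourierTD {d : ℕ} (f : TemperedDist d) : TemperedDist d :=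
  f.comp (fourierTransformCLM ℂ)

/-- The support of a tempered distribution: `x ∈ supp f` iff for every open
neighbourhood `U` of `x` there is a smooth compactly supported test function
supported in `U` on which `f` does not vanish. -/
def tdSupport {d : ℕ} (f : TemperedDist d) : Set (Rd d) :=
  {x | ∀ U : Set (Rd d), IsOpen U → x ∈ U →
    ∃ φ : SchwartzMap (Rd d) ℂ, HasCompactSupport (⇑φ) ∧ tsupport (⇑φ) ⊆ U ∧ f φ ≠ 0}

/-- A set is locally finite if its intersection with every ball is finite. -/
def LocFinite {d : ℕ} (A : Set (Rd d)) : Prop :=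
  ∀ (x : Rd d) (r : ℝ), (A ∩ Metric.ball x r).Finite

/-- A set is uniformly discrete if distances between distinct points are
bounded below by a positive constant. -/
def UniformlyDiscrete {d : ℕ} (A : Set (Rd d)) : Prop :=
  ∃ η > (0:ℝ), ∀ x ∈ A, ∀ y ∈ A, x ≠ y → η ≤ dist x y

/-- A set is polynomially discrete (p-discrete) if
`|x - x'| ≥ c min{1, |x|^{-h}}` for distinct points `x, x'` of the set. -/
def PDiscrete {d : ℕ} (A : Set (Rd d)) : Prop :=
  ∃ c > (0:ℝ), ∃ h > (0:ℝ), ∀ x ∈ A, ∀ y ∈ A, x ≠ y →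
    c * (if ‖x‖ ≤ 1 then 1 else ‖x‖ ^ (-h)) ≤ dist x y

/-- A set has bounded density if it is locally finite and the number of its
points in balls of radius 1 is uniformly bounded. -/
def BoundedDensity {d : ℕ} (A : Set (Rd d)) : Prop :=
  LocFinite A ∧ ∃ N : ℕ, ∀ x : Rd d, (A ∩ Metric.ball x 1).ncard ≤ N

/-- A set is relatively dense if it intersects every ball of some fixed radius `R`. -/
def RelDense {d : ℕ} (A : Set (Rd d)) : Prop :=
  ∃ R : ℝ, 0 < R ∧ ∀ x : Rd d, ∃ a ∈ A, dist x a ≤ R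

/-- A full-rank lattice in `ℝ^d` is the image of `ℤ^d` under an invertible
linear operator. -/
def IsFullRankLattice {d : ℕ} (L : Set (Rd d)) : Prop :=
  ∃ T : Rd d →ₗ[ℝ] Rd d, Function.Bijective T ∧
    L = T '' {x : Rd d | ∀ i, ∃ n : ℤ, x i = (n : ℝ)}

/-- The multi-indices `k ∈ (ℕ ∪ {0})^d` with `‖k‖ = k₁ + ⋯ + k_d ≤ K`. -/
def mIdx (d K : ℕ) : Finset (Fin d → ℕ) :=
  (Finset.Iic fun _ => K).filter fun k => (∑ i, k i) ≤ K

/-- Partial derivative in the `i`-th coordinate direction. -/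
def pderiv' {d : ℕ} (i : Fin d) (φ : Rd d → ℂ) : Rd d → ℂ :=
  fun x => fderiv ℝ φ x (EuclideanSpace.single i (1:ℝ))

/-- The mixed partial derivative `D^k = ∂^{k₁}_{x₁} ⋯ ∂^{k_d}_{x_d}`. -/
def Dmulti {d : ℕ} (k : Fin d → ℕ) : (Rd d → ℂ) → (Rd d → ℂ) :=
  ((List.finRange d).map fun i => (pderiv' i)^[k i]).foldr (· ∘ ·) id

/-- The action of `D^k δ_λ` on a test function: `φ ↦ (-1)^{‖k‖} (D^k φ)(λ)`. -/
def dkDelta {d : ℕ} (k : Fin d → ℕ) (lam : Rd d) (φ : SchwartzMap (Rd d) ℂ) : ℂ :=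
  (-1 : ℂ) ^ (∑ i, k i) * Dmulti k (⇑φ) lam

/-- The exponential `e^{2πi⟨x,w⟩}`. -/
def e2pi {d : ℕ} (x w : Rd d) : ℂ :=
  Complex.exp (((2 * Real.pi : ℝ) : ℂ) * Complex.I * ((⟪x, w⟫ : ℝ) : ℂ))

/-- A trigonometric polynomial: a finite sum `Σ c_ω e^{2πi⟨x,ω⟩}`. -/
def IsTrigPoly {d : ℕ} (P : Rd d → ℂ) : Prop :=
  ∃ (n : ℕ) (cc : Fin n → ℂ) (w : Fin n → Rd d),
    ∀ x, P x = ∑ i, cc i * e2pi x (w i)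

/-- The monomial `x^m = x₁^{m₁} ⋯ x_d^{m_d}` (as a complex number). -/
def monom {d : ℕ} (m : Fin d → ℕ) (x : Rd d) : ℂ := ((∏ i, (x i) ^ (m i) : ℝ) : ℂ)

/-- The total variation of the pure point measure with masses `b` on the open
ball `B(0,r)`: `Σ_{|γ| < r} |b(γ)|` (as an extended nonnegative real). -/
def ballVar {d : ℕ} (b : Rd d → ℂ) (r : ℝ) : ℝ≥0∞ :=
  ∑' γ : Rd d, if ‖γ‖ < r then (‖b γ‖₊ : ℝ≥0∞) else 0

/-- The pure point measure `μ = Σ_λ a(λ) δ_λ` belongs to `S*(ℝ^d)` and is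
represented there by the tempered distribution `f`: its support is countable,
`Σ_λ |a(λ)| |φ(λ)| < ∞` for every Schwartz function `φ`, and the (automatically
continuous) functional `φ ↦ Σ_λ a(λ) φ(λ)` coincides with `f`. -/
def RepMeasure {d : ℕ} (a : Rd d → ℂ) (f : TemperedDist d) : Prop :=
  {x | a x ≠ 0}.Countable ∧
  (∀ φ : SchwartzMap (Rd d) ℂ, Summable fun lam => ‖a lam‖ * ‖φ lam‖) ∧
  (∀ φ : SchwartzMap (Rd d) ℂ, f φ = ∑' lam, a lam * φ lam)

/-- A continuous function on `ℝ^d` is almost periodic if for every `ε > 0` its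
set of `ε`-almost periods is relatively dense. -/
def APFunction {d : ℕ} (g : Rd d → ℂ) : Prop :=
  Continuous g ∧ ∀ ε > (0:ℝ), RelDense {τ : Rd d | ∀ t, ‖g (t + τ) - g t‖ < ε}

/-- A tempered distribution is almost periodic if for every smooth compactly
supported `ψ` the function `t ↦ f(ψ(t - ·))` is almost periodic. -/
def APDistribution {d : ℕ} (f : TemperedDist d) : Prop :=
  ∀ ψ : Rd d → ℂ, ContDiff ℝ (⊤ : ℕ∞) ψ → HasCompactSupport ψ →
    ∀ Φ : Rd d → SchwartzMap (Rd d) ℂ, (∀ t y, Φ t y = ψ (t - y)) →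
      APFunction fun t => f (Φ t)
/-! ### invariant mean -/
section Mean
variable {G : Type*} [AddCommGroup G]

def BddF (G : Type*) : Submodule ℝ (G → ℝ) where
  carrier := {F | ∃ C, ∀ t, |F t| ≤ C}
  add_mem' := by
    rintro F F' ⟨C, h⟩ ⟨C', h'⟩
    exact ⟨C + C', fun t => (abs_add_le _ _).trans (add_le_add (h t) (h' t))⟩
  zero_mem' := ⟨0, by simp⟩
  smul_mem' := by
    rintro c F ⟨C, h⟩
    exact ⟨|c| * C, fun t => by simpa [abs_mul] using mul_le_mul_of_nonneg_left (h t) (abs_nonneg c)⟩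

def mset (F : G → ℝ) : Set ℝ :=
  {M | ∃ l : List G, l ≠ [] ∧ ∀ t, (l.map fun h => F (t + h)).sum ≤ M * l.length}

lemma mset_lb {F : G → ℝ} {C : ℝ} (h : ∀ t, |F t| ≤ C) : ∀ M ∈ mset F, -C ≤ M := by
  rintro M ⟨l, hl, hM⟩
  have h0 := hM 0
  have : ∀ l : List G, -C * l.length ≤ (l.map fun h => F (0 + h)).sum := by
    intro l
    induction l with
    | nil => simp
    | cons a l ih =>
      have := (abs_le.1 (h (0 + a))).1
      simp only [List.map_cons, List.sum_cons, List.length_cons]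
      push_cast; linarith
  have h1 := (this l).trans h0
  have : (0:ℝ) < l.length := by exact_mod_cast List.length_pos_iff.2 hl
  exact le_of_mul_le_mul_right h1 this

lemma mset_bdd {F : G → ℝ} (h : F ∈ BddF G) : BddBelow (mset F) := by
  obtain ⟨C, h⟩ := h
  exact ⟨-C, mset_lb h⟩

lemma mset_of_le {F : G → ℝ} {C : ℝ} (h : ∀ t, F t ≤ C) : C ∈ mset F :=
  ⟨[0], by simp, fun t => by simpa using h t⟩

lemma mset_ne {F : G → ℝ} (h : F ∈ BddF G) : (mset F).Nonempty := by
  obtain ⟨C, h⟩ := h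
  exact ⟨C, mset_of_le fun t => (abs_le.1 (h t)).2⟩

lemma mset_add {F F' : G → ℝ} {M M' : ℝ} (h : M ∈ mset F) (h' : M' ∈ mset F') :
    M + M' ∈ mset (F + F') := by
  obtain ⟨l, hl, h⟩ := h
  obtain ⟨l', hl', h'⟩ := h'
  refine ⟨l.flatMap fun a => l'.map fun b => a + b, ?_, fun t => ?_⟩
  · obtain ⟨a, l, rfl⟩ := List.exists_cons_of_ne_nil hl
    obtain ⟨b, l', rfl⟩ := List.exists_cons_of_ne_nil hl'
    simp
  have key : ∀ l : List G, ((l.flatMap fun a => l'.map fun b => a + b).map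
      fun h => (F + F') (t + h)).sum =
      (l.map fun a => (l'.map fun b => F' (t + a + b)).sum).sum +
      (l'.map fun b => (l.map fun a => F (t + b + a)).sum).sum := by
    intro l
    induction l with
    | nil => simp
    | cons a l ih =>
      rw [List.flatMap_cons, List.map_append, List.sum_append, ih]
      simp only [List.map_cons, List.sum_cons, List.sum_map_add, List.map_map, Function.comp_def,
        Pi.add_apply, ← add_assoc]
      simp only [add_right_comm t]
      ring
  have len : ((l.flatMap fun a => l'.map fun b => a + b).length : ℝ) = l.length * l'.length := by
    simp [List.length_flatMap]
  rw [key, len]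
  have e1 : ∀ l : List G, (l.map fun a => (l'.map fun b => F' (t + a + b)).sum).sum
      ≤ M' * l'.length * l.length := by
    intro l
    induction l with
    | nil => simp
    | cons a l ih =>
      simp only [List.map_cons, List.sum_cons, List.length_cons]; push_cast
      have := h' (t + a); linarith
  have e2 : ∀ l' : List G, (l'.map fun b => (l.map fun a => F (t + b + a)).sum).sum
      ≤ M * l.length * l'.length := by
    intro l'
    induction l' with
    | nil => simp
    | cons a l ih =>
      simp only [List.map_cons, List.sum_cons, List.length_cons]; push_cast
      have := h (t + a); linarith
  have := e1 l; have := e2 l'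
  nlinarith

lemma mset_smul {F : G → ℝ} {M c : ℝ} (hc : 0 < c) (h : M ∈ mset F) : c * M ∈ mset (c • F) := by
  obtain ⟨l, hl, h⟩ := h
  refine ⟨l, hl, fun t => ?_⟩
  have := mul_le_mul_of_nonneg_left (h t) hc.le
  simp only [Pi.smul_apply, smul_eq_mul, List.sum_map_mul_left]
  linarith

lemma mset_shift {F : G → ℝ} {C : ℝ} (h : ∀ t, |F t| ≤ C) (g : G) (n : ℕ) (hn : 0 < n) :
    2 * C / n ∈ mset (fun t => F (t + g) - F t) := by
  refine ⟨(List.range n).map fun j => j • g, by simp; omega, fun t => ?_⟩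
  have : ∀ n : ℕ, (((List.range n).map fun j => j • g).map
      fun h => F (t + h + g) - F (t + h)).sum = F (t + n • g) - F t := by
    intro n
    induction n with
    | zero => simp
    | succ n ih =>
      rw [List.range_succ, List.map_append, List.map_append, List.sum_append, ih]
      simp [succ_nsmul, add_assoc]
  rw [this]
  have h1 := abs_le.1 (h (t + n • g)); have h2 := abs_le.1 (h t)
  have : (n : ℝ) ≠ 0 := by positivity
  simp only [List.length_map, List.length_range]
  field_simp
  linarith

theorem exists_mean (G : Type*) [AddCommGroup G] : ∃ m : (G → ℝ) →ₗ[ℝ] ℝ,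
    (∀ F ∈ BddF G, ∀ C, (∀ t, F t ≤ C) → m F ≤ C) ∧
    (∀ F ∈ BddF G, ∀ g, m (fun t => F (t + g)) = m F) := by
  have hsub : ∀ F F' : BddF G, sInf (mset (F + F' : BddF G).1) ≤
      sInf (mset F.1) + sInf (mset F'.1) := by
    intro F F'
    refine le_of_forall_pos_le_add fun ε hε => ?_
    obtain ⟨M, hM, h⟩ := exists_lt_of_csInf_lt (mset_ne F.2)
      (show sInf (mset F.1) < sInf (mset F.1) + ε / 2 by linarith)
    obtain ⟨M', hM', h'⟩ := exists_lt_of_csInf_lt (mset_ne F'.2)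
      (show sInf (mset F'.1) < sInf (mset F'.1) + ε / 2 by linarith)
    have := csInf_le (mset_bdd (F + F').2) (mset_add hM hM')
    linarith
  have hsm : ∀ c : ℝ, 0 < c → ∀ F : BddF G, sInf (mset (c • F : BddF G).1) ≤ c * sInf (mset F.1) := by
    intro c hc F
    refine le_of_forall_pos_le_add fun ε hε => ?_
    obtain ⟨M, hM, h⟩ := exists_lt_of_csInf_lt (mset_ne F.2)
      (show sInf (mset F.1) < sInf (mset F.1) + ε / c by linarith [div_pos hε hc])
    have := csInf_le (mset_bdd (c • F).2) (mset_smul hc hM)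
    have h2 := mul_lt_mul_of_pos_left h hc
    rw [mul_add, mul_div_cancel₀ _ hc.ne'] at h2
    linarith
  obtain ⟨g, -, hg⟩ := exists_extension_of_le_sublinear (⟨⊥, 0⟩ : BddF G →ₗ.[ℝ] ℝ)
    (fun F => sInf (mset F.1)) (fun c hc F => le_antisymm (hsm c hc F) (by
      have := hsm c⁻¹ (inv_pos.2 hc) (c • F)
      rw [inv_smul_smul₀ hc.ne'] at this
      have := mul_le_mul_of_nonneg_left this hc.le
      rwa [mul_inv_cancel_left₀ hc.ne'] at this)) hsub (by
      rintro ⟨x, hx⟩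
      simp only [Submodule.mem_bot] at hx
      subst hx
      exact le_csInf (mset_ne (0 : BddF G).2) fun M hM => by
        simpa using mset_lb (F := (0 : G → ℝ)) (C := 0) (by simp) M hM)
  obtain ⟨m, hm⟩ := LinearMap.exists_extend g
  have hmg : ∀ F (hF : F ∈ BddF G), m F = g ⟨F, hF⟩ := fun F hF => by rw [← hm]; rfl
  have sh : ∀ F ∈ BddF G, ∀ g, (fun t => F (t + g)) ∈ BddF G := by
    rintro F ⟨C, h⟩ g
    exact ⟨C, fun t => h _⟩
  have half : ∀ F ∈ BddF G, ∀ g, m (fun t => F (t + g)) - m F ≤ 0 := by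
    intro F hF x
    obtain ⟨C, hC⟩ := id hF
    have h1 : (fun t => F (t + x)) - F ∈ BddF G := sub_mem (sh F hF x) hF
    rw [← map_sub, hmg _ h1]
    have h2 : ∀ n : ℕ, 0 < n → g ⟨_, h1⟩ ≤ 2 * C / n := fun n hn =>
      (hg ⟨_, h1⟩).trans (csInf_le (mset_bdd h1) (mset_shift hC x n hn))
    refine ge_of_tendsto (tendsto_const_div_atTop_nhds_zero_nat (2 * C)) ?_
    filter_upwards [Filter.eventually_gt_atTop 0] with n hn using h2 n hn
  refine ⟨m, fun F hF C hC => ?_, fun F hF x => ?_⟩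
  · rw [hmg F hF]
    exact (hg _).trans (csInf_le (mset_bdd hF) (mset_of_le hC))
  · have h1 := half F hF x
    have h2 := half _ (sh F hF x) (-x)
    simp only [neg_add_cancel_right] at h2
    linarith

theorem exists_meanC (G : Type*) [AddCommGroup G] : ∃ m : (G → ℂ) →ₗ[ℂ] ℂ,
    (∀ F : G → ℝ, (∃ C, ∀ t, |F t| ≤ C) → ∀ C, (∀ t, F t ≤ C) → (m fun t => (F t : ℂ)).re ≤ C) ∧
    (∀ F : G → ℂ, (∃ C, ∀ t, ‖F t‖ ≤ C) → ∀ g, m (fun t => F (t + g)) = m F) ∧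
    (∀ F : G → ℂ, (∃ C, ∀ t, ‖F t‖ ≤ C) → m (fun t => F (-t)) = m F) ∧
    (∀ F : G → ℂ, m (fun t => starRingEnd ℂ (F t)) = starRingEnd ℂ (m F)) := by
  obtain ⟨m, h1, h2⟩ := exists_mean G
  let n : (G → ℝ) →ₗ[ℝ] ℝ := (1 / 2 : ℝ) • (m + m.comp (LinearMap.funLeft ℝ ℝ fun x : G => -x))
  have hn : ∀ F, n F = (1 / 2) * (m F + m fun t => F (-t)) := fun F => rfl
  have re : ∀ F : G → ℂ, (∃ C, ∀ t, ‖F t‖ ≤ C) → (fun t => (F t).re) ∈ BddF G :=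
    fun F ⟨C, h⟩ => ⟨C, fun t => (Complex.abs_re_le_norm _).trans (h t)⟩
  have im : ∀ F : G → ℂ, (∃ C, ∀ t, ‖F t‖ ≤ C) → (fun t => (F t).im) ∈ BddF G :=
    fun F ⟨C, h⟩ => ⟨C, fun t => (Complex.abs_im_le_norm _).trans (h t)⟩
  have hneg : ∀ F ∈ BddF G, (fun t => F (-t)) ∈ BddF G := fun F ⟨C, h⟩ => ⟨C, fun t => h _⟩
  have n1 : ∀ F ∈ BddF G, ∀ g, n (fun t => F (t + g)) = n F := by
    intro F hF g
    rw [hn, hn, h2 F hF, ← h2 _ (hneg F hF) (-g)]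
    simp [add_comm]
  have n2 : ∀ F ∈ BddF G, n (fun t => F (-t)) = n F := by
    intro F hF; rw [hn, hn]; simp only [neg_neg]; ring
  let M : (G → ℂ) →ₗ[ℂ] ℂ :=
    { toFun := fun F => ⟨n fun t => (F t).re, n fun t => (F t).im⟩
      map_add' := fun F F' => Complex.ext
        (n.map_add (fun t => (F t).re) (fun t => (F' t).re))
        (n.map_add (fun t => (F t).im) (fun t => (F' t).im))
      map_smul' := fun c F => by
        have e := fun (x y : ℝ) (A B : G → ℝ) => n.map_add (x • A) (y • B)
        simp only [map_smul, smul_eq_mul] at e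
        apply Complex.ext
        · have := e c.re (-c.im) (fun t => (F t).re) (fun t => (F t).im)
          simp only [RingHom.id_apply, smul_eq_mul, Complex.mul_re]
          convert this using 2
          · ext t; simp; ring
          · ring
        · have := e c.re c.im (fun t => (F t).im) (fun t => (F t).re)
          simp only [RingHom.id_apply, smul_eq_mul, Complex.mul_im]
          convert this using 2
          ext t; simp }
  refine ⟨M, fun F hF C hC => ?_, fun F hF g => ?_, fun F hF => ?_, fun F => ?_⟩
  · change n (fun t => ((F t : ℂ)).re) ≤ C
    simp only [Complex.ofReal_re]
    rw [hn]
    have := h1 F hF C hC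
    have := h1 _ (hneg F hF) C fun t => hC _
    linarith
  · exact Complex.ext (n1 _ (re F hF) g) (n1 _ (im F hF) g)
  · exact Complex.ext (n2 _ (re F hF)) (n2 _ (im F hF))
  · apply Complex.ext
    · rfl
    · change n (fun t => ((starRingEnd ℂ (F t))).im) = -(n fun t => (F t).im)
      rw [← map_neg]; rfl
end Mean

/-! ### ultrafilter limits of unitaries -/
section Hilb
open Filter Topology
variable {G : Type*} [AddCommGroup G]

def uadd (U V : Ultrafilter G) : Ultrafilter G := Ultrafilter.add.add U V

lemma ev_uadd (U V : Ultrafilter G) (p : G → Prop) :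
    (∀ᶠ m in (uadd U V : Filter G), p m) ↔ ∀ᶠ m in U, ∀ᶠ m' in V, p (m + m') := Iff.rfl

lemma tendsto_uadd {X : Type*} [TopologicalSpace X] {U V : Ultrafilter G} {f g : G → X} {l : X}
    (h : ∀ x, Tendsto (fun y => f (x + y)) V (𝓝 (g x))) (hg : Tendsto g U (𝓝 l)) :
    Tendsto f (uadd U V : Filter G) (𝓝 l) := by
  refine tendsto_nhds.2 fun s hs hl => ?_
  have := tendsto_nhds.1 hg s hs hl
  refine (ev_uadd U V (fun m => f m ∈ s)).2 ?_
  filter_upwards [this] with x hx using tendsto_nhds.1 (h x) s hs hx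

lemma ultra_bdd {X : Type*} (U : Ultrafilter X) {F : X → ℂ} {C : ℝ} (h : ∀ x, ‖F x‖ ≤ C) :
    ∃ l, Tendsto F U (𝓝 l) := by
  have hc : IsCompact (closedBall (0:ℂ) C) := isCompact_closedBall 0 C
  obtain ⟨l, -, hl⟩ := hc.ultrafilter_le_nhds (U.map F) (by
    rw [Filter.le_principal_iff]
    exact Filter.mem_map.2 <| Filter.univ_mem' fun x => by show F x ∈ closedBall (0:ℂ) C; simpa using h x)
  exact ⟨l, hl⟩

variable {H : Type*} [NormedAddCommGroup H] [InnerProductSpace ℂ H] [CompleteSpace H]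

local notation "⟪" x ", " y "⟫'" => inner ℂ x y

def WL (U : G → H →ₗ[ℂ] H) (𝒰 : Ultrafilter G) (w v : H) : Prop :=
  ∀ u, Tendsto (fun x => ⟪u, U x w⟫') 𝒰 (𝓝 ⟪u, v⟫')

variable {U : G → H →ₗ[ℂ] H} 

lemma WL.unique {𝒰 : Ultrafilter G} {w v v' : H} (h : WL U 𝒰 w v) (h' : WL U 𝒰 w v') : v = v' :=
  ext_inner_left ℂ fun u => tendsto_nhds_unique (h u) (h' u)

lemma exists_WL (hn : ∀ x w, ‖U x w‖ = ‖w‖) (𝒰 : Ultrafilter G) (w : H) : ∃ v, WL U 𝒰 w v := by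
  have hb : ∀ u x, ‖⟪U x w, u⟫'‖ ≤ ‖w‖ * ‖u‖ := fun u x =>
    (norm_inner_le_norm _ _).trans (by rw [hn])
  choose l hl using fun u => ultra_bdd 𝒰 (hb u)
  let L : H →ₗ[ℂ] ℂ :=
    { toFun := l
      map_add' := fun u u' => tendsto_nhds_unique (hl _) (by
        simp only [inner_add_right]; exact (hl u).add (hl u'))
      map_smul' := fun c u => tendsto_nhds_unique (hl _) (by
        simp only [inner_smul_right]; exact (hl u).const_mul c) }
  let L' := L.mkContinuous ‖w‖ (fun u => le_of_tendsto (hl u).norm (Eventually.of_forall (hb u)))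
  refine ⟨(InnerProductSpace.toDual ℂ H).symm L', fun u => ?_⟩
  have h1 : ⟪(InnerProductSpace.toDual ℂ H).symm L', u⟫' = l u := by
    rw [InnerProductSpace.toDual_symm_apply]; rfl
  have := (Complex.continuous_conj.tendsto _).comp (hl u)
  rw [← h1, inner_conj_symm] at this
  simpa [Function.comp_def] using this

lemma exists_T (hn : ∀ x w, ‖U x w‖ = ‖w‖) : ∃ T : Ultrafilter G → H →ₗ[ℂ] H,
    ∀ 𝒰 w, WL U 𝒰 w (T 𝒰 w) := by
  choose T hT using exists_WL hn
  refine ⟨fun 𝒰 => ⟨⟨T 𝒰, fun u u' => ?_⟩, fun c u => ?_⟩, hT⟩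
  · refine (hT _ _).unique fun v => ?_
    simp only [map_add, inner_add_right]; exact (hT _ _ v).add (hT _ _ v)
  · refine (hT _ _).unique fun v => ?_
    simp only [map_smul, inner_smul_right, RingHom.id_apply]; exact (hT _ _ v).const_mul c

lemma split_idem {W : Submodule ℂ H} (S : Finset (H →ₗ[ℂ] H))
    (hi : ∀ p ∈ S, ∀ w, p (p w) = p w) (hW : ∀ p ∈ S, ∀ w ∈ W, p w ∈ W)
    (hcomm : ∀ p ∈ S, ∀ q ∈ S, ∀ w, p (q w) = q (p w)) (a : H) (ha : a ∈ W) :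
    a ∈ Submodule.span ℂ {b | b ∈ W ∧ ∀ p ∈ S, p b = b ∨ p b = 0} := by
  classical
  induction S using Finset.induction_on with
  | empty => exact Submodule.subset_span ⟨ha, by simp⟩
  | insert p S hpS ih =>
    have := ih (fun q hq => hi q (Finset.mem_insert_of_mem hq))
      (fun q hq => hW q (Finset.mem_insert_of_mem hq))
      (fun q hq r hr => hcomm q (Finset.mem_insert_of_mem hq) r (Finset.mem_insert_of_mem hr))
    refine (Submodule.span_le.2 ?_) this
    rintro b ⟨hb, hS⟩
    have hp := Finset.mem_insert_self p S
    have e : b = p b + (b - p b) := by abel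
    rw [SetLike.mem_coe, e]
    refine add_mem (Submodule.subset_span ⟨hW p hp b hb, fun q hq => ?_⟩)
      (Submodule.subset_span ⟨sub_mem hb (hW p hp b hb), fun q hq => ?_⟩)
    · rw [hcomm q hq p hp]
      rcases Finset.mem_insert.1 hq with rfl | hq
      · rw [hi q hp]; simp
      · rcases hS q hq with h | h <;> simp [h]
    · rw [map_sub, hcomm q hq p hp]
      rcases Finset.mem_insert.1 hq with rfl | hq
      · rw [hi q hp]; simp
      · rcases hS q hq with h | h <;> simp [h]

theorem hilb_split (h0 : U 0 = LinearMap.id) (hadd : ∀ x y w, U (x + y) w = U x (U y w))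
    (hn : ∀ x w, ‖U x w‖ = ‖w‖)
    (a : H) (hcyc : (Submodule.span ℂ (range fun x => U x a)).topologicalClosure = ⊤)
    (HT : Set (Ultrafilter G)) (HTadd : ∀ 𝒰 ∈ HT, ∀ 𝒱 ∈ HT, uadd 𝒰 𝒱 ∈ HT)
    (HTneg : ∀ 𝒱 : Ultrafilter G, uadd (𝒱.map Neg.neg) 𝒱 ∈ HT)
    (Q : Set H) (hQ : Q.Finite) (hQa : ∀ 𝒰 ∈ HT, ∀ v, WL U 𝒰 a v → v ∈ Q) :
    a ∈ Submodule.span ℂ {b | b ∈ Submodule.span ℂ (insert a Q) ∧ ∀ 𝒱 : Ultrafilter G,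
      WL U 𝒱 b 0 ∨ ∃ v, Tendsto (fun x => U x b) 𝒱 (𝓝 v)} := by
  classical
  obtain ⟨T, hT⟩ := exists_T hn
  have hin : ∀ x u w, ⟪U x u, U x w⟫' = ⟪u, w⟫' := fun x u w =>
    (LinearMap.norm_map_iff_inner_map_map (U x)).1 (hn x) u w
  have hadj : ∀ x u w, ⟪u, U x w⟫' = ⟪U (-x) u, w⟫' := fun x u w => by
    rw [← hin (-x), ← hadd, neg_add_cancel, h0]; rfl
  have Tadd : ∀ 𝒰 𝒱 w, T (uadd 𝒰 𝒱) w = T 𝒰 (T 𝒱 w) := fun 𝒰 𝒱 w =>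
    (hT _ w).unique fun u => tendsto_uadd (g := fun x => ⟪u, U x (T 𝒱 w)⟫') (fun x => by
      simp only [hadd, hadj x]; exact hT 𝒱 w _) (hT _ _ u)
  have Tneg : ∀ 𝒰 u w, ⟪u, T (𝒰.map Neg.neg) w⟫' = ⟪T 𝒰 u, w⟫' := fun 𝒰 u w => by
    have h1 : Tendsto (fun x => ⟪u, U (-x) w⟫') 𝒰 (𝓝 ⟪u, T (𝒰.map Neg.neg) w⟫') :=
      tendsto_map'_iff.1 (hT (𝒰.map Neg.neg) w u)
    have h2 := (Complex.continuous_conj.tendsto _).comp (hT 𝒰 u w)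
    refine tendsto_nhds_unique h1 ?_
    rw [inner_conj_symm] at h2
    refine h2.congr fun x => ?_
    simp only [Function.comp_apply, inner_conj_symm]
    rw [hadj (-x), neg_neg]
  have TU : ∀ 𝒰 x w, T 𝒰 (U x w) = U x (T 𝒰 w) := fun 𝒰 x w => (hT _ _).unique fun u => by
    rw [hadj]
    refine (hT 𝒰 w (U (-x) u)).congr fun y => ?_
    rw [← hadj, ← hadd, ← hadd, add_comm]
  have negneg : ∀ 𝒰 : Ultrafilter G, (𝒰.map Neg.neg).map Neg.neg = 𝒰 := fun 𝒰 => by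
    ext s; simp [Ultrafilter.mem_map]
  have Tcomm : ∀ 𝒰 𝒱 w, T 𝒰 (T 𝒱 w) = T 𝒱 (T 𝒰 w) := fun 𝒰 𝒱 w => by
    refine (hT 𝒰 (T 𝒱 w)).unique fun u => ?_
    have := hT 𝒰 w (T (𝒱.map Neg.neg) u)
    rw [← Tneg, negneg] at this
    refine this.congr fun x => ?_
    rw [← TU, ← Tneg, negneg]
  have Tn : ∀ 𝒰 w, ‖T 𝒰 w‖ ≤ ‖w‖ := fun 𝒰 w => by
    have h1 : ‖⟪T 𝒰 w, T 𝒰 w⟫'‖ ≤ ‖T 𝒰 w‖ * ‖w‖ :=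
      le_of_tendsto (hT 𝒰 w (T 𝒰 w)).norm (Eventually.of_forall fun x =>
        (norm_inner_le_norm _ _).trans (by rw [hn]))
    rw [inner_self_eq_norm_sq_to_K] at h1
    simp only [norm_pow, RCLike.norm_ofReal, abs_norm] at h1
    by_contra! h
    nlinarith [norm_nonneg w]
  have Tcont : ∀ 𝒰, Continuous (T 𝒰) := fun 𝒰 =>
    ((T 𝒰).mkContinuous 1 fun w => by simpa using Tn 𝒰 w).continuous
  have Tinj : ∀ 𝒰 𝒱, T 𝒰 a = T 𝒱 a → T 𝒰 = T 𝒱 := fun 𝒰 𝒱 h => by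
    have hc : IsClosed {w | T 𝒰 w = T 𝒱 w} := isClosed_eq (Tcont _) (Tcont _)
    have hs : (Submodule.span ℂ (range fun x => U x a)) ≤ LinearMap.eqLocus (T 𝒰) (T 𝒱) := by
      rw [Submodule.span_le]
      rintro _ ⟨x, rfl⟩
      simp [TU, h]
    have := Submodule.topologicalClosure_minimal _ hs hc
    rw [hcyc, top_le_iff] at this
    exact LinearMap.ext fun w => by
      have : w ∈ LinearMap.eqLocus (T 𝒰) (T 𝒱) := by rw [this]; trivial
      simpa using this
  -- finiteness
  have fin : (T '' HT).Finite := by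
    refine Set.Finite.of_finite_image (f := fun t => t a) (hQ.subset ?_) ?_
    · rintro _ ⟨_, ⟨𝒰, h𝒰, rfl⟩, rfl⟩
      exact hQa 𝒰 h𝒰 _ (hT _ _)
    · rintro _ ⟨𝒰, h𝒰, rfl⟩ _ ⟨𝒱, h𝒱, rfl⟩ h
      exact Tinj _ _ h
  -- p = t* t
  let P : Ultrafilter G → H →ₗ[ℂ] H := fun 𝒱 => T (uadd (𝒱.map Neg.neg) 𝒱)
  have Pin : ∀ 𝒱 u w, ⟪u, P 𝒱 w⟫' = ⟪T 𝒱 u, T 𝒱 w⟫' := fun 𝒱 u w => by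
    simp only [P]; rw [Tadd, Tneg]
  have Psym : ∀ 𝒱 u w, ⟪u, P 𝒱 w⟫' = ⟪P 𝒱 u, w⟫' := fun 𝒱 u w => by
    rw [Pin, ← inner_conj_symm, ← Pin, inner_conj_symm]
  have Pker : ∀ 𝒱 (n : ℕ) w, (P 𝒱 ^ (n + 1)) w = 0 → P 𝒱 w = 0 := by
    intro 𝒱 n
    induction n with
    | zero => intro w h; simpa using h
    | succ n ih =>
      intro w h
      refine ih w (inner_self_eq_zero (𝕜 := ℂ).1 ?_)
      nth_rw 2 [pow_succ']
      rw [Module.End.mul_apply, Psym, ← Module.End.mul_apply, ← pow_succ', h, inner_zero_left]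
  have Pmem : ∀ 𝒱 (n : ℕ), P 𝒱 ^ (n + 1) ∈ T '' HT := by
    intro 𝒱 n
    induction n with
    | zero => exact ⟨_, HTneg 𝒱, by simp [P]⟩
    | succ n ih =>
      obtain ⟨𝒰, h, e⟩ := ih
      refine ⟨uadd 𝒰 (uadd (𝒱.map Neg.neg) 𝒱), HTadd _ h _ (HTneg 𝒱), ?_⟩
      ext w
      rw [Tadd, pow_succ, Module.End.mul_apply, ← e]
  have Pidem : ∀ 𝒱 w, P 𝒱 (P 𝒱 w) = P 𝒱 w := by
    intro 𝒱 w
    obtain ⟨k, l, hkl, e⟩ : ∃ k l : ℕ, k < l ∧ P 𝒱 ^ (k + 1) = P 𝒱 ^ (l + 1) := by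
      have : ¬ Function.Injective (fun n : ℕ => (⟨_, Pmem 𝒱 n⟩ : T '' HT)) := by
        have := fin.to_subtype
        exact not_injective_infinite_finite _
      simp only [Function.Injective, Subtype.mk.injEq, not_forall] at this
      obtain ⟨k, l, h, hne⟩ := this
      rcases lt_or_gt_of_ne hne with h' | h'
      · exact ⟨k, l, h', h⟩
      · exact ⟨l, k, h', h.symm⟩
    obtain ⟨m, rfl⟩ : ∃ m, l = k + m + 1 := ⟨l - k - 1, by omega⟩
    have h1 : P 𝒱 (w - (P 𝒱 ^ (m + 1)) w) = 0 := Pker 𝒱 k _ (by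
      rw [map_sub, ← Module.End.mul_apply, ← pow_add, e, sub_eq_zero]
      congr 2; ring)
    have h2 : P 𝒱 w = (P 𝒱 ^ (m + 1)) (P 𝒱 w) := by
      rw [map_sub, sub_eq_zero] at h1
      rw [← Module.End.mul_apply, ← pow_succ, pow_succ', Module.End.mul_apply]; exact h1
    set v := P 𝒱 w with hv
    have hcon : ∀ (n : ℕ) u, ‖(P 𝒱 ^ n) u‖ ≤ ‖u‖ := by
      intro n
      induction n with
      | zero => simp
      | succ n ih => intro u; rw [pow_succ, Module.End.mul_apply]; exact (ih _).trans (Tn _ _)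
    have h3 : ‖v‖ ≤ ‖P 𝒱 v‖ := by
      conv_lhs => rw [h2, pow_succ, Module.End.mul_apply]
      exact hcon m _
    have h4 : ‖P 𝒱 v‖ ≤ ‖T 𝒱 v‖ := by
      simp only [P]; rw [Tadd]; exact Tn _ _
    have h5 : ‖P 𝒱 v‖ ≤ ‖v‖ := Tn _ _
    have h6 : ‖P 𝒱 v - v‖ ^ 2 ≤ 0 := by
      rw [norm_sub_sq (𝕜 := ℂ), ← Psym, Pin, inner_self_eq_norm_sq_to_K]
      norm_cast
      nlinarith [norm_nonneg v, norm_nonneg (P 𝒱 v)]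
    have : ‖P 𝒱 v - v‖ = 0 := by nlinarith [norm_nonneg (P 𝒱 v - v), sq_nonneg (‖P 𝒱 v - v‖)]
    exact sub_eq_zero.1 (norm_eq_zero.1 this)
  let W : Submodule ℂ H := Submodule.span ℂ (insert a ((fun 𝒰 => T 𝒰 a) '' HT))
  have hWQ : W ≤ Submodule.span ℂ (insert a Q) := by
    apply Submodule.span_mono
    apply insert_subset_insert
    rintro _ ⟨𝒰, h, rfl⟩
    exact hQa 𝒰 h _ (hT _ _)
  have WT : ∀ 𝒰 ∈ HT, W ≤ W.comap (T 𝒰) := by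
    intro 𝒰 h
    refine Submodule.span_le.2 ?_
    rintro _ (rfl | ⟨𝒱, h', rfl⟩)
    · exact Submodule.subset_span (Or.inr ⟨𝒰, h, rfl⟩)
    · exact Submodule.subset_span (Or.inr ⟨uadd 𝒰 𝒱, HTadd _ h _ h', Tadd _ _ _⟩)
  have Sfin : (range P).Finite := fin.subset (by
    rintro _ ⟨𝒱, rfl⟩; simpa using Pmem 𝒱 0)
  have key := split_idem (W := W) Sfin.toFinset (by simpa using Pidem)
    (by simpa using fun 𝒱 w hw => WT _ (HTneg 𝒱) hw) (by simpa using fun 𝒱 𝒰 w => Tcomm _ _ w)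
    a (Submodule.subset_span (Or.inl rfl))
  refine Submodule.span_mono ?_ key
  rintro b ⟨hb, hP⟩
  refine ⟨hWQ hb, fun 𝒱 => ?_⟩
  have hnorm : ∀ w, ‖T 𝒱 w‖ ^ 2 = (⟪w, P 𝒱 w⟫').re := fun w => by
    rw [Pin, inner_self_eq_norm_sq_to_K]; norm_cast
  rcases hP (P 𝒱) (by simp) with h | h
  · right
    refine ⟨T 𝒱 b, ?_⟩
    have h1 : ‖T 𝒱 b‖ ^ 2 = ‖b‖ ^ 2 := by
      rw [hnorm b, h, inner_self_eq_norm_sq_to_K]; norm_cast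
    rw [tendsto_iff_norm_sub_tendsto_zero]
    have h2 : Tendsto (fun x => ‖b‖ ^ 2 - 2 * (⟪T 𝒱 b, U x b⟫').re + ‖T 𝒱 b‖ ^ 2) 𝒱
        (𝓝 (‖b‖ ^ 2 - 2 * (⟪T 𝒱 b, T 𝒱 b⟫').re + ‖T 𝒱 b‖ ^ 2)) :=
      (tendsto_const_nhds.sub (((Complex.continuous_re.tendsto _).comp (hT 𝒱 b _)).const_mul 2)).add_const _
    have h3 : (⟪T 𝒱 b, T 𝒱 b⟫').re = ‖T 𝒱 b‖ ^ 2 := by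
      rw [inner_self_eq_norm_sq_to_K]; norm_cast
    rw [h3, h1, show ‖b‖ ^ 2 - 2 * ‖b‖ ^ 2 + ‖b‖ ^ 2 = 0 by ring] at h2
    have h4 := (Real.continuous_sqrt.tendsto _).comp h2
    rw [Real.sqrt_zero] at h4
    refine h4.congr fun x => ?_
    rw [Function.comp_apply, ← Real.sqrt_sq (norm_nonneg (U x b - T 𝒱 b)), norm_sub_sq (𝕜 := ℂ), hn, h1,
      ← inner_conj_symm (U x b)]
    simp only [RCLike.re_to_complex, Complex.conj_re]
  · left
    have h1 := hnorm b
    rw [h, inner_zero_right] at h1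
    have : T 𝒱 b = 0 := by
      rw [← norm_eq_zero]; simpa using h1
    rw [← this]; exact hT 𝒱 b
end Hilb

/-! ### the density functional -/
section Dens
open Filter Topology ComplexConjugate
variable {d : ℕ}

def mean (d : ℕ) : (Rd d → ℂ) →ₗ[ℂ] ℂ := (exists_meanC (Rd d)).choose
lemma mean_le (F : Rd d → ℝ) (hF : ∃ C, ∀ t, |F t| ≤ C) (C : ℝ) (h : ∀ t, F t ≤ C) :
    (mean d fun t => (F t : ℂ)).re ≤ C := (exists_meanC (Rd d)).choose_spec.1 F hF C h
lemma mean_shift (F : Rd d → ℂ) (hF : ∃ C, ∀ t, ‖F t‖ ≤ C) (g : Rd d) :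
    mean d (fun t => F (t + g)) = mean d F := (exists_meanC (Rd d)).choose_spec.2.1 F hF g
lemma mean_neg (F : Rd d → ℂ) (hF : ∃ C, ∀ t, ‖F t‖ ≤ C) :
    mean d (fun t => F (-t)) = mean d F := (exists_meanC (Rd d)).choose_spec.2.2.1 F hF
lemma mean_conj (F : Rd d → ℂ) : mean d (fun t => conj (F t)) = conj (mean d F) :=
  (exists_meanC (Rd d)).choose_spec.2.2.2 F

variable {ω : Rd d → ℝ}

/-- weighted translation bounded -/
def TBle (ω : Rd d → ℝ) (g : Rd d → ℂ) (M : ℝ) : Prop :=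
  ∀ t, ∀ s : Finset (Rd d), ∑ x ∈ s, ‖g x‖ * ω (x - t) ≤ M
def TB (ω : Rd d → ℝ) (g : Rd d → ℂ) : Prop := ∃ M, TBle ω g M

def SS (ω : Rd d → ℝ) (g : Rd d → ℂ) (t : Rd d) : ℂ := ∑' x, g x * ω (x - t)
def II (ω : Rd d → ℝ) (g : Rd d → ℂ) : ℂ := mean d (SS ω g)

lemma TB.add {g h : Rd d → ℂ} (hω : ∀ x, 0 ≤ ω x) : TB ω g → TB ω h → TB ω (fun x => g x + h x) := by
  rintro ⟨M, hM⟩ ⟨N, hN⟩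
  refine ⟨M + N, fun t s => (Finset.sum_le_sum fun x _ => mul_le_mul_of_nonneg_right (norm_add_le _ _) (hω _)).trans ?_⟩
  simp only [add_mul, Finset.sum_add_distrib]
  exact add_le_add (hM t s) (hN t s)

lemma TB.smul {g : Rd d → ℂ} (c : ℂ) : TB ω g → TB ω (fun x => c * g x) := by
  rintro ⟨M, hM⟩
  refine ⟨‖c‖ * M, fun t s => ?_⟩
  simp only [norm_mul, mul_assoc, ← Finset.mul_sum]
  exact mul_le_mul_of_nonneg_left (hM t s) (norm_nonneg c)

lemma TB.mono {g h : Rd d → ℂ} (hω : ∀ x, 0 ≤ ω x) (hgh : ∀ x, ‖g x‖ ≤ ‖h x‖) : TB ω h → TB ω g := by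
  rintro ⟨M, hM⟩
  exact ⟨M, fun t s => (Finset.sum_le_sum fun x _ => mul_le_mul_of_nonneg_right (hgh x) (hω _)).trans (hM t s)⟩

lemma TBle.shift {g : Rd d → ℂ} {M : ℝ} (y : Rd d) (h : TBle ω g M) : TBle ω (fun x => g (x + y)) M := by
  intro t s
  have := h (t + y) (s.map (Equiv.addRight y).toEmbedding)
  simpa using this

lemma TBle.summable {g : Rd d → ℂ} {M : ℝ} (hω : ∀ x, 0 ≤ ω x) (h : TBle ω g M) (t : Rd d) :
    Summable fun x => ‖g x * ω (x - t)‖ := by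
  refine summable_of_sum_le (c := M) (fun x => norm_nonneg _) fun s => ?_
  simpa [abs_of_nonneg (hω _)] using h t s

lemma TBle.tsum_le {g : Rd d → ℂ} {M : ℝ} (hω : ∀ x, 0 ≤ ω x) (h : TBle ω g M) (t : Rd d) :
    ‖SS ω g t‖ ≤ M := by
  refine (norm_tsum_le_tsum_norm (h.summable hω t)).trans ?_
  refine Real.tsum_le_of_sum_le (fun x => norm_nonneg _) fun s => ?_
  simpa [abs_of_nonneg (hω _)] using h t s

lemma II_add {g h : Rd d → ℂ} (hω : ∀ x, 0 ≤ ω x) (hg : TB ω g) (hh : TB ω h) :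
    II ω (fun x => g x + h x) = II ω g + II ω h := by
  obtain ⟨M, hM⟩ := hg
  obtain ⟨N, hN⟩ := hh
  rw [II, II, II, ← map_add]
  congr 1; ext t
  rw [Pi.add_apply, SS, SS, SS, ← (hM.summable hω t).of_norm.tsum_add (hN.summable hω t).of_norm]
  simp only [add_mul]

lemma II_smul (g : Rd d → ℂ) (c : ℂ) : II ω (fun x => c * g x) = c * II ω g := by
  rw [II, II, ← smul_eq_mul c (mean d (SS ω g)), ← map_smul]
  congr 1; ext t
  simp only [SS, Pi.smul_apply, smul_eq_mul, mul_assoc, tsum_mul_left]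

lemma II_conj (g : Rd d → ℂ) : II ω (fun x => conj (g x)) = conj (II ω g) := by
  rw [II, II, ← mean_conj]
  congr 1; ext t
  simp only [SS]
  rw [Complex.conj_tsum]
  simp

lemma II_shift {g : Rd d → ℂ} (hω : ∀ x, 0 ≤ ω x) (hg : TB ω g) (y : Rd d) :
    II ω (fun x => g (x + y)) = II ω g := by
  obtain ⟨M, hM⟩ := hg
  rw [II, II, ← mean_shift (SS ω g) ⟨M, hM.tsum_le hω⟩ y]
  congr 1; ext t
  rw [SS, SS, ← (Equiv.addRight y).tsum_eq fun x => g x * (ω (x - (t + y)) : ℂ)]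
  simp

/-- real version -/
def JJ (ω : Rd d → ℝ) (g : Rd d → ℝ) : ℝ := (II ω fun x => (g x : ℂ)).re
def TBr (ω : Rd d → ℝ) (g : Rd d → ℝ) : Prop := TB ω fun x => (g x : ℂ)

lemma JJ_add {g h : Rd d → ℝ} (hω : ∀ x, 0 ≤ ω x) (hg : TBr ω g) (hh : TBr ω h) :
    JJ ω (fun x => g x + h x) = JJ ω g + JJ ω h := by
  rw [JJ, JJ, JJ, ← Complex.add_re, ← II_add hω hg hh]; simp

lemma JJ_smul (g : Rd d → ℝ) (c : ℝ) : JJ ω (fun x => c * g x) = c * JJ ω g := by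
  have := II_smul (ω := ω) (fun x => (g x : ℂ)) c
  rw [JJ, JJ]; push_cast
  rw [this]; simp

lemma TBr.add {g h : Rd d → ℝ} (hω : ∀ x, 0 ≤ ω x) (hg : TBr ω g) (hh : TBr ω h) :
    TBr ω (fun x => g x + h x) := by
  have := TB.add hω hg hh
  simpa [TBr] using this

lemma TBr.smul {g : Rd d → ℝ} (c : ℝ) (hg : TBr ω g) : TBr ω (fun x => c * g x) := by
  have := TB.smul (c : ℂ) hg
  simpa [TBr] using this

lemma TBr.mono {g h : Rd d → ℝ} (hω : ∀ x, 0 ≤ ω x) (hgh : ∀ x, |g x| ≤ |h x|) (hh : TBr ω h) :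
    TBr ω g := TB.mono hω (fun x => by simpa using hgh x) hh

lemma TBr.shift {g : Rd d → ℝ} (hg : TBr ω g) (y : Rd d) : TBr ω (fun x => g (x + y)) := by
  obtain ⟨M, h⟩ := hg
  exact ⟨M, h.shift y⟩

lemma JJ_shift {g : Rd d → ℝ} (hω : ∀ x, 0 ≤ ω x) (hg : TBr ω g) (y : Rd d) :
    JJ ω (fun x => g (x + y)) = JJ ω g := by
  rw [JJ, JJ, ← II_shift hω hg y]

lemma SS_real (g : Rd d → ℝ) (t : Rd d) :
    SS ω (fun x => (g x : ℂ)) t = ((∑' x, g x * ω (x - t) : ℝ) : ℂ) := by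
  rw [SS]; push_cast; rfl

lemma JJ_le {g : Rd d → ℝ} (hω : ∀ x, 0 ≤ ω x) (hg : TBr ω g) {C : ℝ}
    (h : ∀ t, ∑' x, g x * ω (x - t) ≤ C) : JJ ω g ≤ C := by
  obtain ⟨M, hM⟩ := hg
  have e : SS ω (fun x => (g x : ℂ)) = fun t => ((∑' x, g x * ω (x - t) : ℝ) : ℂ) :=
    funext fun t => SS_real g t
  rw [JJ, II, e]
  refine mean_le _ ⟨M, fun t => ?_⟩ C h
  have := hM.tsum_le hω t
  rwa [SS_real, Complex.norm_real, Real.norm_eq_abs] at this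

lemma JJ_le_of_TBle {g : Rd d → ℝ} (hω : ∀ x, 0 ≤ ω x) {C : ℝ}
    (h : TBle ω (fun x => (g x : ℂ)) C) : JJ ω g ≤ C :=
  JJ_le hω ⟨C, h⟩ fun t => by
    have := h.tsum_le hω t
    rw [SS_real, Complex.norm_real, Real.norm_eq_abs] at this
    exact (le_abs_self _).trans this

lemma JJ_nonneg {g : Rd d → ℝ} (hω : ∀ x, 0 ≤ ω x) (hg : TBr ω g) (h : ∀ x, 0 ≤ g x) :
    0 ≤ JJ ω g := by
  have h1 := JJ_le (C := 0) hω (hg.smul (-1)) fun t => tsum_nonpos fun x => by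
    nlinarith [mul_nonneg (h x) (hω (x - t))]
  rw [JJ_smul] at h1
  linarith

lemma JJ_mono {g h : Rd d → ℝ} (hω : ∀ x, 0 ≤ ω x) (hg : TBr ω g) (hh : TBr ω h)
    (hgh : ∀ x, g x ≤ h x) : JJ ω g ≤ JJ ω h := by
  have h1 := JJ_nonneg hω (hh.add hω (hg.smul (-1))) fun x => by linarith [hgh x]
  rw [JJ_add hω hh (hg.smul (-1)), JJ_smul] at h1
  linarith

lemma TBr_zero : TBr ω (fun _ => 0) := ⟨0, fun t s => by simp⟩

lemma JJ_zero : JJ ω (fun _ => 0) = 0 := by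
  have := JJ_smul (ω := ω) (fun _ => 0) 0
  simpa using this

lemma TBr.sum {ι : Type*} (s : Finset ι) {g : ι → Rd d → ℝ} (hω : ∀ x, 0 ≤ ω x)
    (hg : ∀ i ∈ s, TBr ω (g i)) : TBr ω (fun x => ∑ i ∈ s, g i x) := by
  classical
  induction s using Finset.induction_on with
  | empty => simpa using TBr_zero
  | insert i s hi ih =>
    simp only [Finset.sum_insert hi]
    exact (hg i (Finset.mem_insert_self _ _)).add hω (ih fun j hj => hg j (Finset.mem_insert_of_mem hj))

lemma JJ_sum {ι : Type*} (s : Finset ι) {g : ι → Rd d → ℝ} (hω : ∀ x, 0 ≤ ω x)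
    (hg : ∀ i ∈ s, TBr ω (g i)) : JJ ω (fun x => ∑ i ∈ s, g i x) = ∑ i ∈ s, JJ ω (g i) := by
  classical
  induction s using Finset.induction_on with
  | empty => simpa using JJ_zero
  | insert i s hi ih =>
    simp only [Finset.sum_insert hi]
    rw [JJ_add hω (hg i (Finset.mem_insert_self _ _)) (TBr.sum s hω fun j hj => hg j (Finset.mem_insert_of_mem hj)),
      ih fun j hj => hg j (Finset.mem_insert_of_mem hj)]
end Dens

/-! ### the Hilbert space -/
section KSpace
open Filter Topology ComplexConjugate
variable {d : ℕ}

abbrev nsq (g : Rd d → ℂ) : Rd d → ℝ := fun x => ‖g x‖ ^ 2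

def Dle (ω : Rd d → ℝ) (g : Rd d → ℂ) (C : ℝ) : Prop := TBle ω (fun x => ((nsq g x : ℝ) : ℂ)) C

structure Setup (d : ℕ) where
  ω : Rd d → ℝ
  hω : ∀ x, 0 ≤ ω x
  ω0 : ω 0 = 1
  ωsum : ∀ Y : Set (Rd d), UniformlyDiscrete Y → TBr ω (Y.indicator 1)
  VV : Submodule ℂ (Rd d → ℂ)
  hL2 : ∀ g ∈ VV, TBr ω (nsq g)
  hinv : ∀ g ∈ VV, ∀ y, (fun x => g (x + y)) ∈ VV
  C1 : ℝ
  hA : ∀ g ∈ VV, Dle ω g (C1 * JJ ω (nsq g))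

variable {ω : Rd d → ℝ}

lemma sq_add_le (g h : Rd d → ℂ) (x : Rd d) : nsq (g + h) x ≤ 2 * nsq g x + 2 * nsq h x := by
  have := norm_add_le (g x) (h x)
  simp only [nsq, Pi.add_apply]
  nlinarith [sq_nonneg (‖g x‖ - ‖h x‖), norm_nonneg (g x + h x)]

lemma Dle.add (hω : ∀ x, 0 ≤ ω x) {g h : Rd d → ℂ} {C C' : ℝ} (hg : Dle ω g C) (hh : Dle ω h C') :
    Dle ω (g + h) (2 * C + 2 * C') := by
  intro t s
  have h1 := hg t s; have h2 := hh t s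
  refine le_trans (Finset.sum_le_sum (g := fun x => 2 * (‖((nsq g x : ℝ) : ℂ)‖ * ω (x - t)) + 2 * (‖((nsq h x : ℝ) : ℂ)‖ * ω (x - t))) fun x _ => ?_) ?_
  · have := mul_le_mul_of_nonneg_right (sq_add_le g h x) (hω (x - t))
    simp only [Complex.norm_real, norm_pow, norm_norm, nsq] at *
    linarith
  · rw [Finset.sum_add_distrib, ← Finset.mul_sum, ← Finset.mul_sum]; linarith

lemma Dle.mono {g : Rd d → ℂ} {C C' : ℝ} (hg : Dle ω g C) (h : C ≤ C') : Dle ω g C' :=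
  fun t s => (hg t s).trans h

lemma Dle.smul {g : Rd d → ℂ} {C : ℝ} (hg : Dle ω g C) (c : ℂ) : Dle ω (c • g) (‖c‖ ^ 2 * C) := by
  intro t s
  have := mul_le_mul_of_nonneg_left (hg t s) (sq_nonneg ‖c‖)
  rw [Finset.mul_sum] at this
  refine le_trans (le_of_eq (Finset.sum_congr rfl fun x _ => ?_)) this
  simp [nsq]; ring

lemma Dle.neg {g : Rd d → ℂ} {C : ℝ} (hg : Dle ω g C) : Dle ω (-g) C := by
  simpa using hg.smul (-1)

lemma Dle.shift {g : Rd d → ℂ} {C : ℝ} (hg : Dle ω g C) (y : Rd d) : Dle ω (fun x => g (x + y)) C :=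
  TBle.shift y hg

lemma Dle.TBr {g : Rd d → ℂ} {C : ℝ} (hg : Dle ω g C) : TBr ω (nsq g) := ⟨C, hg⟩

lemma Dle.JJ {g : Rd d → ℂ} {C : ℝ} (hω : ∀ x, 0 ≤ ω x) (hg : Dle ω g C) : JJ ω (nsq g) ≤ C :=
  JJ_le_of_TBle hω hg

lemma Dle.le (hω : ∀ x, 0 ≤ ω x) (ω0 : ω 0 = 1) {g : Rd d → ℂ} {C : ℝ} (hg : Dle ω g C) (x : Rd d) :
    ‖g x‖ ^ 2 ≤ C := by
  simpa [ω0] using hg x {x}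

lemma Dle_of_tendsto {g : ℕ → Rd d → ℂ} {h : Rd d → ℂ} {C : ℝ}
    (hg : ∀ᶠ n in atTop, Dle ω (g n) C)
    (hl : ∀ x, Tendsto (fun n => g n x) atTop (𝓝 (h x))) : Dle ω h C := by
  intro t s
  refine le_of_tendsto (tendsto_finsetSum s fun x _ => (?_ : Tendsto (fun n => ‖((nsq (g n) x : ℝ) : ℂ)‖ * ω (x - t)) atTop _)) (hg.mono fun n hn => hn t s)
  refine Tendsto.mul_const _ ?_
  simp only [Complex.norm_real, norm_pow, norm_norm, nsq]
  exact (hl x).norm.pow 2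

variable (c : Setup d)

def Setup.K : Submodule ℂ (Rd d → ℂ) where
  carrier := {w | ∀ ε > 0, ∃ g ∈ c.VV, Dle c.ω (w - g) ε}
  add_mem' := by
    intro w w' h h' ε hε
    obtain ⟨g, hg, h⟩ := h (ε / 4) (by positivity)
    obtain ⟨g', hg', h'⟩ := h' (ε / 4) (by positivity)
    refine ⟨g + g', add_mem hg hg', ?_⟩
    have := (h.add c.hω h').mono (C' := ε) (by linarith)
    rwa [show w + w' - (g + g') = w - g + (w' - g') by abel]
  zero_mem' := fun ε hε => ⟨0, zero_mem _, fun t s => by simpa [nsq] using hε.le⟩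
  smul_mem' := by
    intro z w h ε hε
    obtain ⟨g, hg, h⟩ := h (ε / (‖z‖ ^ 2 + 1)) (by positivity)
    refine ⟨z • g, Submodule.smul_mem _ z hg, ?_⟩
    rw [← smul_sub]
    refine (h.smul z).mono ?_
    rw [mul_div_assoc', div_le_iff₀ (by positivity)]
    nlinarith

lemma Setup.VK : c.VV ≤ c.K := fun g hg ε hε => ⟨g, hg, fun t s => by simpa [nsq] using hε.le⟩

lemma Setup.KL2 {w : Rd d → ℂ} (hw : w ∈ c.K) : TBr c.ω (nsq w) := by
  obtain ⟨g, hg, h⟩ := hw 1 one_pos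
  obtain ⟨C, hC⟩ := c.hL2 g hg
  have : Dle c.ω (w - g + g) _ := h.add c.hω (show Dle c.ω g C from hC)
  rw [sub_add_cancel] at this
  exact this.TBr

lemma Setup.Kshift {w : Rd d → ℂ} (hw : w ∈ c.K) (y : Rd d) : (fun x => w (x + y)) ∈ c.K := by
  intro ε hε
  obtain ⟨g, hg, h⟩ := hw ε hε
  exact ⟨_, c.hinv g hg y, h.shift y⟩

lemma JJ_sq_add (hω : ∀ x, 0 ≤ ω x) {g h : Rd d → ℂ} (hg : TBr ω (nsq g)) (hh : TBr ω (nsq h)) :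
    JJ ω (nsq (g + h)) ≤ 2 * JJ ω (nsq g) + 2 * JJ ω (nsq h) := by
  rw [← JJ_smul, ← JJ_smul, ← JJ_add hω (hg.smul 2) (hh.smul 2)]
  have hT := (hg.smul 2).add hω (hh.smul 2)
  refine JJ_mono hω (hT.mono hω fun x => ?_) hT (sq_add_le g h)
  have := sq_add_le g h x
  rw [abs_of_nonneg (by positivity), abs_of_nonneg (by positivity)]
  exact this

lemma Setup.KD {w : Rd d → ℂ} (hw : w ∈ c.K) : Dle c.ω w (4 * |c.C1| * JJ c.ω (nsq w)) := by
  suffices ∀ ε > 0, Dle c.ω w (4 * |c.C1| * JJ c.ω (nsq w) + (2 + 4 * |c.C1|) * ε) by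
    intro t s
    refine le_of_forall_pos_le_add fun δ hδ => ?_
    have := this (δ / (2 + 4 * |c.C1|)) (by positivity) t s
    rwa [mul_div_cancel₀ _ (by positivity)] at this
  intro ε hε
  obtain ⟨g, hg, h⟩ := hw ε hε
  have h1 := h.add c.hω (c.hA g hg)
  rw [sub_add_cancel] at h1
  have h2 := JJ_sq_add c.hω (c.KL2 hw) h.neg.TBr
  rw [show w + -(w - g) = g by abel] at h2
  have h3 := h.neg.JJ c.hω
  have h4 := JJ_nonneg c.hω (c.hL2 g hg) fun x => sq_nonneg _
  refine h1.mono ?_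
  have h5 := mul_le_mul_of_nonneg_right (le_abs_self c.C1) h4
  have h6 := mul_le_mul_of_nonneg_left (h2.trans (add_le_add_right (mul_le_mul_of_nonneg_left h3 zero_le_two) _)) (abs_nonneg c.C1)
  nlinarith

def inn (ω : Rd d → ℝ) (w w' : Rd d → ℂ) : ℂ := II ω fun x => conj (w x) * w' x

lemma inn_TB (hω : ∀ x, 0 ≤ ω x) {w w' : Rd d → ℂ} (h : TBr ω (nsq w)) (h' : TBr ω (nsq w')) :
    TB ω fun x => conj (w x) * w' x := by
  refine TB.mono hω (fun x => ?_) (h.add hω h')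
  simp only [norm_mul, RCLike.norm_conj, Complex.norm_real, nsq]
  rw [Real.norm_of_nonneg (by positivity)]
  nlinarith [sq_nonneg (‖w x‖ - ‖w' x‖), sq_nonneg (‖w x‖ + ‖w' x‖)]

lemma inn_self (w : Rd d → ℂ) : (inn ω w w).re = JJ ω (nsq w) := by
  rw [inn, JJ]
  congr 2; ext x
  rw [mul_comm, Complex.mul_conj']; simp

def Setup.KT : Type := c.K
instance : AddCommGroup c.KT := inferInstanceAs (AddCommGroup c.K)
instance : Module ℂ c.KT := inferInstanceAs (Module ℂ c.K)

def Setup.fn : c.KT →ₗ[ℂ] (Rd d → ℂ) := c.K.subtype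

lemma Setup.fn_mem (w : c.KT) : c.fn w ∈ c.K := w.2
lemma Setup.fn_inj {w w' : c.KT} (h : c.fn w = c.fn w') : w = w' := Subtype.ext h
lemma Setup.fnTB (w : c.KT) : TBr c.ω (nsq (c.fn w)) := c.KL2 (c.fn_mem w)

def Setup.core : InnerProductSpace.Core ℂ c.KT where
  inner w w' := inn c.ω (c.fn w) (c.fn w')
  conj_inner_symm w w' := by
    change conj (inn _ _ _) = inn _ _ _
    rw [inn, ← II_conj, inn]; congr 1; ext x; simp [mul_comm]
  re_inner_nonneg w := by
    change 0 ≤ (inn _ _ _).re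
    rw [inn_self]; exact JJ_nonneg c.hω (c.fnTB w) fun x => sq_nonneg _
  add_left u v w := by
    change inn _ _ _ = inn _ _ _ + inn _ _ _
    rw [inn, inn, inn, ← II_add c.hω (inn_TB c.hω (c.fnTB u) (c.fnTB w)) (inn_TB c.hω (c.fnTB v) (c.fnTB w))]
    simp only [map_add, Pi.add_apply, add_mul]
  smul_left u v r := by
    change inn _ _ _ = _ * inn _ _ _
    rw [inn, inn, ← II_smul]; simp [mul_assoc]
  definite w h := by
    have h1 : JJ c.ω (nsq (c.fn w)) = 0 := by
      rw [← inn_self]; change inn _ _ _ = 0 at h; rw [h]; rfl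
    have h2 := c.KD (c.fn_mem w)
    rw [h1, mul_zero] at h2
    refine c.fn_inj (funext fun x => ?_)
    have := h2.le c.hω c.ω0 x
    simpa using this

instance : NormedAddCommGroup c.KT := c.core.toNormedAddCommGroup
instance : InnerProductSpace ℂ c.KT := InnerProductSpace.ofCore c.core.toCore

lemma Setup.inner_def (w w' : c.KT) : inner ℂ w w' = inn c.ω (c.fn w) (c.fn w') := rfl

lemma Setup.norm_sq (w : c.KT) : ‖w‖ ^ 2 = JJ c.ω (nsq (c.fn w)) := by
  rw [← inn_self, ← c.inner_def, ← inner_self_eq_norm_sq (𝕜 := ℂ)]; rfl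

def Setup.C0 : ℝ := 4 * |c.C1|
lemma Setup.C0_nonneg : 0 ≤ c.C0 := by unfold Setup.C0; positivity

lemma Setup.fnD (w : c.KT) : Dle c.ω (c.fn w) (c.C0 * ‖w‖ ^ 2) := by
  rw [c.norm_sq]; exact c.KD (c.fn_mem w)

lemma Setup.ev (w : c.KT) (x : Rd d) : ‖c.fn w x‖ ^ 2 ≤ c.C0 * ‖w‖ ^ 2 := (c.fnD w).le c.hω c.ω0 x

lemma Setup.ev' (w : c.KT) (x : Rd d) : ‖c.fn w x‖ ≤ √c.C0 * ‖w‖ := by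
  rw [← Real.sqrt_sq (norm_nonneg w), ← Real.sqrt_mul c.C0_nonneg]
  exact Real.le_sqrt_of_sq_le (c.ev w x)

lemma Setup.norm_le {w : c.KT} {C : ℝ} (h : Dle c.ω (c.fn w) C) : ‖w‖ ^ 2 ≤ C := by
  rw [c.norm_sq]; exact h.JJ c.hω

def Setup.evL (x : Rd d) : c.KT →L[ℂ] ℂ :=
  ((LinearMap.proj x).comp c.fn : c.KT →ₗ[ℂ] ℂ).mkContinuous (√c.C0) fun w => c.ev' w x

lemma Setup.evL_apply (x : Rd d) (w : c.KT) : c.evL x w = c.fn w x := rfl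

instance : CompleteSpace c.KT := by
  refine Metric.complete_of_cauchySeq_tendsto fun u hu => ?_
  have h1 : ∀ x, ∃ l, Tendsto (fun n => c.fn (u n) x) atTop (𝓝 l) := fun x =>
    cauchySeq_tendsto_of_complete ((c.evL x).uniformContinuous.comp_cauchySeq hu)
  choose w hw using h1
  have h2 : ∀ ε > 0, ∃ N, ∀ n ≥ N, Dle c.ω (w - c.fn (u n)) ε := by
    intro ε hε
    obtain ⟨δ, hδ, hδε⟩ : ∃ δ > 0, c.C0 * δ ^ 2 ≤ ε := by
      refine ⟨√(ε / (c.C0 + 1)), Real.sqrt_pos.2 (div_pos hε (by linarith [c.C0_nonneg])), ?_⟩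
      have := c.C0_nonneg
      rw [Real.sq_sqrt (by positivity), mul_div_assoc', div_le_iff₀ (by positivity)]
      nlinarith
    obtain ⟨N, hN⟩ := Metric.cauchySeq_iff.1 hu δ hδ
    refine ⟨N, fun n hn => Dle_of_tendsto (g := fun m => c.fn (u m) - c.fn (u n)) ?_ fun x => ?_⟩
    · filter_upwards [eventually_ge_atTop N] with m hm
      rw [← map_sub]
      refine (c.fnD _).mono (le_trans (mul_le_mul_of_nonneg_left ?_ c.C0_nonneg) hδε)
      have := hN m hm n hn
      rw [dist_eq_norm] at this
      exact pow_le_pow_left₀ (norm_nonneg _) this.le 2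
    · exact (hw x).sub_const _
  have hwK : w ∈ c.K := by
    intro ε hε
    obtain ⟨N, hN⟩ := h2 (ε / 4) (by positivity)
    obtain ⟨g, hg, h⟩ := c.fn_mem (u N) (ε / 4) (by positivity)
    refine ⟨g, hg, ?_⟩
    have := ((hN N le_rfl).add c.hω h).mono (C' := ε) (by linarith)
    rwa [sub_add_sub_cancel] at this
  let w' : c.KT := ⟨w, hwK⟩
  have hfw : c.fn w' = w := rfl
  refine ⟨w', ?_⟩
  rw [Metric.tendsto_atTop]
  intro ε hε
  obtain ⟨N, hN⟩ := h2 (ε ^ 2 / 4) (by positivity)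
  refine ⟨N, fun n hn => ?_⟩
  rw [dist_comm, dist_eq_norm]
  have : Dle c.ω (c.fn (w' - u n)) (ε ^ 2 / 4) := by
    rw [map_sub, hfw]; exact hN n hn
  have := c.norm_le this
  by_contra! h
  nlinarith [norm_nonneg (w' - u n)]

def Setup.U (y : Rd d) : c.KT →ₗ[ℂ] c.KT where
  toFun w := ⟨fun x => c.fn w (x + y), c.Kshift (c.fn_mem w) y⟩
  map_add' u v := c.fn_inj (by ext x; simp [Setup.fn]; rfl)
  map_smul' r v := c.fn_inj (by ext x; simp [Setup.fn]; rfl)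

lemma Setup.fnU (y x : Rd d) (w : c.KT) : c.fn (c.U y w) x = c.fn w (x + y) := rfl

lemma Setup.normU (y : Rd d) (w : c.KT) : ‖c.U y w‖ = ‖w‖ := by
  rw [← sq_eq_sq₀ (norm_nonneg _) (norm_nonneg _), c.norm_sq, c.norm_sq]
  exact JJ_shift c.hω (c.fnTB w) y

lemma Setup.Uadd (x y : Rd d) (w : c.KT) : c.U (x + y) w = c.U x (c.U y w) :=
  c.fn_inj (by ext z; simp only [c.fnU, add_assoc])

lemma Setup.Uzero : c.U 0 = LinearMap.id :=
  LinearMap.ext fun w => c.fn_inj (by ext z; simp [c.fnU])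
end KSpace

section Core
open Filter Topology ComplexConjugate
variable {d : ℕ} (c : Setup d)

lemma Setup.bessel {n : ℕ} {e : Fin n → c.KT} (he : Orthonormal ℂ e) (x : Rd d) :
    ∑ i, ‖c.fn (e i) x‖ ^ 2 ≤ c.C0 := by
  set s := ∑ i, ‖c.fn (e i) x‖ ^ 2 with hs
  have hs0 : 0 ≤ s := by positivity
  set w : c.KT := ∑ i, conj (c.fn (e i) x) • e i with hw
  have h1 : c.fn w x = (s : ℂ) := by
    rw [hw, map_sum, Finset.sum_apply, hs, Complex.ofReal_sum]
    refine Finset.sum_congr rfl fun i _ => ?_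
    rw [map_smul, Pi.smul_apply, smul_eq_mul, Complex.conj_mul']
    push_cast; rfl
  have h2 : ‖w‖ ^ 2 = s := by
    have h := he.inner_sum (fun i => conj (c.fn (e i) x)) (fun i => conj (c.fn (e i) x)) Finset.univ
    rw [← hw, inner_self_eq_norm_sq_to_K] at h
    have h3 : ((‖w‖ ^ 2 : ℝ) : ℂ) = ((s : ℝ) : ℂ) := by
      push_cast
      refine (h.trans ?_)
      rw [hs]; push_cast
      refine Finset.sum_congr rfl fun i _ => ?_
      rw [Complex.conj_conj, Complex.mul_conj']
    exact_mod_cast h3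
  have h4 := c.ev w x
  rw [h1, h2, Complex.norm_real, Real.norm_of_nonneg hs0] at h4
  by_contra hlt
  push Not at hlt
  nlinarith [c.C0_nonneg]

lemma Setup.card_eq {n : ℕ} {e : Fin n → c.KT} (he : Orthonormal ℂ e) :
    (n : ℝ) = JJ c.ω (fun x => ∑ i, ‖c.fn (e i) x‖ ^ 2) := by
  rw [JJ_sum Finset.univ c.hω fun i _ => c.fnTB (e i)]
  have : ∀ i, JJ c.ω (fun x => ‖c.fn (e i) x‖ ^ 2) = 1 := fun i => by
    have := c.norm_sq (e i)
    rw [he.1 i] at this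
    simpa using this.symm
  simp [this]

lemma onb {H : Type*} [NormedAddCommGroup H] [InnerProductSpace ℂ H] (T : Finset H)
    (hT : LinearIndependent ℂ ((↑) : T → H)) :
    ∃ e : Fin T.card → H, Orthonormal ℂ e ∧ ∀ i, e i ∈ Submodule.span ℂ (T : Set H) := by
  have hf : Module.finrank ℂ (Submodule.span ℂ (T : Set H)) = T.card := by
    have := finrank_span_eq_card hT
    rw [Subtype.range_coe_subtype] at this
    simpa using this
  let B := stdOrthonormalBasis ℂ (Submodule.span ℂ (T : Set H))
  have h := B.orthonormal
  have h2 := h.comp (Fin.cast hf.symm) (Fin.cast_injective _)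
  refine ⟨fun i => (B (Fin.cast hf.symm i) : H), ?_, fun i => (B _).2⟩
  exact h2.comp_linearIsometry (Submodule.span ℂ (T : Set H)).subtypeₗᵢ

lemma FD_of {H : Type*} [NormedAddCommGroup H] [InnerProductSpace ℂ H] (S : Set H) (N : ℕ)
    (h : ∀ T : Finset H, (T : Set H) ⊆ S → LinearIndependent ℂ ((↑) : T → H) → T.card ≤ N) :
    FiniteDimensional ℂ (Submodule.span ℂ S) := by
  obtain ⟨b, hbS, hb, hli⟩ := exists_linearIndependent ℂ S
  have hfin : b.Finite := by
    by_contra hinf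
    obtain ⟨T, hT, hc⟩ := Set.Infinite.exists_subset_card_eq hinf (N + 1)
    have := h T (hT.trans hbS) (LinearIndepOn.mono (v := id) (s := b) (t := (T : Set H)) hli hT)
    omega
  rw [← hb]
  exact FiniteDimensional.span_of_finite ℂ hfin

lemma sepF (E : Submodule ℂ c.KT) [FiniteDimensional ℂ E] :
    ∃ F : Finset (Rd d), ∀ w ∈ E, (∀ x ∈ F, c.fn w x = 0) → w = 0 := by
  obtain ⟨F, hF⟩ := Finset.exists_inf_le (fun x : Rd d => LinearMap.ker ((c.evL x : c.KT →ₗ[ℂ] ℂ).comp E.subtype))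
  refine ⟨F, fun w hw h => c.fn_inj ?_⟩
  have h1 : (⟨w, hw⟩ : E) ∈ F.inf (fun x : Rd d => LinearMap.ker ((c.evL x : c.KT →ₗ[ℂ] ℂ).comp E.subtype)) := by
    rw [Submodule.mem_finsetInf]
    intro x hx
    rw [LinearMap.mem_ker]
    exact h x hx
  funext x
  have := hF x h1
  rw [LinearMap.mem_ker] at this
  rw [map_zero]
  exact this

def Setup.FL (Λ : Set (Rd d)) : Submodule ℂ c.KT where
  carrier := {w | ∀ x ∉ Λ, c.fn w x = 0}
  add_mem' := fun h h' x hx => by rw [map_add, Pi.add_apply, h x hx, h' x hx, add_zero]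
  zero_mem' := fun x _ => by rw [map_zero]; rfl
  smul_mem' := fun r w h x hx => by rw [map_smul, Pi.smul_apply, h x hx, smul_zero]

lemma Setup.FLfin {Λ : Set (Rd d)} (hΛ : UniformlyDiscrete Λ) : FiniteDimensional ℂ (c.FL Λ) := by
  have := FD_of (c.FL Λ : Set c.KT) ⌊c.C0 * JJ c.ω (Λ.indicator 1)⌋₊ (by
    intro T hT hli
    obtain ⟨e, he, hes⟩ := onb T hli
    have hes' : ∀ i, e i ∈ c.FL Λ := fun i => by
      have := Submodule.span_mono (R := ℂ) hT (hes i)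
      rwa [Submodule.span_eq] at this
    refine Nat.le_floor ?_
    rw [c.card_eq he, ← JJ_smul]
    refine JJ_mono c.hω (TBr.sum Finset.univ c.hω fun i _ => c.fnTB (e i)) ((c.ωsum Λ hΛ).smul _) fun x => ?_
    by_cases hx : x ∈ Λ
    · simpa [hx] using c.bessel he x
    · simp [hx, hes' _ x hx])
  rwa [Submodule.span_eq] at this

lemma Setup.WL_fn {𝒰 : Ultrafilter (Rd d)} {w v : c.KT} (h : WL c.U 𝒰 w v) (x : Rd d) :
    Tendsto (fun τ => c.fn w (x + τ)) 𝒰 (𝓝 (c.fn v x)) := by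
  have := h ((InnerProductSpace.toDual ℂ c.KT).symm (c.evL x))
  simpa [InnerProductSpace.toDual_symm_apply, c.evL_apply, c.fnU] using this

lemma Setup.Qfin {Λ : Set (Rd d)} (hΛ : UniformlyDiscrete Λ) (a : c.KT) :
    {w : c.KT | w ∈ c.FL Λ ∧ ∀ x, c.fn w x = 0 ∨ c.fn w x = c.fn a x}.Finite := by
  have := c.FLfin hΛ
  obtain ⟨F, hF⟩ := sepF c (c.FL Λ)
  refine Set.Finite.of_finite_image (f := fun w : c.KT => fun x : F => c.fn w x) ?_ ?_
  · refine (Set.Finite.pi' (t := fun x : F => ({0, c.fn a x} : Set ℂ)) fun x => by simp).subset ?_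
    rintro _ ⟨w, hw, rfl⟩ x
    exact hw.2 x
  · intro w hw w' hw' h
    refine sub_eq_zero.1 (hF _ (Submodule.sub_mem _ hw.1 hw'.1) fun x hx => ?_)
    have := congrFun h ⟨x, hx⟩
    rw [map_sub, Pi.sub_apply]
    exact sub_eq_zero.2 this

def GoodB (b : c.KT) : Prop :=
  ∀ 𝒱 : Ultrafilter (Rd d), WL c.U 𝒱 b 0 ∨ ∃ v, Tendsto (fun x => c.U x b) 𝒱 (𝓝 v)

lemma Setup.split {Λ : Set (Rd d)} (hΛ : UniformlyDiscrete Λ) (a : c.KT) (haΛ : a ∈ c.FL Λ)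
    (hVV : c.VV = Submodule.span ℂ (range fun y : Rd d => fun x => c.fn a (x + y)))
    (HT : Set (Ultrafilter (Rd d))) (HTadd : ∀ 𝒰 ∈ HT, ∀ 𝒱 ∈ HT, uadd 𝒰 𝒱 ∈ HT)
    (HTneg : ∀ 𝒱, uadd (𝒱.map Neg.neg) 𝒱 ∈ HT)
    (hex : ∀ 𝒰 ∈ HT, ∀ x, Tendsto (fun τ => c.fn a (x + τ)) (𝒰 : Filter (Rd d)) (𝓝 0) ∨
      Tendsto (fun τ => c.fn a (x + τ)) (𝒰 : Filter (Rd d)) (𝓝 (c.fn a x))) :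
    a ∈ Submodule.span ℂ {b | b ∈ c.FL Λ ∧ GoodB c b} := by
  have hcyc : (Submodule.span ℂ (range fun x => c.U x a)).topologicalClosure = ⊤ := by
    rw [eq_top_iff]
    intro w _
    rw [← SetLike.mem_coe, Submodule.topologicalClosure_coe, Metric.mem_closure_iff]
    intro ε hε
    obtain ⟨g, hg, hD⟩ := c.fn_mem w (ε ^ 2 / 2) (by positivity)
    have h1 : Submodule.map c.fn (Submodule.span ℂ (range fun x => c.U x a)) = c.VV := by
      rw [hVV, Submodule.map_span, ← Set.range_comp]
      rfl
    rw [← h1] at hg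
    obtain ⟨u, hu, rfl⟩ := hg
    refine ⟨u, hu, ?_⟩
    rw [dist_eq_norm]
    have h2 := c.norm_le (w := w - u) (by rw [map_sub]; exact hD)
    nlinarith [norm_nonneg (w - u)]
  have key := hilb_split (U := c.U) c.Uzero c.Uadd c.normU a hcyc HT HTadd HTneg
    {w : c.KT | w ∈ c.FL Λ ∧ ∀ x, c.fn w x = 0 ∨ c.fn w x = c.fn a x} (c.Qfin hΛ a) (by
      intro 𝒰 hU v hv
      have h1 : ∀ x, c.fn v x = 0 ∨ c.fn v x = c.fn a x := fun x => by
        rcases hex 𝒰 hU x with h | h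
        · exact Or.inl (tendsto_nhds_unique (c.WL_fn hv x) h)
        · exact Or.inr (tendsto_nhds_unique (c.WL_fn hv x) h)
      refine ⟨fun x hx => ?_, h1⟩
      rcases h1 x with h | h
      · exact h
      · rw [h, haΛ x hx])
  refine Submodule.span_mono ?_ key
  rintro b ⟨hb, hb2⟩
  refine ⟨?_, hb2⟩
  refine (Submodule.span_le.2 ?_) hb
  rintro w (rfl | hw)
  · exact haΛ
  · exact hw.1
end Core

section Core2
open Filter Topology ComplexConjugate
variable {d : ℕ} (c : Setup d)

lemma UniformlyDiscrete.mono {A B : Set (Rd d)} (hB : UniformlyDiscrete B) (h : A ⊆ B) :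
    UniformlyDiscrete A := by
  obtain ⟨η, h0, h1⟩ := hB
  exact ⟨η, h0, fun x hx y hy => h1 x (h hx) y (h hy)⟩

def Setup.S (b : c.KT) (θ : ℝ) : Set (Rd d) := {x | θ ≤ ‖c.fn b x‖}
def Setup.mu (A : Set (Rd d)) : ℝ := JJ c.ω (A.indicator 1)

lemma Setup.mu_mono {A B : Set (Rd d)} (hB : UniformlyDiscrete B) (h : A ⊆ B) : c.mu A ≤ c.mu B :=
  JJ_mono c.hω (c.ωsum A (hB.mono h)) (c.ωsum B hB) fun x =>
    Set.indicator_le_indicator_of_subset h (fun _ => zero_le_one) x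

lemma Setup.mu_nonneg {A : Set (Rd d)} (hA : UniformlyDiscrete A) : 0 ≤ c.mu A :=
  JJ_nonneg c.hω (c.ωsum A hA) fun x => Set.indicator_nonneg (fun _ _ => zero_le_one) x

variable {Λ : Set (Rd d)} (hΛ : UniformlyDiscrete Λ) {b : c.KT} (hb : b ∈ c.FL Λ)
include hΛ hb

omit hΛ in
lemma Setup.Ssub {θ : ℝ} (h : 0 < θ) : c.S b θ ⊆ Λ := fun x hx => by
  by_contra hx'
  have := hb x hx'
  rw [Setup.S, mem_setOf_eq, this, norm_zero] at hx
  linarith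

lemma Setup.mpos (hb0 : b ≠ 0) : ∃ θ > 0, 0 < c.mu (c.S b θ) := by
  by_contra hcon
  push Not at hcon
  have h1 : ∀ θ > 0, ‖b‖ ^ 2 ≤ θ ^ 2 * c.mu Λ := fun θ hθ => by
    have hSu := hΛ.mono (c.Ssub hb hθ)
    have : ‖b‖ ^ 2 ≤ (c.C0 * ‖b‖ ^ 2) * c.mu (c.S b θ) + θ ^ 2 * c.mu Λ := by
      generalize hBB : c.C0 * ‖b‖ ^ 2 = BB
      rw [c.norm_sq b, Setup.mu, Setup.mu, ← JJ_smul, ← JJ_smul, ← JJ_add c.hω ((c.ωsum _ hSu).smul _) ((c.ωsum _ hΛ).smul _)]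
      refine JJ_mono c.hω (c.fnTB b) (((c.ωsum _ hSu).smul _).add c.hω ((c.ωsum _ hΛ).smul _)) fun x => ?_
      by_cases hx : x ∈ c.S b θ
      · have h2 : x ∈ Λ := c.Ssub hb hθ hx
        have := c.ev b x
        simp only [Set.indicator_of_mem hx, Set.indicator_of_mem h2, Pi.one_apply, mul_one]
        rw [hBB] at this
        change ‖c.fn b x‖ ^ 2 ≤ _
        nlinarith [sq_nonneg θ]
      · by_cases h2 : x ∈ Λ
        · simp only [Set.indicator_of_notMem hx, Set.indicator_of_mem h2, Pi.one_apply, mul_one, mul_zero, zero_add]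
          rw [Setup.S, mem_setOf_eq, not_le] at hx
          exact pow_le_pow_left₀ (norm_nonneg _) hx.le 2
        · simp [hx, h2, hb x h2]
    have h3 := hcon θ hθ
    have h4 : 0 ≤ c.C0 * ‖b‖ ^ 2 := mul_nonneg c.C0_nonneg (by positivity)
    nlinarith [mul_nonneg h4 (neg_nonneg.2 h3)]
  have hmu := c.mu_nonneg hΛ
  have hb1 : 0 < ‖b‖ := norm_pos_iff.2 hb0
  have h5 := h1 (‖b‖ / (c.mu Λ + 2)) (by positivity)
  rw [div_pow, div_mul_eq_mul_div, le_div_iff₀ (by positivity)] at h5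
  have : 0 < ‖b‖ ^ 2 := by positivity
  have h6 : c.mu Λ < (c.mu Λ + 2) ^ 2 := by nlinarith
  nlinarith [mul_lt_mul_of_pos_left h6 this]

def Setup.TT (b : c.KT) (ε : ℝ) : Set (Rd d) := {τ | ‖c.U τ b - b‖ ≤ ε}
def Setup.EE (b : c.KT) (ε : ℝ) : Submodule ℂ c.KT := Submodule.span ℂ ((fun τ => c.U τ b) '' c.TT b ε)

lemma mu_shift_aux {θ θ0 ε δ : ℝ} (hθ : 0 < θ) (hθ0 : 0 < θ0) (hθθ : θ ≤ θ0 / 2) (hε : √c.C0 * ε ≤ θ0 / 2)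
    (hδ : c.mu (c.S b θ) ≤ c.mu (c.S b θ0) + δ) {τ : Rd d} (hτ : τ ∈ c.TT b ε) :
    TBr c.ω (({x | x + τ ∈ c.S b θ} \ c.S b θ).indicator 1) ∧
    c.mu ({x | x + τ ∈ c.S b θ} \ c.S b θ) ≤ δ := by
  have hA : UniformlyDiscrete (c.S b θ) := hΛ.mono (c.Ssub hb hθ)
  have hA0 : UniformlyDiscrete (c.S b θ0) := hΛ.mono (c.Ssub hb hθ0)
  have hsub : c.S b θ0 ⊆ c.S b θ := fun x hx => by
    simp only [Setup.S, mem_setOf_eq] at hx ⊢; linarith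
  have hD : UniformlyDiscrete (c.S b θ \ c.S b θ0) := hA.mono diff_subset
  have hT := c.ωsum _ hD
  have hle : ∀ x, ({x | x + τ ∈ c.S b θ} \ c.S b θ).indicator (1 : Rd d → ℝ) x ≤
      (c.S b θ \ c.S b θ0).indicator (1 : Rd d → ℝ) (x + τ) := fun x => by
    by_cases hx : x ∈ {x | x + τ ∈ c.S b θ} \ c.S b θ
    · have h2 : x + τ ∈ c.S b θ \ c.S b θ0 := by
        refine ⟨hx.1, fun h => ?_⟩
        have h3 := hx.2
        simp only [Setup.S, mem_setOf_eq, not_le] at h h3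
        have h4 := c.ev' (c.U τ b - b) x
        rw [map_sub, Pi.sub_apply, c.fnU] at h4
        have h5 := mul_le_mul_of_nonneg_left hτ (Real.sqrt_nonneg c.C0)
        have h6 := norm_sub_norm_le (c.fn b (x + τ)) (c.fn b x)
        linarith
      simp only [Set.indicator_of_mem hx, Set.indicator_of_mem h2]; rfl
    · rw [Set.indicator_of_notMem hx]
      exact Set.indicator_nonneg (fun _ _ => zero_le_one) _
  have hT2 : TBr c.ω (({x | x + τ ∈ c.S b θ} \ c.S b θ).indicator 1) :=
    (hT.shift τ).mono c.hω fun x => by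
      have i1 : ∀ (A : Set (Rd d)) x, 0 ≤ A.indicator (1 : Rd d → ℝ) x := fun A x => Set.indicator_nonneg (fun _ _ => zero_le_one) _
      rw [abs_of_nonneg (i1 _ _), abs_of_nonneg (i1 _ _)]
      exact hle x
  refine ⟨hT2, ?_⟩
  have h1 : c.mu ({x | x + τ ∈ c.S b θ} \ c.S b θ) ≤ c.mu (c.S b θ \ c.S b θ0) := by
    rw [Setup.mu, Setup.mu, ← JJ_shift c.hω hT τ]
    exact JJ_mono c.hω hT2 (hT.shift τ) hle
  have h2 : c.mu (c.S b θ) = c.mu (c.S b θ \ c.S b θ0) + c.mu (c.S b θ0) := by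
    rw [Setup.mu, Setup.mu, Setup.mu, ← JJ_add c.hω hT (c.ωsum _ hA0)]
    congr 1
    funext x
    by_cases h : x ∈ c.S b θ0
    · simp [h, hsub h]
    · by_cases h' : x ∈ c.S b θ <;> simp [h, h']
  linarith

lemma Setup.Efin : ∃ ε > 0, FiniteDimensional ℂ (c.EE b ε) := by
  have hbdd : BddAbove ((fun θ => c.mu (c.S b θ)) '' Ioi 0) := ⟨c.mu Λ, by
    rintro _ ⟨θ, hθ, rfl⟩; exact c.mu_mono hΛ (c.Ssub hb hθ)⟩
  set D := sSup ((fun θ => c.mu (c.S b θ)) '' Ioi 0) with hD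
  have hDle : ∀ θ > 0, c.mu (c.S b θ) ≤ D := fun θ hθ => le_csSup hbdd ⟨θ, hθ, rfl⟩
  set δ : ℝ := 1 / (2 * (c.C0 + 1)) with hδ
  have hC0 := c.C0_nonneg
  have hδ0 : 0 < δ := by positivity
  have hCδ : c.C0 * δ ≤ 1 / 2 := by
    rw [hδ, mul_one_div, div_le_div_iff₀ (by positivity) (by positivity)]; linarith
  obtain ⟨_, ⟨θ0, hθ0, rfl⟩, hlt⟩ := exists_lt_of_lt_csSup ((Set.nonempty_Ioi (a := (0:ℝ))).image (fun θ => c.mu (c.S b θ))) (show D - δ < D by linarith)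
  simp only [mem_Ioi] at hθ0 hlt
  set ε := θ0 / (2 * (√c.C0 + 1)) with hε
  have hsq := Real.sqrt_nonneg c.C0
  have hε0 : 0 < ε := by positivity
  have hεle : √c.C0 * ε ≤ θ0 / 2 := by
    rw [hε, mul_div_assoc', div_le_div_iff₀ (by positivity) (by positivity)]; nlinarith
  refine ⟨ε, hε0, FD_of _ ⌊2 * c.C0 * D⌋₊ fun T hT hli => Nat.le_floor ?_⟩
  obtain ⟨e, he, hes⟩ := onb T hli
  choose! τ hτ hτb using fun w (hw : w ∈ T) => hT hw
  choose r hr using fun i => (Submodule.mem_span_finset'.1 (hes i))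
  -- bound
  set M : ℝ := ∑ i, ∑ w, ‖r i w‖ with hM
  have hMi : ∀ i, ∑ w, ‖r i w‖ ≤ M := fun i =>
    Finset.single_le_sum (f := fun i => ∑ w, ‖r i w‖) (fun i _ => by positivity) (Finset.mem_univ i)
  have hM0 : 0 ≤ M := by positivity
  have hfe : ∀ i x, c.fn (e i) x = ∑ w : T, r i w * c.fn b (x + τ w) := fun i x => by
    rw [← hr i, map_sum, Finset.sum_apply]
    refine Finset.sum_congr rfl fun w _ => ?_
    rw [map_smul, Pi.smul_apply, smul_eq_mul, ← c.fnU, show c.U (τ w) b = w from hτb w w.2]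
  have main : ∀ θ > 0, θ ≤ θ0 / 2 → (T.card : ℝ) ≤ c.C0 * (D + T.card * δ) + T.card * (M * θ) ^ 2 * (T.card * c.mu Λ) := by
    intro θ hθ hθθ
    have hA : UniformlyDiscrete (c.S b θ) := hΛ.mono (c.Ssub hb hθ)
    have haux := fun w : T => mu_shift_aux c hΛ hb hθ hθ0 hθθ hεle (δ := δ) (by linarith [hDle θ hθ]) (hτ w w.2)
    have hΛs := fun w : T => (c.ωsum Λ hΛ).shift (τ w)
    have t1 := (c.ωsum _ hA).add c.hω (TBr.sum Finset.univ c.hω fun w _ => (haux w).1)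
    have t2 := TBr.sum Finset.univ c.hω fun w _ => hΛs w
    have h1 : (T.card : ℝ) ≤ c.C0 * (c.mu (c.S b θ) + ∑ w : T, c.mu ({x | x + τ w ∈ c.S b θ} \ c.S b θ)) +
        T.card * (M * θ) ^ 2 * ∑ w : T, c.mu Λ := by
      have e1 : ∀ w : T, c.mu Λ = JJ c.ω (fun x => Λ.indicator 1 (x + τ w)) := fun w =>
        (JJ_shift c.hω (c.ωsum Λ hΛ) (τ w)).symm
      rw [Finset.sum_congr rfl fun w _ => e1 w]
      simp only [Setup.mu]
      rw [← JJ_sum _ c.hω fun w _ => (haux w).1, ← JJ_add c.hω (c.ωsum _ hA) (TBr.sum Finset.univ c.hω fun w _ => (haux w).1),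
        ← JJ_smul, ← JJ_sum _ c.hω fun w _ => hΛs w, ← JJ_smul, ← JJ_add c.hω (t1.smul _) (t2.smul _)]
      conv_lhs => rw [c.card_eq he]
      refine JJ_mono c.hω (TBr.sum Finset.univ c.hω fun i _ => c.fnTB (e i)) ((t1.smul _).add c.hω (t2.smul _)) fun x => ?_
      have i1 : ∀ (A : Set (Rd d)) x, 0 ≤ A.indicator (1 : Rd d → ℝ) x := fun A x => Set.indicator_nonneg (fun _ _ => zero_le_one) _
      have p1 : 0 ≤ ∑ w : T, ({x | x + τ w ∈ c.S b θ} \ c.S b θ).indicator (1 : Rd d → ℝ) x := Finset.sum_nonneg fun w _ => i1 _ _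
      have p2 : 0 ≤ ∑ w : T, Λ.indicator (1 : Rd d → ℝ) (x + τ w) := Finset.sum_nonneg fun w _ => i1 _ _
      have p3 : 0 ≤ (T.card : ℝ) * (M * θ) ^ 2 := by positivity
      by_cases hx : ∃ w : T, x + τ w ∈ c.S b θ
      · have hge : 1 ≤ (c.S b θ).indicator 1 x + ∑ w : T, ({x | x + τ w ∈ c.S b θ} \ c.S b θ).indicator (1 : Rd d → ℝ) x := by
          by_cases hxS : x ∈ c.S b θ
          · rw [Set.indicator_of_mem hxS]; simpa using p1
          · obtain ⟨w, hw⟩ := hx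
            have := Finset.single_le_sum (f := fun w : T => ({x | x + τ w ∈ c.S b θ} \ c.S b θ).indicator (1 : Rd d → ℝ) x)
              (fun w _ => i1 _ _) (Finset.mem_univ w)
            have h2 : x ∈ {x | x + τ w ∈ c.S b θ} \ c.S b θ := ⟨hw, hxS⟩
            simp only [Set.indicator_of_mem h2, Pi.one_apply] at this
            linarith [i1 (c.S b θ) x]
        have := c.bessel he x
        nlinarith [mul_le_mul_of_nonneg_left hge hC0, mul_nonneg p3 p2]
      · push Not at hx
        have hsm : ∀ w : T, ‖c.fn b (x + τ w)‖ ≤ θ * Λ.indicator (1 : Rd d → ℝ) (x + τ w) := fun w => by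
          by_cases h : x + τ w ∈ Λ
          · have := hx w
            rw [Setup.S, mem_setOf_eq, not_le] at this
            rw [Set.indicator_of_mem h]; simpa using this.le
          · rw [hb _ h]; simp [h]
        by_cases hy : ∃ w : T, x + τ w ∈ Λ
        · have hge : 1 ≤ ∑ w : T, Λ.indicator (1 : Rd d → ℝ) (x + τ w) := by
            obtain ⟨w, hw⟩ := hy
            have := Finset.single_le_sum (f := fun w : T => Λ.indicator (1 : Rd d → ℝ) (x + τ w))
              (fun w _ => i1 _ _) (Finset.mem_univ w)
            simpa [Set.indicator_of_mem hw] using this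
          have hei : ∀ i, ‖c.fn (e i) x‖ ^ 2 ≤ (M * θ) ^ 2 := fun i => by
            refine pow_le_pow_left₀ (norm_nonneg _) ?_ 2
            rw [hfe]
            calc ‖∑ w : T, r i w * c.fn b (x + τ w)‖ ≤ ∑ w : T, ‖r i w‖ * θ := by
                  refine (norm_sum_le _ _).trans (Finset.sum_le_sum fun w _ => ?_)
                  rw [norm_mul]
                  refine mul_le_mul_of_nonneg_left ((hsm w).trans ?_) (norm_nonneg _)
                  have : Λ.indicator (1 : Rd d → ℝ) (x + τ w) ≤ 1 := Set.indicator_le_self' (fun _ _ => zero_le_one) _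
                  nlinarith
              _ = (∑ w : T, ‖r i w‖) * θ := by rw [Finset.sum_mul]
              _ ≤ M * θ := mul_le_mul_of_nonneg_right (hMi i) hθ.le
          have h7 : ∑ i, ‖c.fn (e i) x‖ ^ 2 ≤ T.card * (M * θ) ^ 2 := by
            refine (Finset.sum_le_sum fun i _ => hei i).trans ?_
            simp
          have h8 : 0 ≤ c.C0 * ((c.S b θ).indicator 1 x + ∑ w : T, ({x | x + τ w ∈ c.S b θ} \ c.S b θ).indicator (1 : Rd d → ℝ) x) :=
            mul_nonneg hC0 (add_nonneg (i1 _ _) p1)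
          nlinarith [mul_le_mul_of_nonneg_left hge p3]
        · push Not at hy
          have : ∀ i, c.fn (e i) x = 0 := fun i => by
            rw [hfe]
            exact Finset.sum_eq_zero fun w _ => by rw [hb _ (hy w), mul_zero]
          have h8 : 0 ≤ c.C0 * ((c.S b θ).indicator 1 x + ∑ w : T, ({x | x + τ w ∈ c.S b θ} \ c.S b θ).indicator (1 : Rd d → ℝ) x) :=
            mul_nonneg hC0 (add_nonneg (i1 _ _) p1)
          simp only [this, norm_zero, ne_eq, OfNat.ofNat_ne_zero, not_false_eq_true, zero_pow, Finset.sum_const_zero]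
          exact add_nonneg h8 (mul_nonneg p3 p2)
    refine h1.trans ?_
    have h2 : ∑ w : T, c.mu ({x | x + τ w ∈ c.S b θ} \ c.S b θ) ≤ T.card * δ := by
      refine (Finset.sum_le_sum fun w _ => (haux w).2).trans ?_
      simp
    have h3 : ∑ w : T, c.mu Λ = T.card * c.mu Λ := by simp
    rw [h3]
    gcongr
    exact hDle θ hθ
  -- limit
  have hlim : Tendsto (fun θ : ℝ => c.C0 * (D + T.card * δ) + T.card * (M * θ) ^ 2 * (T.card * c.mu Λ)) (𝓝[>] 0)
      (𝓝 (c.C0 * (D + T.card * δ) + T.card * (M * 0) ^ 2 * (T.card * c.mu Λ))) := by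
    refine Tendsto.mono_left (Continuous.tendsto (by fun_prop) 0) nhdsWithin_le_nhds
  have hfin := ge_of_tendsto hlim (b := (T.card : ℝ)) (by
    filter_upwards [Ioc_mem_nhdsGT (show (0:ℝ) < θ0 / 2 by positivity)] with θ hθ
    exact main θ hθ.1 hθ.2)
  have : (0:ℝ) ≤ T.card := Nat.cast_nonneg _
  nlinarith [mul_le_mul_of_nonneg_right hCδ this]
end Core2

section Lat
open Filter Topology ComplexConjugate Module
variable {d : ℕ}

lemma e2pi_add (x y w : Rd d) : e2pi (x + y) w = e2pi x w * e2pi y w := by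
  rw [e2pi, e2pi, e2pi, ← Complex.exp_add, inner_add_left]; push_cast; ring_nf

lemma e2pi_zero (w : Rd d) : e2pi 0 w = 1 := by simp [e2pi]

lemma e2pi_neg_mul (x w : Rd d) : e2pi (-x) w * e2pi x w = 1 := by
  rw [← e2pi_add, neg_add_cancel, e2pi_zero]

lemma e2pi_norm (x w : Rd d) : ‖e2pi x w‖ = 1 := by
  rw [e2pi, show ((2 * Real.pi : ℝ) : ℂ) * Complex.I * ((⟪x, w⟫ : ℝ) : ℂ) = ((2 * Real.pi * ⟪x, w⟫ : ℝ) : ℂ) * Complex.I by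
    push_cast; ring]
  exact Complex.norm_exp_ofReal_mul_I _

abbrev latB (B : Basis (Fin d) ℝ (Rd d)) : Submodule ℤ (Rd d) := Submodule.span ℤ (range B)

open Classical in
def cgen (B : Basis (Fin d) ℝ (Rd d)) (v w : Rd d) : Rd d → ℂ :=
  fun x => if x - v ∈ latB B then e2pi x w else 0

def Crys (d : ℕ) : Submodule ℂ (Rd d → ℂ) := Submodule.span ℂ {g | ∃ B v w, g = cgen B v w}

lemma latB_full (B : Basis (Fin d) ℝ (Rd d)) : IsFullRankLattice (latB B : Set (Rd d)) := by
  let E := (EuclideanSpace.basisFun (Fin d) ℝ).toBasis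
  let T := E.equiv B (Equiv.refl _)
  refine ⟨T.toLinearMap, T.bijective, ?_⟩
  ext y
  rw [SetLike.mem_coe, Basis.mem_span_iff_repr_mem]
  have hr : ∀ x i, B.repr (T x) i = x i := fun x i => by
    have : B.repr (T x) i = E.repr x i := by simp [T, Basis.equiv]
    rw [this]; simp [E]
  constructor
  · intro h
    refine ⟨T.symm y, fun i => ?_, by simp⟩
    obtain ⟨n, hn⟩ := h i
    refine ⟨n, ?_⟩
    rw [← hr, T.apply_symm_apply, ← hn]; simp
  · rintro ⟨x, hx, rfl⟩ i
    obtain ⟨n, hn⟩ := hx i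
    refine ⟨n, ?_⟩
    have := hr x i
    simp only [LinearEquiv.coe_coe]
    rw [this, hn]; simp

lemma lat_basis (H : AddSubgroup (Rd d)) (hd : ∃ δ > 0, ∀ y ∈ H, y ≠ 0 → δ ≤ ‖y‖)
    (hs : Submodule.span ℝ (H : Set (Rd d)) = ⊤) :
    ∃ B : Basis (Fin d) ℝ (Rd d), ∀ y, y ∈ latB B ↔ y ∈ H := by
  obtain ⟨δ, hδ, h⟩ := hd
  let L : Submodule ℤ (Rd d) := AddSubgroup.toIntSubmodule H
  have : DiscreteTopology L := DiscreteTopology.of_forall_le_norm hδ fun x hx => h x x.2 (by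
    intro h0; exact hx (Subtype.ext h0))
  have : IsZLattice ℝ L := ⟨hs⟩
  have := ZLattice.module_finite ℝ L
  have := ZLattice.module_free ℝ L
  have hr := ZLattice.rank ℝ L
  rw [finrank_euclideanSpace_fin] at hr
  let b : Basis (Fin d) ℤ L := (Module.finBasis ℤ L).reindex (finCongr hr)
  refine ⟨b.ofZLatticeBasis ℝ L, fun y => ?_⟩
  rw [latB, Basis.ofZLatticeBasis_span]
  rfl

lemma exists_char (B : Basis (Fin d) ℝ (Rd d)) (θ : Rd d → ℂ) (h0 : θ 0 = 1)
    (hadd : ∀ x ∈ latB B, ∀ y ∈ latB B, θ (x + y) = θ x * θ y) (hn : ∀ x ∈ latB B, ‖θ x‖ = 1) :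
    ∃ w, ∀ x ∈ latB B, e2pi x w = θ x := by
  have hB : ∀ i, B i ∈ latB B := fun i => Submodule.subset_span ⟨i, rfl⟩
  let s : Fin d → ℝ := fun i => Complex.arg (θ (B i)) / (2 * Real.pi)
  let w := (InnerProductSpace.toDual ℝ (Rd d)).symm (LinearMap.toContinuousLinearMap (B.constr ℝ s))
  have hw : ∀ i, ⟪B i, w⟫ = s i := fun i => by
    rw [real_inner_comm]
    simp [w]
  refine ⟨w, fun x hx => ?_⟩
  have hx2 : x ∈ AddSubgroup.closure (range B) := by
    rw [← Submodule.span_int_eq_addSubgroupClosure]; exact hx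
  have hcl : ∀ y ∈ AddSubgroup.closure (range B), y ∈ latB B := fun y hy => by
    rw [← Submodule.span_int_eq_addSubgroupClosure] at hy; exact hy
  induction hx2 using AddSubgroup.closure_induction with
  | mem x h =>
    obtain ⟨i, rfl⟩ := h
    rw [e2pi, hw]
    have := Complex.norm_mul_exp_arg_mul_I (θ (B i))
    rw [hn _ (hB i)] at this
    conv_rhs => rw [← this]
    simp only [s, Complex.ofReal_one, one_mul]
    congr 1
    push_cast
    have : (Real.pi : ℂ) ≠ 0 := by exact_mod_cast Real.pi_ne_zero
    field_simp
  | zero => rw [e2pi_zero, h0]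
  | add x y hx' hy' ihx ihy =>
    rw [e2pi_add, ihx (hcl x hx'), ihy (hcl y hy'), hadd x (hcl x hx') y (hcl y hy')]
  | neg x hx' ihx =>
    have h1 := hadd (-x) ((latB B).neg_mem (hcl x hx')) x (hcl x hx')
    rw [neg_add_cancel, h0, ← ihx (hcl x hx'), ← e2pi_neg_mul x w] at h1
    exact mul_right_cancel₀ (by intro h; have := e2pi_norm x w; simp [h] at this) h1

lemma eig_crys (B : Basis (Fin d) ℝ (Rd d)) (f : Rd d → ℂ) (hLF : LocFinite {x | f x ≠ 0}) (θ : Rd d → ℂ)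
    (h : ∀ y ∈ latB B, ∀ x, f (x + y) = θ y * f x) (hn : ∀ y ∈ latB B, ‖θ y‖ = 1) : f ∈ Crys d := by
  by_cases hf : f = 0
  · rw [hf]; exact Submodule.zero_mem _
  obtain ⟨x0, hx0⟩ := Function.ne_iff.1 hf
  simp only [Pi.zero_apply] at hx0
  obtain ⟨w, hw⟩ := exists_char B θ (by
      have := h 0 (Submodule.zero_mem _) x0
      rw [add_zero] at this
      exact (mul_right_cancel₀ hx0 (by rw [one_mul, ← this])))
    (fun x hx y hy => by
      have h1 := h (x + y) (Submodule.add_mem _ hx hy) x0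
      rw [← add_assoc, h y hy, h x hx] at h1
      exact (mul_right_cancel₀ hx0 (by rw [← h1]; ring))) hn
  obtain ⟨R, hR⟩ := (ZSpan.fundamentalDomain_isBounded B).subset_ball 0
  have hfin : ({x | f x ≠ 0} ∩ ZSpan.fundamentalDomain B).Finite :=
    (hLF 0 R).subset (inter_subset_inter_right _ hR)
  have key : f = ∑ z ∈ hfin.toFinset, (f z * e2pi (-z) w) • cgen B z w := by
    funext x
    rw [Finset.sum_apply]
    have hxf : x - ZSpan.fract B x ∈ latB B := by
      rw [ZSpan.fract_apply]; simp
    have hx1 : f x = θ (x - ZSpan.fract B x) * f (ZSpan.fract B x) := by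
      rw [← h _ hxf]; congr 1; abel
    rw [Finset.sum_eq_single (ZSpan.fract B x)]
    · rw [Pi.smul_apply, smul_eq_mul, cgen, if_pos hxf, hx1, ← hw _ hxf, sub_eq_add_neg, e2pi_add]; ring
    · intro z hz hne
      rw [Pi.smul_apply, smul_eq_mul, cgen, if_neg, mul_zero]
      intro hxz
      apply hne
      rw [Set.Finite.mem_toFinset] at hz
      have h1 := ZSpan.fract_add_ZSpan B z hxz
      rw [add_sub_cancel, ZSpan.fract_eq_self.2 hz.2] at h1
      exact h1.symm
    · intro hz
      rw [Set.Finite.mem_toFinset] at hz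
      have : f (ZSpan.fract B x) = 0 := by
        by_contra h0
        exact hz ⟨h0, ZSpan.fract_mem_fundamentalDomain B x⟩
      rw [this]; simp
  rw [key]
  exact Submodule.sum_mem _ fun z _ => Submodule.smul_mem _ _ (Submodule.subset_span ⟨B, z, w, rfl⟩)
end Lat

section Core3
open Filter Topology ComplexConjugate Module
variable {d : ℕ} (c : Setup d)

lemma UniformlyDiscrete.count {A : Set (Rd d)} (hA : UniformlyDiscrete A) (R : ℝ) :
    ∃ N : ℕ, ∀ x, (A ∩ ball x R).Finite ∧ (A ∩ ball x R).ncard ≤ N := by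
  obtain ⟨η, hη, hd⟩ := hA
  obtain ⟨t, ht, hcov⟩ := Metric.totallyBounded_iff.1 (isCompact_closedBall (0 : Rd d) R).totallyBounded (η / 2) (by positivity)
  refine ⟨ht.toFinset.card, fun x => ?_⟩
  have h1 : ∀ y ∈ A ∩ ball x R, ∃ z ∈ t, dist (y - x) z < η / 2 := fun y hy => by
    have := hcov (show y - x ∈ closedBall 0 R by
      rw [mem_closedBall_zero_iff, ← dist_eq_norm]; exact (mem_ball.1 hy.2).le)
    obtain ⟨z, hz, h⟩ := mem_iUnion₂.1 this
    exact ⟨z, hz, h⟩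
  choose! g hg1 hg2 using h1
  have hinj : InjOn g (A ∩ ball x R) := fun y hy y' hy' h => by
    by_contra hne
    have h1 := hd y hy.1 y' hy'.1 hne
    have h2 := hg2 y hy; have h3 := hg2 y' hy'
    rw [← h] at h3
    have := dist_triangle_right (y - x) (y' - x) (g y)
    rw [dist_sub_right] at this
    linarith
  have hmaps : g '' (A ∩ ball x R) ⊆ t := by rintro _ ⟨y, hy, rfl⟩; exact hg1 y hy
  refine ⟨Set.Finite.of_finite_image (ht.subset hmaps) hinj, ?_⟩
  rw [← Set.ncard_image_of_injOn hinj, ← Set.ncard_eq_toFinset_card t ht]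
  exact Set.ncard_le_ncard hmaps ht

lemma UniformlyDiscrete.BD {A : Set (Rd d)} (hA : UniformlyDiscrete A) : BoundedDensity A :=
  ⟨fun x r => ((hA.count r).choose_spec x).1, (hA.count 1).choose, fun x => ((hA.count 1).choose_spec x).2⟩

lemma Setup.span_top {Λ A : Set (Rd d)} (hΛ : UniformlyDiscrete Λ) (hA : A ⊆ Λ) (hpos : 0 < c.mu A)
    (H : AddSubgroup (Rd d)) (hAH : ∀ x ∈ A, ∀ y ∈ A, x - y ∈ H) :
    Submodule.span ℝ (H : Set (Rd d)) = ⊤ := by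
  by_contra hne
  have h1 : (Submodule.span ℝ (H : Set (Rd d)))ᗮ ≠ ⊥ := fun h => hne (Submodule.orthogonal_eq_bot_iff.1 h)
  obtain ⟨n, hn, hn0⟩ := Submodule.exists_mem_ne_zero_of_ne_bot h1
  have hort : ∀ y ∈ H, ⟪y, n⟫ = 0 := fun y hy =>
    (Submodule.mem_orthogonal _ _).1 hn y (Submodule.subset_span hy)
  have hn1 : 0 < ‖n‖ := norm_pos_iff.2 hn0
  obtain ⟨η, hη, hd⟩ := hΛ.mono hA
  let Y : Set (Rd d) := {z | ∃ x ∈ A, ∃ j : ℕ, z = x + (j : ℝ) • n}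
  have hsq : ∀ y ∈ H, ∀ s : ℝ, ‖y + s • n‖ ^ 2 = ‖y‖ ^ 2 + s ^ 2 * ‖n‖ ^ 2 := fun y hy s => by
    rw [norm_add_sq_real, inner_smul_right, hort y hy, norm_smul, mul_pow, Real.norm_eq_abs, sq_abs]; ring
  have hY : UniformlyDiscrete Y := by
    refine ⟨min η ‖n‖, lt_min hη hn1, ?_⟩
    rintro _ ⟨x, hx, j, rfl⟩ _ ⟨x', hx', j', rfl⟩ hxx
    have h2 := hsq (x - x') (hAH x hx x' hx') ((j : ℝ) - j')
    rw [dist_eq_norm, show x + (j : ℝ) • n - (x' + (j' : ℝ) • n) = x - x' + ((j : ℝ) - j') • n by module]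
    by_cases hx1 : x = x'
    · subst hx1
      have hj : (j : ℤ) - j' ≠ 0 := by
        intro h
        have : j = j' := by omega
        exact hxx (by rw [this])
      have h3 : (1 : ℝ) ≤ ((j : ℝ) - j') ^ 2 := by
        have : (1 : ℤ) ≤ ((j : ℤ) - j') ^ 2 := by have := sq_pos_of_ne_zero hj; linarith
        exact_mod_cast this
      refine (min_le_right _ _).trans ((fun h h' => abs_le_of_sq_le_sq' h h' |>.2) ?_ (norm_nonneg _))
      rw [h2, sub_self, norm_zero]
      nlinarith [sq_nonneg ‖n‖]
    · refine (min_le_left _ _).trans ((hd x hx x' hx' hx1).trans ((fun h h' => abs_le_of_sq_le_sq' h h' |>.2) ?_ (norm_nonneg _)))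
      rw [h2, dist_eq_norm]
      nlinarith [mul_nonneg (sq_nonneg ((j : ℝ) - j')) (sq_nonneg ‖n‖)]
  have hYA := c.ωsum _ (hΛ.mono hA)
  have hle : ∀ N : ℕ, N * c.mu A ≤ c.mu Y := fun N => by
    have : ∀ j ∈ Finset.range N, TBr c.ω (fun x => A.indicator 1 (x + (-((j : ℝ) • n)))) := fun j _ => hYA.shift _
    have h3 : N * c.mu A = JJ c.ω (fun x => ∑ j ∈ Finset.range N, A.indicator 1 (x + (-((j : ℝ) • n)))) := by
      rw [JJ_sum _ c.hω this, Finset.sum_congr rfl fun (j : ℕ) _ => JJ_shift c.hω hYA (-((j : ℝ) • n))]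
      simp [Setup.mu]
    rw [h3]
    refine JJ_mono c.hω (TBr.sum _ c.hω this) (c.ωsum Y hY) fun x => ?_
    by_cases hx : ∃ j ∈ Finset.range N, x + (-((j : ℝ) • n)) ∈ A
    · obtain ⟨j, hj, hjA⟩ := hx
      have hxY : x ∈ Y := ⟨_, hjA, j, by module⟩
      rw [Finset.sum_eq_single_of_mem j hj, Set.indicator_of_mem hjA, Set.indicator_of_mem hxY]; · rfl
      intro j' _ hne'
      refine Set.indicator_of_notMem (fun h' => hne' ?_) _
      have h4 := hort _ (hAH _ h' _ hjA)
      rw [show x + (-((j' : ℝ) • n)) - (x + (-((j : ℝ) • n))) = ((j : ℝ) - j') • n by module, inner_smul_left,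
        real_inner_self_eq_norm_sq] at h4
      have h5 : (j : ℝ) - j' = 0 := by
        rcases mul_eq_zero.1 h4 with h | h
        · simpa using h
        · exact absurd h (by positivity)
      exact_mod_cast (sub_eq_zero.1 h5).symm
    · push Not at hx
      rw [Finset.sum_eq_zero fun j hj => Set.indicator_of_notMem (hx j hj) _]
      exact Set.indicator_nonneg (fun _ _ => zero_le_one) _
  obtain ⟨N, hN⟩ := exists_nat_gt (c.mu Y / c.mu A)
  rw [div_lt_iff₀ hpos] at hN
  linarith [hle N]

lemma Setup.innerU (y : Rd d) (w w' : c.KT) : inner ℂ (c.U y w) w' = inner ℂ w (c.U (-y) w') := by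
  let I : c.KT →ₗᵢ[ℂ] c.KT := ⟨c.U y, c.normU y⟩
  have := I.inner_map_map w (c.U (-y) w')
  rw [← this]
  change _ = inner ℂ (c.U y w) (c.U y (c.U (-y) w'))
  rw [← c.Uadd, add_neg_cancel, c.Uzero]; rfl

lemma Setup.totB {b : c.KT} (hb : GoodB c b) {θ : ℝ} (hθ : 0 < θ) :
    TotallyBounded ((fun x => c.U x b) '' c.S b θ) := by
  rw [totallyBounded_iff_ultrafilter]
  intro f hf
  have hm : (fun x => c.U x b) '' c.S b θ ∈ f := hf (mem_principal_self _)
  have h1 := Ultrafilter.ofComapInfPrincipal_mem hm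
  have h2 := Ultrafilter.ofComapInfPrincipal_eq_of_map hm
  set 𝒱 := Ultrafilter.ofComapInfPrincipal hm
  rcases hb 𝒱 with h | ⟨v, hv⟩
  · exfalso
    have h3 := (c.WL_fn h 0).norm
    simp only [zero_add, map_zero, Pi.zero_apply, norm_zero] at h3
    have h4 := ge_of_tendsto h3 (b := θ) h1
    linarith
  · refine cauchy_nhds (a := v) |>.mono ?_
    rw [← h2]
    exact hv

lemma Setup.TTadd {b : c.KT} {ε ε' : ℝ} {x y : Rd d} (hx : x ∈ c.TT b ε) (hy : y ∈ c.TT b ε') :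
    x + y ∈ c.TT b (ε + ε') := by
  change ‖_‖ ≤ _
  rw [c.Uadd, show c.U x (c.U y b) - b = c.U x (c.U y b - b) + (c.U x b - b) by rw [map_sub]; abel]
  refine (norm_add_le _ _).trans ?_
  rw [c.normU, add_comm]
  exact add_le_add hx hy

lemma Setup.TTsub {b : c.KT} {ε : ℝ} {x y : Rd d} (h : ‖c.U x b - c.U y b‖ ≤ ε) : x - y ∈ c.TT b ε := by
  change ‖_‖ ≤ _
  have h1 : c.U x b - c.U y b = c.U y (c.U (x - y) b - b) := by
    rw [map_sub, ← c.Uadd]; congr 3; abel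
  rwa [h1, c.normU] at h

lemma Setup.goodB {Λ : Set (Rd d)} (hΛ : UniformlyDiscrete Λ) {b : c.KT} (hb : b ∈ c.FL Λ) (hgood : GoodB c b) :
    c.fn b ∈ Crys d := by
  by_cases hb0 : b = 0
  · rw [hb0, map_zero]; exact Submodule.zero_mem _
  obtain ⟨ε0, hε0, hfd0⟩ := c.Efin hΛ hb
  have mono : ∀ {ε ε'}, ε ≤ ε' → c.EE b ε ≤ c.EE b ε' := fun h =>
    Submodule.span_mono (image_mono fun τ hτ => le_trans (show ‖_‖ ≤ _ from hτ) h)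
  have hfd : ∀ ε ≤ ε0, FiniteDimensional ℂ (c.EE b ε) := fun ε h => Submodule.finiteDimensional_of_le (mono h)
  obtain ⟨ε1, ⟨h1pos, h1le⟩, hmin⟩ : ∃ ε1 ∈ Ioc 0 ε0, ∀ ε ∈ Ioc 0 ε0, finrank ℂ (c.EE b ε1) ≤ finrank ℂ (c.EE b ε) := by
    obtain ⟨m, ⟨ε1, h1, rfl⟩, h2⟩ := wellFounded_lt.has_min ((fun ε => finrank ℂ (c.EE b ε)) '' Ioc 0 ε0)
      ⟨_, ε0, ⟨hε0, le_rfl⟩, rfl⟩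
    exact ⟨ε1, h1, fun ε hε => not_lt.1 (h2 _ ⟨ε, hε, rfl⟩)⟩
  have hE : c.EE b (ε1 / 2) = c.EE b ε1 := by
    have := hfd ε1 h1le
    exact Submodule.eq_of_le_of_finrank_le (mono (by linarith)) (hmin _ ⟨by linarith, by linarith⟩)
  set E := c.EE b ε1 with hEdef
  have hEfd : FiniteDimensional ℂ E := hfd ε1 h1le
  let H : AddSubgroup (Rd d) := AddSubgroup.closure (c.TT b (ε1 / 2))
  have hbE : b ∈ E := Submodule.subset_span ⟨0, by
    change ‖_‖ ≤ _; rw [c.Uzero]; simpa using h1pos.le, by simp [c.Uzero]⟩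
  have hT' : ∀ τ ∈ c.TT b (ε1 / 2), ∀ w ∈ E, c.U τ w ∈ E := by
    intro τ hτ w hw
    rw [← hE] at hw
    refine Submodule.span_induction (p := fun w _ => c.U τ w ∈ E) ?_ ?_ ?_ ?_ hw
    · rintro _ ⟨σ, hσ, rfl⟩
      refine Submodule.subset_span ⟨τ + σ, ?_, c.Uadd _ _ _⟩
      have := c.TTadd hτ hσ
      rwa [add_halves] at this
    · rw [map_zero]; exact Submodule.zero_mem _
    · intro x y _ _ hx hy; rw [map_add]; exact Submodule.add_mem _ hx hy
    · intro r x _ hx; rw [map_smul]; exact Submodule.smul_mem _ _ hx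
  have hTneg : ∀ τ ∈ c.TT b (ε1 / 2), -τ ∈ c.TT b (ε1 / 2) := fun τ hτ => by
    have := c.TTsub (x := 0) (y := τ) (b := b) (ε := ε1 / 2) (by
      rw [c.Uzero, norm_sub_rev]; exact hτ)
    rwa [zero_sub] at this
  have hUH : ∀ y ∈ H, ∀ w ∈ E, c.U y w ∈ E := by
    intro y hy
    induction hy using AddSubgroup.closure_induction'' with
    | zero => intro w hw; rw [c.Uzero]; exact hw
    | mem x hx => exact hT' x hx
    | neg_mem x hx => exact hT' _ (hTneg x hx)
    | add x y _ _ hx hy => intro w hw; rw [c.Uadd]; exact hx _ (hy _ hw)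
  -- span
  have hspan : Submodule.span ℝ (H : Set (Rd d)) = ⊤ := by
    obtain ⟨θ, hθ, hpos⟩ := c.mpos hΛ hb hb0
    obtain ⟨t, ht, hcov⟩ := Metric.totallyBounded_iff.1 (c.totB hgood hθ) (ε1 / 4) (by positivity)
    let A : c.KT → Set (Rd d) := fun y => {x | x ∈ c.S b θ ∧ c.U x b ∈ ball y (ε1 / 4)}
    have hAS : ∀ y, A y ⊆ Λ := fun y x hx => c.Ssub hb hθ hx.1
    have hTB := fun y => c.ωsum _ (hΛ.mono (hAS y))
    have hle : c.mu (c.S b θ) ≤ ∑ y ∈ ht.toFinset, c.mu (A y) := by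
      simp only [Setup.mu]
      rw [← JJ_sum _ c.hω fun y _ => hTB y]
      refine JJ_mono c.hω (c.ωsum _ (hΛ.mono (c.Ssub hb hθ))) (TBr.sum _ c.hω fun y _ => hTB y) fun x => ?_
      have i1 : ∀ (A : Set (Rd d)) x, 0 ≤ A.indicator (1 : Rd d → ℝ) x := fun A x => Set.indicator_nonneg (fun _ _ => zero_le_one) _
      by_cases hx : x ∈ c.S b θ
      · obtain ⟨y, hy, hxy⟩ := mem_iUnion₂.1 (hcov ⟨x, hx, rfl⟩)
        have h2 : x ∈ A y := ⟨hx, hxy⟩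
        have := Finset.single_le_sum (f := fun y => (A y).indicator (1 : Rd d → ℝ) x) (fun y _ => i1 _ _) (ht.mem_toFinset.2 hy)
        simp only [Set.indicator_of_mem h2, Pi.one_apply] at this
        rw [Set.indicator_of_mem hx]
        exact this
      · rw [Set.indicator_of_notMem hx]
        exact Finset.sum_nonneg fun y _ => i1 _ _
    obtain ⟨y, hy, hypos⟩ := Finset.exists_lt_of_sum_lt (s := ht.toFinset) (f := fun _ => (0:ℝ)) (g := fun y => c.mu (A y)) (by
      simpa using hpos.trans_le hle)
    refine c.span_top hΛ (hAS y) hypos H fun x hx x' hx' => AddSubgroup.subset_closure (c.TTsub ?_)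
    rw [← dist_eq_norm]
    have h1 := hx.2; have h2 := hx'.2
    rw [mem_ball] at h1 h2
    have := dist_triangle_right (c.U x b) (c.U x' b) y
    linarith
  -- discrete
  have hdisc : ∃ δ > 0, ∀ y ∈ H, y ≠ 0 → δ ≤ ‖y‖ := by
    obtain ⟨F, hF⟩ := sepF c E
    obtain ⟨η, hη, hd⟩ := hΛ
    have hyF : ∀ y ∈ H, ∃ x ∈ F, x + y ∈ Λ := fun y hy => by
      by_contra hcon
      push Not at hcon
      have h1 := hF _ (hUH y hy b hbE) fun x hx => by rw [c.fnU]; exact hb _ (hcon x hx)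
      have := c.normU y b
      rw [h1, norm_zero] at this
      exact hb0 (norm_eq_zero.1 this.symm)
    have hfin : ((H : Set (Rd d)) ∩ ball 0 (η / 2)).Finite := by
      choose! g hg1 hg2 using hyF
      refine Set.Finite.of_finite_image (f := g) (F.finite_toSet.subset ?_) ?_
      · rintro _ ⟨y, hy, rfl⟩; exact hg1 y hy.1
      · intro y hy y' hy' h
        by_contra hne
        have h1 := hd _ (hg2 y hy.1) _ (hg2 y' hy'.1) (by rw [h]; intro h'; exact hne (add_left_cancel h'))
        rw [h, dist_add_left] at h1
        have h2 := hy.2; have h3 := hy'.2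
        rw [mem_ball] at h2 h3
        have := dist_triangle_right y y' 0
        linarith
    have hfin2 := hfin.subset (t := ((H : Set (Rd d)) ∩ ball 0 (η / 2)) \ {0}) diff_subset
    have hopen : (((H : Set (Rd d)) ∩ ball 0 (η / 2)) \ {0})ᶜ ∈ 𝓝 (0 : Rd d) :=
      hfin2.isClosed.isOpen_compl.mem_nhds (by simp)
    obtain ⟨δ, hδ, hsub⟩ := Metric.mem_nhds_iff.1 hopen
    refine ⟨min δ (η / 2), lt_min hδ (by positivity), fun y hy hy0 => ?_⟩
    by_contra hlt
    rw [not_le, lt_min_iff] at hlt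
    exact hsub (show y ∈ ball 0 δ by simpa using hlt.1) ⟨⟨hy, by simpa using hlt.2⟩, hy0⟩
  obtain ⟨B, hB⟩ := lat_basis H hdisc hspan
  -- locally finite supports
  have hLF : ∀ w ∈ E, LocFinite {x | c.fn w x ≠ 0} := by
    intro w hw
    refine Submodule.span_induction (p := fun w _ => LocFinite {x | c.fn w x ≠ 0}) ?_ ?_ ?_ ?_ hw
    · rintro _ ⟨τ, -, rfl⟩ x r
      have hfin := ((hΛ.count r).choose_spec (x + τ)).1
      refine (hfin.preimage (f := fun z => z + τ) (add_left_injective τ).injOn).subset ?_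
      rintro z ⟨hz, hz2⟩
      refine ⟨?_, ?_⟩
      · by_contra h; exact hz (hb _ h)
      · simpa using hz2
    · intro x r; simp
    · intro u v _ _ hu hv x r
      refine ((hu x r).union (hv x r)).subset ?_
      rintro z ⟨hz, hz2⟩
      by_contra hcon
      simp only [mem_union, mem_inter_iff, mem_setOf_eq, hz2, and_true, not_or, not_not] at hcon
      apply hz
      rw [map_add, Pi.add_apply, hcon.1, hcon.2, add_zero]
    · intro s u _ hu x r
      refine (hu x r).subset ?_
      rintro z ⟨hz, hz2⟩
      refine ⟨fun h0 => hz ?_, hz2⟩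
      rw [map_smul, Pi.smul_apply, h0, smul_zero]
  -- eigen
  let V : H → E →ₗ[ℂ] E := fun y => (c.U y).restrict (hUH y y.2)
  have hV : ∀ (y : H) (w : E), ((V y w : E) : c.KT) = c.U y w := fun y w => rfl
  have hVV : ∀ y z w, V y (V z w) = V (y + z) w := fun y z w => Subtype.ext (by
    rw [hV, hV, hV, ← c.Uadd]; rfl)
  let A : H × Bool → E →ₗ[ℂ] E := fun p => if p.2 then Complex.I • (V p.1 - V (-p.1)) else V p.1 + V (-p.1)
  have hadj : ∀ (y : H) (w w' : E), inner ℂ (V y w) w' = inner ℂ w (V (-y) w') := fun y w w' => c.innerU y w w'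
  have hA1 : ∀ p, (A p).IsSymmetric := by
    rintro ⟨y, _ | _⟩ w w'
    · simp only [A, Bool.false_eq_true, if_false, LinearMap.add_apply, inner_add_left, inner_add_right, hadj, neg_neg]
      ring
    · simp only [A, if_true, LinearMap.smul_apply, LinearMap.sub_apply, inner_smul_left, inner_smul_right, inner_sub_left,
        inner_sub_right, hadj, neg_neg, Complex.conj_I]
      ring
  have hcomm : ∀ y z, Commute (V y) (V z) := fun y z => LinearMap.ext fun w => by
    change V y (V z w) = V z (V y w)
    rw [hVV, hVV, add_comm]
  have hA2 : Pairwise (Function.onFun Commute A) := by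
    rintro ⟨y, _ | _⟩ ⟨z, _ | _⟩ -
    · exact ((hcomm _ _).add_right (hcomm _ _)).add_left ((hcomm _ _).add_right (hcomm _ _))
    · exact (((hcomm _ _).sub_right (hcomm _ _)).add_left ((hcomm _ _).sub_right (hcomm _ _))).smul_right _
    · exact (((hcomm _ _).add_right (hcomm _ _)).sub_left ((hcomm _ _).add_right (hcomm _ _))).smul_left _
    · exact ((((hcomm _ _).sub_right (hcomm _ _)).sub_left ((hcomm _ _).sub_right (hcomm _ _))).smul_left _).smul_right _
  have htop := LinearMap.IsSymmetric.iSup_iInf_eq_top_of_commute hA1 hA2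
  have hmem : (⟨b, hbE⟩ : E) ∈ ⨆ χ : H × Bool → ℂ, ⨅ i, End.eigenspace (A i) (χ i) := by rw [htop]; trivial
  refine Submodule.iSup_induction (motive := fun w : E => c.fn w ∈ Crys d) _ hmem ?_ ?_ ?_
  · intro χ w hw
    rw [Submodule.mem_iInf] at hw
    have hv : ∀ y : H, V y w = ((χ (y, false) - Complex.I * χ (y, true)) / 2) • w := fun y => by
      have h1 := End.mem_eigenspace_iff.1 (hw (y, false))
      have h2 := End.mem_eigenspace_iff.1 (hw (y, true))
      simp only [A, Bool.false_eq_true, if_false, if_true, LinearMap.add_apply, LinearMap.smul_apply, LinearMap.sub_apply] at h1 h2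
      have h3 : V y w = (1 / 2 : ℂ) • ((V y w + V (-y) w) - Complex.I • (Complex.I • (V y w - V (-y) w))) := by
        rw [smul_smul, Complex.I_mul_I]; module
      rw [h3, h1, h2]; module
    by_cases hw0 : (w : c.KT) = 0
    · rw [hw0, map_zero]; exact Submodule.zero_mem _
    classical
    let θ : Rd d → ℂ := fun y => if hy : y ∈ H then (χ (⟨y, hy⟩, false) - Complex.I * χ (⟨y, hy⟩, true)) / 2 else 0
    have hUθ : ∀ y ∈ H, c.U y w = θ y • (w : c.KT) := fun y hy => by
      have := congrArg (Subtype.val) (hv ⟨y, hy⟩)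
      simp only [θ, hy, dif_pos]
      exact this
    refine eig_crys B _ (hLF w w.2) θ ?_ ?_
    · intro y hy x
      rw [← c.fnU, hUθ y ((hB y).1 hy), map_smul, Pi.smul_apply, smul_eq_mul]
    · intro y hy
      have h1 := c.normU y w
      rw [hUθ y ((hB y).1 hy), norm_smul] at h1
      exact (mul_eq_right₀ (norm_ne_zero_iff.2 hw0)).1 h1
  · change c.fn (0 : c.KT) ∈ _
    rw [map_zero]; exact Submodule.zero_mem _
  · intro x y hx hy
    change c.fn ((x : c.KT) + y) ∈ _
    rw [map_add]; exact Submodule.add_mem _ hx hy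

theorem Setup.crys {Λ : Set (Rd d)} (hΛ : UniformlyDiscrete Λ) (a : Rd d → ℂ) (haΛ : ∀ x ∉ Λ, a x = 0)
    (hVV : c.VV = Submodule.span ℂ (range fun y : Rd d => fun x => a (x + y)))
    (HT : Set (Ultrafilter (Rd d))) (HTadd : ∀ 𝒰 ∈ HT, ∀ 𝒱 ∈ HT, uadd 𝒰 𝒱 ∈ HT)
    (HTneg : ∀ 𝒱, uadd (𝒱.map Neg.neg) 𝒱 ∈ HT)
    (hex : ∀ 𝒰 ∈ HT, ∀ x, Tendsto (fun τ => a (x + τ)) (𝒰 : Filter (Rd d)) (𝓝 0) ∨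
      Tendsto (fun τ => a (x + τ)) (𝒰 : Filter (Rd d)) (𝓝 (a x))) : a ∈ Crys d := by
  have haV : a ∈ c.VV := by
    rw [hVV]; exact Submodule.subset_span ⟨0, by simp⟩
  let a' : c.KT := ⟨a, c.VK haV⟩
  have h := c.split hΛ a' haΛ hVV HT HTadd HTneg hex
  have h2 : Submodule.map c.fn (Submodule.span ℂ {b | b ∈ c.FL Λ ∧ GoodB c b}) ≤ Crys d := by
    rw [Submodule.map_span, Submodule.span_le]
    rintro _ ⟨b, ⟨hb, hb2⟩, rfl⟩
    exact c.goodB hΛ hb hb2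
  exact h2 ⟨a', h, rfl⟩
end Core3

section Schw
open Filter Topology FourierTransform
open LineDeriv
variable {d : ℕ}

def wt (x : Rd d) : ℝ := ((1 + ‖x‖) ^ (d + 1))⁻¹
lemma wt_nonneg (x : Rd d) : 0 ≤ wt x := by unfold wt; positivity

lemma wt_int : Integrable (wt : Rd d → ℝ) := by
  have := integrable_one_add_norm (E := Rd d) (μ := volume) (r := (d + 1 : ℕ)) (by simp)
  refine this.congr (ae_of_all _ fun x => ?_)
  simp only [wt]
  rw [Real.rpow_neg (by positivity), Real.rpow_natCast]

lemma TB_ud {Y : Set (Rd d)} (hY : UniformlyDiscrete Y) : TBr wt (Y.indicator 1) := by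
  obtain ⟨η, hη, h⟩ := hY
  set r := min (η / 2) 1 with hr
  have hr0 : 0 < r := by positivity
  set V := volume.real (ball (0 : Rd d) r) with hV
  have hV0 : 0 < V := ENNReal.toReal_pos (measure_ball_pos _ _ hr0).ne' measure_ball_lt_top.ne
  refine ⟨V⁻¹ * (2 ^ (d + 1) * ∫ y : Rd d, wt y), fun t s => ?_⟩
  rw [le_inv_mul_iff₀ hV0, Finset.mul_sum]
  classical
  have h1 : ∑ x ∈ s, V * (‖((Y.indicator 1 x : ℝ) : ℂ)‖ * wt (x - t)) = ∑ x ∈ s.filter (· ∈ Y), V * wt (x - t) := by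
    rw [Finset.sum_filter]
    refine Finset.sum_congr rfl fun x _ => ?_
    by_cases hx : x ∈ Y <;> simp [hx]
  rw [h1]
  have hint : Integrable (fun y : Rd d => wt (y - t)) := wt_int.comp_sub_right t
  have h2 : ∀ x ∈ s.filter (· ∈ Y), V * wt (x - t) ≤ ∫ y in ball x r, 2 ^ (d + 1) * wt (y - t) := by
    intro x _
    have : V * wt (x - t) = ∫ y in ball x r, wt (x - t) := by
      rw [setIntegral_const, smul_eq_mul, hV, measureReal_def, measureReal_def, Measure.addHaar_ball_center volume x r]
    rw [this]
    refine setIntegral_mono_on (integrableOn_const measure_ball_lt_top.ne) ((hint.const_mul _).integrableOn) measurableSet_ball fun y hy => ?_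
    rw [mem_ball, dist_eq_norm] at hy
    have hy1 : ‖y - x‖ ≤ 1 := hy.le.trans (min_le_right _ _)
    have h3 : ‖y - t‖ ≤ ‖y - x‖ + ‖x - t‖ := norm_sub_le_norm_sub_add_norm_sub _ _ _
    unfold wt
    rw [← div_eq_mul_inv, inv_eq_one_div, div_le_div_iff₀ (by positivity) (by positivity), one_mul, ← mul_pow]
    gcongr
    nlinarith [norm_nonneg (x - t)]
  refine (Finset.sum_le_sum h2).trans ?_
  rw [← integral_biUnion_finset _ (fun x _ => measurableSet_ball) ?_ (fun x _ => (hint.const_mul _).integrableOn)]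
  · refine (setIntegral_le_integral (hint.const_mul _) (ae_of_all _ fun y => by have := wt_nonneg (y - t); positivity)).trans ?_
    rw [integral_const_mul, integral_sub_right_eq_self (fun y : Rd d => wt y)]
  · intro x hx y hy hxy
    have hx' := (Finset.mem_filter.1 (Finset.mem_coe.1 hx)).2
    have hy' := (Finset.mem_filter.1 (Finset.mem_coe.1 hy)).2
    refine ball_disjoint_ball ?_
    have := h x hx' y hy' hxy
    have := min_le_left (η / 2) 1
    linarith

lemma TB_bdd {Y : Set (Rd d)} (hY : UniformlyDiscrete Y) {p : Rd d → ℂ} {C : ℝ} (h0 : ∀ x ∉ Y, p x = 0)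
    (hC : ∀ x ∈ Y, ‖p x‖ ≤ C) : TB wt p := by
  refine TB.mono wt_nonneg (fun x => ?_) (TB.smul (C : ℂ) (TB_ud hY))
  by_cases hx : x ∈ Y
  · simpa [hx] using (hC x hx).trans (le_abs_self C)
  · simp [hx, h0 x hx]

lemma wt_bound (ψ : 𝓢(Rd d, ℂ)) (x : Rd d) : ‖ψ x‖ ≤
    2 ^ (d + 1) * (Finset.Iic (d + 1, 0)).sup (schwartzSeminormFamily ℂ (Rd d) ℂ) ψ * wt x := by
  have := one_add_le_sup_seminorm_apply (𝕜 := ℂ) (m := (d + 1, 0)) (k := d + 1) (n := 0) le_rfl le_rfl ψ x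
  rw [norm_iteratedFDeriv_zero] at this
  rw [wt, ← div_eq_mul_inv, le_div_iff₀ (by positivity), mul_comm]
  exact this

def Wsn (ψ : 𝓢(Rd d, ℂ)) : ℝ := 2 ^ (d + 1) * (Finset.Iic (d + 1, 0)).sup (schwartzSeminormFamily ℂ (Rd d) ℂ) ψ
lemma Wsn_nonneg (ψ : 𝓢(Rd d, ℂ)) : 0 ≤ Wsn ψ := by unfold Wsn; positivity

lemma TBle.sum_schw {p : Rd d → ℂ} {M : ℝ} (h : TBle wt p M) (ψ : Rd d → ℂ) {C : ℝ} (hC0 : 0 ≤ C) (hC : ∀ x, ‖ψ x‖ ≤ C * wt x)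
    (t : Rd d) (s : Finset (Rd d)) : ∑ x ∈ s, ‖p x * ψ (x - t)‖ ≤ C * M := by
  refine le_trans (Finset.sum_le_sum fun x _ => ?_) (?_ : ∑ x ∈ s, C * (‖p x‖ * wt (x - t)) ≤ C * M)
  · rw [norm_mul]
    nlinarith [hC (x - t), norm_nonneg (p x)]
  · rw [← Finset.mul_sum]
    exact mul_le_mul_of_nonneg_left (h t s) hC0

lemma TBle.summ {p : Rd d → ℂ} {M : ℝ} (h : TBle wt p M) (ψ : Rd d → ℂ) {C : ℝ} (hC0 : 0 ≤ C) (hC : ∀ x, ‖ψ x‖ ≤ C * wt x)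
    (t : Rd d) : Summable (fun x => ‖p x * ψ (x - t)‖) :=
  summable_of_sum_le (fun x => norm_nonneg _) (h.sum_schw ψ hC0 hC t)

lemma TBle.tsum_bd {p : Rd d → ℂ} {M : ℝ} (h : TBle wt p M) (ψ : Rd d → ℂ) {C : ℝ} (hC0 : 0 ≤ C) (hC : ∀ x, ‖ψ x‖ ≤ C * wt x)
    (t : Rd d) : ‖∑' x, p x * ψ (x - t)‖ ≤ C * M :=
  (norm_tsum_le_tsum_norm (h.summ ψ hC0 hC t)).trans
    (Real.tsum_le_of_sum_le (fun x => norm_nonneg _) (h.sum_schw ψ hC0 hC t))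

lemma TB.summ {p : Rd d → ℂ} (h : TB wt p) (ψ : 𝓢(Rd d, ℂ)) (t : Rd d) : Summable (fun x => p x * ψ (x - t)) := by
  obtain ⟨M, hM⟩ := h
  exact (hM.summ ψ (Wsn_nonneg ψ) (wt_bound ψ) t).of_norm

lemma TB.summ0 {p : Rd d → ℂ} (h : TB wt p) (ψ : 𝓢(Rd d, ℂ)) : Summable (fun x => p x * ψ x) := by
  simpa using h.summ ψ 0

def LD0 (p : Rd d → ℂ) (h : TB wt p) : TemperedDist d :=
  mkCLMtoNormedSpace (fun ψ => ∑' x, p x * ψ x)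
    (fun f g => by
      simp only [SchwartzMap.add_apply, mul_add]
      exact (h.summ0 f).tsum_add (h.summ0 g))
    (fun a f => by
      simp only [SchwartzMap.smul_apply, smul_eq_mul, RingHom.id_apply, mul_left_comm _ a, tsum_mul_left])
    (by
      obtain ⟨M, hM⟩ := h
      refine ⟨Finset.Iic (d + 1, 0), 2 ^ (d + 1) * |M|, by positivity, fun f => ?_⟩
      have := hM.tsum_bd f (Wsn_nonneg f) (wt_bound f) 0
      simp only [sub_zero] at this
      refine this.trans ?_
      calc Wsn f * M ≤ Wsn f * |M| := mul_le_mul_of_nonneg_left (le_abs_self _) (Wsn_nonneg f)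
        _ = _ := by unfold Wsn; ring)

lemma LD0_apply (p : Rd d → ℂ) (h : TB wt p) (ψ : 𝓢(Rd d, ℂ)) : LD0 p h ψ = ∑' x, p x * ψ x := rfl

abbrev ee (i : Fin d) : Rd d := EuclideanSpace.single i (1 : ℝ)

lemma pd_coe (i : Fin d) (n : ℕ) (ψ : 𝓢(Rd d, ℂ)) :
    ⇑(((lineDerivOpCLM ℂ 𝓢(Rd d, ℂ) (ee i)) ^ n) ψ) = (pderiv' i)^[n] ψ := by
  induction n with
  | zero => rfl
  | succ n ih =>
    rw [Function.iterate_succ_apply', ← ih, pow_succ', ContinuousLinearMap.mul_apply]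
    rfl

def DS (k : Fin d → ℕ) : 𝓢(Rd d, ℂ) →L[ℂ] 𝓢(Rd d, ℂ) :=
  ((List.finRange d).map fun i => (lineDerivOpCLM ℂ 𝓢(Rd d, ℂ) (ee i)) ^ (k i)).prod

lemma DS_coe (k : Fin d → ℕ) (ψ : 𝓢(Rd d, ℂ)) : ⇑(DS k ψ) = Dmulti k ψ := by
  unfold DS Dmulti
  generalize List.finRange d = l
  induction l with
  | nil => rfl
  | cons i l ih =>
    simp only [List.map_cons, List.prod_cons, List.foldr_cons, ContinuousLinearMap.mul_apply, Function.comp_apply]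
    rw [pd_coe, ih]

abbrev tr (t : Rd d) : 𝓢(Rd d, ℂ) →L[ℂ] 𝓢(Rd d, ℂ) := compSubConstCLM ℂ t

lemma DS_tr (k : Fin d → ℕ) (t : Rd d) (ψ : 𝓢(Rd d, ℂ)) : DS k (tr t ψ) = tr t (DS k ψ) := by
  have h0 : ∀ (i : Fin d) (φ : Rd d → ℂ), pderiv' i (fun x => φ (x - t)) = fun x => pderiv' i φ (x - t) := by
    intro i φ; ext x; simp only [pderiv']; rw [fderiv_comp_sub]
  have h1 : ∀ (i : Fin d) (n : ℕ) (φ : Rd d → ℂ), (pderiv' i)^[n] (fun x => φ (x - t)) = fun x => (pderiv' i)^[n] φ (x - t) := by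
    intro i n φ
    induction n generalizing φ with
    | zero => rfl
    | succ n ih => rw [Function.iterate_succ_apply, h0, ih]; rfl
  ext x
  rw [DS_coe, compSubConstCLM_apply, DS_coe]
  change Dmulti k (fun x => ψ (x - t)) x = _
  suffices ∀ l : List (Fin d), ((l.map fun i => (pderiv' i)^[k i]).foldr (· ∘ ·) id) (fun x => ψ (x - t)) =
      fun x => ((l.map fun i => (pderiv' i)^[k i]).foldr (· ∘ ·) id) ψ (x - t) from congrFun (this _) x
  intro l
  induction l with
  | nil => rfl
  | cons i l ih => simp only [List.map_cons, List.foldr_cons, Function.comp_apply]; rw [ih, h1]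

def LD (p : Rd d → ℂ) (h : TB wt p) (k : Fin d → ℕ) : TemperedDist d :=
  ((-1 : ℂ) ^ (∑ i, k i)) • (LD0 p h).comp (DS k)

lemma LD_apply (p : Rd d → ℂ) (h : TB wt p) (k : Fin d → ℕ) (ψ : 𝓢(Rd d, ℂ)) :
    LD p h k ψ = ∑' x, p x * dkDelta k x ψ := by
  simp only [LD, ContinuousLinearMap.smul_apply, ContinuousLinearMap.comp_apply, LD0_apply, DS_coe, dkDelta, smul_eq_mul]
  rw [← tsum_mul_left]
  congr 1; ext x; ring

lemma LD_summ (p : Rd d → ℂ) (h : TB wt p) (k : Fin d → ℕ) (ψ : 𝓢(Rd d, ℂ)) :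
    Summable fun x => p x * dkDelta k x ψ := by
  have := (h.summ0 (DS k ψ)).mul_left ((-1 : ℂ) ^ (∑ i, k i))
  refine this.congr fun x => ?_
  rw [DS_coe, dkDelta]; ring

lemma LD_tr (p : Rd d → ℂ) (h : TB wt p) (k : Fin d → ℕ) (ψ : 𝓢(Rd d, ℂ)) (t : Rd d) :
    LD p h k (tr t ψ) = (-1 : ℂ) ^ (∑ i, k i) * ∑' x, p x * DS k ψ (x - t) := by
  simp only [LD, ContinuousLinearMap.smul_apply, ContinuousLinearMap.comp_apply, LD0_apply, DS_tr, smul_eq_mul]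
  rfl

lemma LD_bdd (p : Rd d → ℂ) (h : TB wt p) (k : Fin d → ℕ) (ψ : 𝓢(Rd d, ℂ)) : ∃ C, ∀ t, ‖LD p h k (tr t ψ)‖ ≤ C := by
  obtain ⟨M, hM⟩ := id h
  refine ⟨Wsn (DS k ψ) * M, fun t => ?_⟩
  rw [LD_tr, norm_mul]
  simpa using hM.tsum_bd (DS k ψ) (Wsn_nonneg _) (wt_bound _) t

end Schw

section Modu
open Filter Topology FourierTransform
open scoped ContDiff
variable {d : ℕ}

lemma tg_exp : (fun r : ℝ => Complex.exp (((2 * Real.pi : ℝ) : ℂ) * Complex.I * (r : ℂ))).HasTemperateGrowth := by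
  set c : ℂ := ((2 * Real.pi : ℝ) : ℂ) * Complex.I with hc
  have h1 : ∀ r : ℝ, HasDerivAt (fun r : ℝ => Complex.exp (c * (r : ℂ))) (c * Complex.exp (c * r)) r := by
    intro r
    have := ((Complex.ofRealCLM.hasDerivAt (x := r)).const_mul c).cexp
    simpa [mul_comm] using this
  have h2 : ∀ n, iteratedDeriv n (fun r : ℝ => Complex.exp (c * (r : ℂ))) = fun r : ℝ => c ^ n * Complex.exp (c * r) := by
    intro n
    induction n with
    | zero => simp
    | succ n ih =>
      rw [iteratedDeriv_succ, ih]
      ext r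
      rw [((h1 r).const_mul (c ^ n)).deriv]; ring
  refine ⟨?_, fun n => ⟨0, ‖c‖ ^ n, fun r => ?_⟩⟩
  · exact Complex.contDiff_exp.comp (contDiff_const.mul Complex.ofRealCLM.contDiff)
  · rw [norm_iteratedFDeriv_eq_norm_iteratedDeriv, h2, norm_mul, norm_pow, hc, Complex.norm_exp]
    simp

lemma tg_e2pi (h : Rd d) : (fun x : Rd d => e2pi x h).HasTemperateGrowth :=
  tg_exp.comp (Function.hasTemperateGrowth_inner_left h)

def md (h : Rd d) : 𝓢(Rd d, ℂ) →L[ℂ] 𝓢(Rd d, ℂ) := smulLeftCLM ℂ (fun x => e2pi x h)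

lemma md_apply (h : Rd d) (ψ : 𝓢(Rd d, ℂ)) (x : Rd d) : md h ψ x = e2pi x h * ψ x := by
  rw [md, smulLeftCLM_apply_apply (tg_e2pi h), smul_eq_mul]

abbrev FT : 𝓢(Rd d, ℂ) →L[ℂ] 𝓢(Rd d, ℂ) := fourierTransformCLM ℂ

lemma e2pi_symm (x y : Rd d) : e2pi x y = e2pi y x := by
  unfold e2pi; rw [real_inner_comm]

lemma e2pi_sub (x y w : Rd d) : e2pi (x - y) w = e2pi x w * e2pi (-y) w := by
  rw [sub_eq_add_neg, e2pi_add]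

lemma e2pi_neg_right (x y : Rd d) : e2pi x (-y) = e2pi (-x) y := by
  unfold e2pi; rw [inner_neg_left, inner_neg_right]

lemma FT_apply (β : 𝓢(Rd d, ℂ)) (y : Rd d) : FT β y = ∫ v, e2pi (-v) y * β v := by
  rw [fourierTransformCLM_apply, fourier_coe, Real.fourier_eq']
  congr 1; ext v
  simp only [e2pi, smul_eq_mul, inner_neg_left]
  congr 2
  push_cast; ring

lemma FT_md (t : Rd d) (β : 𝓢(Rd d, ℂ)) : FT (md t β) = tr t (FT β) := by
  ext y
  rw [compSubConstCLM_apply, FT_apply, FT_apply]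
  congr 1; ext v
  rw [md_apply, e2pi_symm (-v) (y - t), e2pi_sub, e2pi_symm y, e2pi_symm (-t), ← mul_assoc]
  congr 2
  rw [e2pi_neg_right, neg_neg]

lemma FT_tr (s : Rd d) (β : 𝓢(Rd d, ℂ)) : FT (tr s β) = md (-s) (FT β) := by
  ext y
  rw [md_apply, FT_apply, FT_apply, ← integral_const_mul]
  rw [← integral_add_right_eq_self _ s]
  congr 1; ext v
  rw [compSubConstCLM_apply, add_sub_cancel_right, neg_add, e2pi_add, e2pi_symm y (-s)]
  ring

def chi (x : Rd d) : ℂ := ((⟨1, 2, one_pos, one_lt_two⟩ : ContDiffBump (0 : Rd d)) x : ℝ)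

lemma chi_smooth : ContDiff ℝ ∞ (chi : Rd d → ℂ) :=
  Complex.ofRealCLM.contDiff.comp (ContDiffBump.contDiff _)

lemma chi_one {x : Rd d} (h : ‖x‖ ≤ 1) : chi x = 1 := by
  rw [chi, ContDiffBump.one_of_mem_closedBall]; · simp
  · simpa using h

lemma chi_zero {x : Rd d} (h : 2 ≤ ‖x‖) : chi x = 0 := by
  rw [chi, ContDiffBump.zero_of_le_dist]; · simp
  · simpa using h

lemma chi_cs : HasCompactSupport (chi : Rd d → ℂ) :=
  HasCompactSupport.intro (isCompact_closedBall (0 : Rd d) 2) fun x hx => chi_zero (by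
    simp at hx; exact hx.le)

lemma smooth_bdd {f : Rd d → ℂ} (hf : ContDiff ℝ ∞ f) (hc : HasCompactSupport f) (m : ℕ) :
    ∃ C, 0 ≤ C ∧ ∀ i ≤ m, ∀ x, ‖iteratedFDeriv ℝ i f x‖ ≤ C := by
  induction m with
  | zero =>
    obtain ⟨C, hC⟩ := (hf.continuous_iteratedFDeriv (m := 0) (by simp)).bounded_above_of_compact_support (hc.iteratedFDeriv 0)
    exact ⟨C, (norm_nonneg _).trans (hC 0), fun i hi x => by obtain rfl : i = 0 := by omega
                                                             exact hC x⟩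
  | succ m ih =>
    obtain ⟨C', hC'0, hC'⟩ := ih
    obtain ⟨C, hC⟩ := (hf.continuous_iteratedFDeriv (m := m + 1) (by exact_mod_cast le_top)).bounded_above_of_compact_support (hc.iteratedFDeriv (m + 1))
    refine ⟨max C' C, le_max_of_le_left hC'0, fun i hi x => ?_⟩
    rcases Nat.lt_or_ge i (m + 1) with h | h
    · exact (hC' i (by omega) x).trans (le_max_left _ _)
    · obtain rfl : i = m + 1 := by omega
      exact (hC x).trans (le_max_right _ _)

def cut (s : ℝ) (γ x : Rd d) : ℂ := chi (s • (x - γ))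

lemma cut_smooth (s : ℝ) (γ : Rd d) : ContDiff ℝ ∞ (cut s γ) :=
  chi_smooth.comp ((contDiff_id.sub contDiff_const).const_smul s)

lemma cut_one {s : ℝ} (hs : 0 < s) {γ x : Rd d} (h : ‖x - γ‖ ≤ s⁻¹) : cut s γ x = 1 := by
  refine chi_one ?_
  rw [norm_smul, Real.norm_of_nonneg hs.le]
  calc s * ‖x - γ‖ ≤ s * s⁻¹ := by gcongr
    _ = 1 := mul_inv_cancel₀ hs.ne'

lemma cut_zero {s : ℝ} (hs : 0 < s) {γ x : Rd d} (h : 2 * s⁻¹ ≤ ‖x - γ‖) : cut s γ x = 0 := by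
  refine chi_zero ?_
  rw [norm_smul, Real.norm_of_nonneg hs.le]
  calc 2 = s * (2 * s⁻¹) := by field_simp
    _ ≤ _ := by gcongr

lemma cut_cs {s : ℝ} (hs : 0 < s) (γ : Rd d) : HasCompactSupport (cut s γ) :=
  HasCompactSupport.intro (isCompact_closedBall γ (2 * s⁻¹)) fun x hx => cut_zero hs (by
    rw [mem_closedBall, dist_eq_norm, not_le] at hx; exact hx.le)

lemma cut_bd (m : ℕ) : ∃ C, 0 ≤ C ∧ ∀ i ≤ m, ∀ (s : ℝ), 0 ≤ s → ∀ γ x : Rd d, ‖iteratedFDeriv ℝ i (cut s γ) x‖ ≤ C * s ^ i := by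
  obtain ⟨C, h0, hC⟩ := smooth_bdd (chi_smooth (d := d)) chi_cs m
  refine ⟨C, h0, fun i hi s hs γ x => ?_⟩
  have e := iteratedFDeriv_comp_sub (𝕜 := ℝ) (f := fun z : Rd d => chi (s • z)) i γ x
  rw [iteratedFDeriv_comp_const_smul (i := i) s (chi_smooth.of_le (by exact_mod_cast le_top))] at e
  change ‖iteratedFDeriv ℝ i (fun z : Rd d => chi (s • (z - γ))) x‖ ≤ _
  rw [e, norm_smul, norm_pow, Real.norm_of_nonneg hs, mul_comm]
  gcongr
  exact hC i hi _

lemma cut_tg {s : ℝ} (hs : 0 < s) (γ : Rd d) : (cut s γ).HasTemperateGrowth :=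
  (cut_cs hs γ).hasTemperateGrowth (cut_smooth s γ)

lemma cs_approx (Ψ : 𝓢(Rd d, ℂ)) : ∃ Ψn : ℕ → 𝓢(Rd d, ℂ), (∀ n, HasCompactSupport (Ψn n)) ∧
    Tendsto Ψn atTop (𝓝 Ψ) := by
  set Ψn : ℕ → 𝓢(Rd d, ℂ) := fun n => smulLeftCLM ℂ (cut ((n + 1 : ℝ)⁻¹) 0) Ψ with hΨn
  have hs : ∀ n : ℕ, (0 : ℝ) < (n + 1 : ℝ)⁻¹ := fun n => by positivity
  have hap : ∀ n x, Ψn n x = cut ((n + 1 : ℝ)⁻¹) 0 x * Ψ x := fun n x => by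
    simp only [hΨn]; rw [smulLeftCLM_apply_apply (cut_tg (hs n) 0), smul_eq_mul]
  have h0 : ∀ n, HasCompactSupport (Ψn n) := by
    intro n
    have : ⇑(Ψn n) = fun x => cut ((n + 1 : ℝ)⁻¹) 0 x * Ψ x := funext (hap n)
    rw [this]
    exact (cut_cs (hs n) 0).mul_right
  refine ⟨Ψn, h0, ?_⟩
  · rw [(schwartz_withSeminorms ℂ (Rd d) ℂ).tendsto_nhds]
    rintro ⟨k, m⟩ ε hε
    obtain ⟨C, hC0, hC⟩ := cut_bd (d := d) m
    set B := ∑ i ∈ Finset.range (m + 1), (m.choose i : ℝ) * (C + 1) * SchwartzMap.seminorm ℂ (k + 1) (m - i) Ψ with hB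
    have hB0 : 0 ≤ B := Finset.sum_nonneg fun i _ => by positivity
    have hlim : Tendsto (fun n : ℕ => B * (n + 1 : ℝ)⁻¹) atTop (𝓝 0) := by
      have := (tendsto_one_div_add_atTop_nhds_zero_nat (𝕜 := ℝ)).const_mul B
      simpa using this
    filter_upwards [hlim.eventually_lt_const hε] with n hn
    refine lt_of_le_of_lt ?_ hn
    refine SchwartzMap.seminorm_le_bound ℂ k m _ (by positivity) fun x => ?_
    have e : ⇑(Ψn n - Ψ) = fun x => (cut ((n + 1 : ℝ)⁻¹) 0 x - 1) * Ψ x := by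
      ext x; rw [SchwartzMap.sub_apply, hap]; ring
    rw [e]
    have hR : (0 : ℝ) < n + 1 := by positivity
    rcases lt_or_ge ‖x‖ (n + 1 : ℝ) with hx | hx
    · have : (fun x => (cut ((n + 1 : ℝ)⁻¹) 0 x - 1) * Ψ x) =ᶠ[𝓝 x] fun _ => 0 := by
        filter_upwards [(continuous_norm.tendsto x).eventually_lt_const hx] with y hy
        rw [cut_one (hs n) (by simpa using hy.le)]; simp
      rw [(this.iteratedFDeriv ℝ m).eq_of_nhds, iteratedFDeriv_zero_fun]
      simp; positivity
    · have h1 := norm_iteratedFDeriv_mul_le (N := ∞) (((cut_smooth ((n + 1 : ℝ)⁻¹) (0 : Rd d)).sub contDiff_const (g := fun _ => (1 : ℂ))).contDiffOn (s := univ) |> contDiffOn_univ.1) (Ψ.smooth ⊤) x (n := m) (by exact_mod_cast le_top)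
      refine (mul_le_mul_of_nonneg_left h1 (by positivity)).trans ?_
      rw [Finset.mul_sum, hB, Finset.sum_mul]
      refine Finset.sum_le_sum fun i hi => ?_
      have hi' : i ≤ m := by simpa [Nat.lt_succ_iff] using hi
      have h2 : ‖iteratedFDeriv ℝ i (fun x => cut ((n + 1 : ℝ)⁻¹) 0 x - 1) x‖ ≤ C + 1 := by
        have hsub := iteratedFDeriv_sub_apply (𝕜 := ℝ) (i := i) (x := x) (f := cut ((n + 1 : ℝ)⁻¹) 0) (g := fun _ => (1 : ℂ))
          ((cut_smooth _ _).contDiffAt.of_le (by exact_mod_cast le_top)) contDiffAt_const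
        have e2 : (fun x => cut ((n + 1 : ℝ)⁻¹) 0 x - 1) = cut ((n + 1 : ℝ)⁻¹) 0 - fun _ : Rd d => (1 : ℂ) := rfl
        rw [e2, hsub]
        refine (norm_sub_le _ _).trans (add_le_add ?_ ?_)
        · refine (hC i hi' _ (hs n).le 0 x).trans (mul_le_of_le_one_right hC0 (pow_le_one₀ (hs n).le ?_))
          exact inv_le_one_of_one_le₀ (by linarith [(Nat.cast_nonneg n : (0 : ℝ) ≤ n)])
        · rcases Nat.eq_zero_or_pos i with rfl | hi0
          · simp
          · rw [iteratedFDeriv_const_of_ne (by omega)]; simp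
      have h3 := SchwartzMap.le_seminorm ℂ (k + 1) (m - i) Ψ x
      have h4 : ‖x‖ ^ k ≤ ‖x‖ ^ (k + 1) * (n + 1 : ℝ)⁻¹ := by
        rw [pow_succ, ← div_eq_mul_inv, le_div_iff₀ hR]; gcongr
      calc _ ≤ ‖x‖ ^ (k + 1) * (n + 1 : ℝ)⁻¹ * ((m.choose i : ℝ) * (C + 1) * ‖iteratedFDeriv ℝ (m - i) Ψ x‖) := by gcongr
        _ = (m.choose i : ℝ) * (C + 1) * (‖x‖ ^ (k + 1) * ‖iteratedFDeriv ℝ (m - i) Ψ x‖) * (n + 1 : ℝ)⁻¹ := by ring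
        _ ≤ _ := by gcongr

lemma td_dense (u : TemperedDist d) (hu : ∀ φ : 𝓢(Rd d, ℂ), HasCompactSupport φ → u φ = 0) : u = 0 := by
  ext Ψ
  obtain ⟨Ψn, h0, hT⟩ := cs_approx Ψ
  have := (u.continuous.tendsto Ψ).comp hT
  simp only [Function.comp_def, fun n => hu _ (h0 n)] at this
  exact (tendsto_nhds_unique tendsto_const_nhds this).symm

end Modu

section SuppL
open Filter Topology
open scoped ContDiff Manifold
variable {d : ℕ}

def mulS (b : Rd d → ℂ) (hb : ContDiff ℝ ∞ b) (ψ : 𝓢(Rd d, ℂ)) (hψ : HasCompactSupport ψ) : 𝓢(Rd d, ℂ) :=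
  HasCompactSupport.toSchwartzMap (f := fun x => b x * ψ x) hψ.mul_left (hb.mul (ψ.smooth ⊤))

lemma mulS_apply (b : Rd d → ℂ) (hb : ContDiff ℝ ∞ b) (ψ : 𝓢(Rd d, ℂ)) (hψ : HasCompactSupport ψ) (x : Rd d) :
    mulS b hb ψ hψ x = b x * ψ x := rfl

lemma mulS_cs (b : Rd d → ℂ) (hb : ContDiff ℝ ∞ b) (ψ : 𝓢(Rd d, ℂ)) (hψ : HasCompactSupport ψ) :
    HasCompactSupport (mulS b hb ψ hψ) := hψ.mul_left

lemma mulS_ts (b : Rd d → ℂ) (hb : ContDiff ℝ ∞ b) (ψ : 𝓢(Rd d, ℂ)) (hψ : HasCompactSupport ψ) :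
    tsupport (mulS b hb ψ hψ) ⊆ tsupport ψ := tsupport_mul_subset_right

lemma mulS_ts' (b : Rd d → ℂ) (hb : ContDiff ℝ ∞ b) (ψ : 𝓢(Rd d, ℂ)) (hψ : HasCompactSupport ψ) :
    tsupport (mulS b hb ψ hψ) ⊆ tsupport b := tsupport_mul_subset_left

lemma ts_sub {b : Rd d → ℂ} {S : Set (Rd d)} (hS : IsClosed S) (h : ∀ x ∉ S, b x = 0) : tsupport b ⊆ S :=
  closure_minimal (fun x hx => by by_contra hn; exact hx (h x hn)) hS

lemma lemP (u : TemperedDist d) (ψ : 𝓢(Rd d, ℂ)) (hψ : HasCompactSupport ψ)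
    (h : ∀ x ∈ tsupport ψ, x ∉ tdSupport u) : u ψ = 0 := by
  have h1 : ∀ x : tsupport ψ, ∃ U : Set (Rd d), IsOpen U ∧ (x : Rd d) ∈ U ∧
      ∀ φ : 𝓢(Rd d, ℂ), HasCompactSupport φ → tsupport φ ⊆ U → u φ = 0 := by
    rintro ⟨x, hx⟩
    have := h x hx
    simp only [tdSupport, mem_setOf_eq, not_forall] at this
    obtain ⟨U, hU, hxU, hn⟩ := this
    refine ⟨U, hU, hxU, fun φ hφ hs => ?_⟩
    by_contra hne
    exact hn ⟨φ, hφ, hs, hne⟩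
  choose U hU hxU hUu using h1
  obtain ⟨t, ht⟩ := hψ.isCompact.elim_finite_subcover U hU (fun x hx => mem_iUnion.2 ⟨⟨x, hx⟩, hxU _⟩)
  obtain ⟨ρ, hρ⟩ := SmoothPartitionOfUnity.exists_isSubordinate (ι := t) 𝓘(ℝ, Rd d) (isClosed_tsupport ψ)
    (fun i => U i) (fun i => hU i) (fun x hx => by
      obtain ⟨i, hi, hx⟩ := mem_iUnion₂.1 (ht hx)
      exact mem_iUnion.2 ⟨⟨i, hi⟩, hx⟩)
  have hsm : ∀ i, ContDiff ℝ ∞ (fun x => ((ρ i x : ℝ) : ℂ)) := fun i =>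
    Complex.ofRealCLM.contDiff.comp (ρ i).contMDiff.contDiff
  have e : ψ = ∑ i, mulS _ (hsm i) ψ hψ := by
    ext x
    rw [SchwartzMap.sum_apply]
    simp only [mulS_apply]
    rw [← Finset.sum_mul]
    by_cases hx : x ∈ tsupport ψ
    · have := ρ.sum_eq_one hx
      rw [finsum_eq_sum_of_fintype] at this
      rw [← Complex.ofReal_sum, this]; simp
    · rw [image_eq_zero_of_notMem_tsupport hx, mul_zero]
  rw [e, map_sum]
  refine Finset.sum_eq_zero fun i _ => hUu i _ (mulS_cs _ _ _ _) ((mulS_ts' _ _ _ _).trans ?_)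
  refine subset_trans ?_ (hρ i)
  exact closure_mono fun x hx => by
    simp only [Function.mem_support] at hx ⊢
    exact fun h0 => hx (by rw [h0]; simp)

def Big (m : ℕ) (γ : Rd d) (w : ℝ → Rd d → ℂ) (p : ℕ) : Prop :=
  (∀ ε, ContDiff ℝ ∞ (w ε)) ∧ ∃ C, 0 ≤ C ∧ ∀ ε, 0 < ε → ε ≤ 1 → ∀ i ≤ m, ∀ x, ‖x - γ‖ ≤ 2 * ε →
    ε ^ i * ‖iteratedFDeriv ℝ i (w ε) x‖ ≤ C * ε ^ p

lemma Big.mul {m : ℕ} {γ : Rd d} {w z : ℝ → Rd d → ℂ} {p q : ℕ} (hw : Big m γ w p) (hz : Big m γ z q) :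
    Big m γ (fun ε x => w ε x * z ε x) (p + q) := by
  obtain ⟨sw, C, hC0, hC⟩ := hw
  obtain ⟨sz, C', hC0', hC'⟩ := hz
  refine ⟨fun ε => (sw ε).mul (sz ε), 2 ^ m * (C * C'), by positivity, fun ε h0 h1 i hi x hx => ?_⟩
  have h := norm_iteratedFDeriv_mul_le (sw ε) (sz ε) x (n := i) (by exact_mod_cast le_top)
  calc ε ^ i * _ ≤ ε ^ i * ∑ j ∈ Finset.range (i + 1), (i.choose j : ℝ) * ‖iteratedFDeriv ℝ j (w ε) x‖ * ‖iteratedFDeriv ℝ (i - j) (z ε) x‖ := by gcongr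
    _ = ∑ j ∈ Finset.range (i + 1), (i.choose j : ℝ) * ((ε ^ j * ‖iteratedFDeriv ℝ j (w ε) x‖) * (ε ^ (i - j) * ‖iteratedFDeriv ℝ (i - j) (z ε) x‖)) := by
      rw [Finset.mul_sum]
      refine Finset.sum_congr rfl fun j hj => ?_
      have : j + (i - j) = i := by simp at hj; omega
      nth_rewrite 1 [← this]
      rw [pow_add]; ring
    _ ≤ ∑ j ∈ Finset.range (i + 1), (i.choose j : ℝ) * ((C * ε ^ p) * (C' * ε ^ q)) := by
      refine Finset.sum_le_sum fun j hj => ?_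
      simp at hj
      have a1 := hC ε h0 h1 j (by omega) x hx
      have a2 := hC' ε h0 h1 (i - j) (by omega) x hx
      gcongr
    _ = 2 ^ i * (C * C') * ε ^ (p + q) := by
      rw [← Finset.sum_mul]
      have : ∑ j ∈ Finset.range (i + 1), (i.choose j : ℝ) = 2 ^ i := by exact_mod_cast Nat.sum_range_choose i
      rw [this]; ring
    _ ≤ _ := by gcongr; norm_num

lemma cpt_bdd {f : Rd d → ℂ} (hf : ContDiff ℝ ∞ f) (γ : Rd d) (m : ℕ) :
    ∃ C, 0 ≤ C ∧ ∀ i ≤ m, ∀ x, ‖x - γ‖ ≤ 2 → ‖iteratedFDeriv ℝ i f x‖ ≤ C := by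
  obtain ⟨C, h0, hC⟩ := smooth_bdd (f := fun x => cut (1/4) γ x * f x) ((cut_smooth _ _).mul hf)
    (cut_cs (by norm_num) γ).mul_right m
  refine ⟨C, h0, fun i hi x hx => ?_⟩
  have : (fun x => cut (1/4) γ x * f x) =ᶠ[𝓝 x] f := by
    have hc : Continuous fun y : Rd d => ‖y - γ‖ := by fun_prop
    filter_upwards [(hc.tendsto x).eventually_lt_const (lt_of_le_of_lt hx (by norm_num : (2 : ℝ) < 4))] with y hy
    rw [cut_one (by norm_num) (by norm_num; exact hy.le), one_mul]
  rw [← (this.iteratedFDeriv ℝ i).eq_of_nhds]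
  exact hC i hi x

lemma Big.const {f : Rd d → ℂ} (hf : ContDiff ℝ ∞ f) (m : ℕ) (γ : Rd d) : Big m γ (fun _ => f) 0 := by
  obtain ⟨C, h0, hC⟩ := cpt_bdd hf γ m
  refine ⟨fun _ => hf, C, h0, fun ε e0 e1 i hi x hx => ?_⟩
  have := hC i hi x (by linarith)
  calc _ ≤ 1 * C := by gcongr; exact pow_le_one₀ e0.le e1
    _ = _ := by simp

lemma Big.van {f : Rd d → ℂ} (hf : ContDiff ℝ ∞ f) (m : ℕ) (γ : Rd d) (hv : f γ = 0) : Big m γ (fun _ => f) 1 := by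
  obtain ⟨C, h0, hC⟩ := cpt_bdd hf γ (m + 1)
  refine ⟨fun _ => hf, 2 * C, by positivity, fun ε e0 e1 i hi x hx => ?_⟩
  rcases Nat.eq_zero_or_pos i with rfl | hi0
  · have := (convex_closedBall γ 2).norm_image_sub_le_of_norm_fderiv_le (𝕜 := ℝ) (f := f) (C := C) (x := γ) (y := x)
      (fun y _ => (hf.differentiable (by simp)) y) (fun y hy => by
        rw [← norm_iteratedFDeriv_one]
        exact hC 1 (by omega) y (by simpa [dist_eq_norm] using hy)) (by simp) (by simp [dist_eq_norm]; linarith)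
    rw [hv, sub_zero] at this
    simp only [pow_zero, one_mul, norm_iteratedFDeriv_zero, pow_one]
    nlinarith
  · have := hC i (by omega) x (by linarith)
    have h2 : ε ^ i ≤ ε := by
      calc ε ^ i ≤ ε ^ 1 := pow_le_pow_of_le_one e0.le e1 hi0
        _ = ε := pow_one _
    calc _ ≤ ε * C := by gcongr
      _ ≤ _ := by rw [pow_one]; nlinarith

lemma Big.pow {f : Rd d → ℂ} (hf : ContDiff ℝ ∞ f) (m : ℕ) (γ : Rd d) (hv : f γ = 0) (p : ℕ) :
    Big m γ (fun _ x => f x ^ p) p := by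
  induction p with
  | zero => simpa using Big.const (f := fun _ => (1 : ℂ)) contDiff_const m γ
  | succ p ih => simpa only [pow_succ] using ih.mul (Big.van hf m γ hv)

lemma Big.cut (m : ℕ) (γ : Rd d) : Big m γ (fun ε => cut ε⁻¹ γ) 0 := by
  obtain ⟨C, h0, hC⟩ := cut_bd (d := d) m
  refine ⟨fun ε => cut_smooth _ _, C, h0, fun ε e0 e1 i hi x hx => ?_⟩
  have := hC i hi ε⁻¹ (by positivity) γ x
  calc _ ≤ ε ^ i * (C * ε⁻¹ ^ i) := by gcongr
    _ = C * ε ^ 0 := by rw [inv_pow]; field_simp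

lemma td_order (u : TemperedDist d) : ∃ (s : Finset (ℕ × ℕ)) (C : ℝ≥0), ∀ φ,
    ‖u φ‖ ≤ C * s.sup (schwartzSeminormFamily ℂ (Rd d) ℂ) φ := by
  obtain ⟨s, C, _, h⟩ := Seminorm.bound_of_continuous (schwartz_withSeminorms ℂ (Rd d) ℂ)
    ((normSeminorm ℂ ℂ).comp u.toLinearMap) (continuous_norm.comp u.continuous)
  exact ⟨s, C, fun φ => h φ⟩

lemma lemZ1 (u : TemperedDist d) : ∃ m : ℕ, ∀ (γ : Rd d) (v : Rd d → ℂ) (hv : ContDiff ℝ ∞ v), v γ = 0 →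
    ∀ (ψ φ : 𝓢(Rd d, ℂ)), HasCompactSupport ψ → (∀ x ∈ tsupport ψ, x ∈ tdSupport u → x = γ) →
    (∀ x, φ x = v x ^ (m + 1) * ψ x) → u φ = 0 := by
  obtain ⟨s, C, hC⟩ := td_order u
  set m := s.sup Prod.snd with hm
  set k0 := s.sup Prod.fst with hk0
  refine ⟨m, fun γ v hv hvγ ψ φ hψ hsupp hφ => ?_⟩
  obtain ⟨_, B, hB0, hB⟩ := ((Big.cut m γ).mul (Big.pow hv m γ hvγ (m + 1))).mul (Big.const (ψ.smooth ⊤) m γ)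
  have hφ' : HasCompactSupport φ := by
    have : ⇑φ = fun x => v x ^ (m + 1) * ψ x := funext hφ
    rw [this]; exact hψ.mul_left
  have key : ∀ ε : ℝ, 0 < ε → ε ≤ 1 → ‖u φ‖ ≤ C * ((1 + (‖γ‖ + 2)) ^ k0 * B) * ε := by
    intro ε e0 e1
    set φε := mulS _ (cut_smooth ε⁻¹ γ) φ hφ' with hφε
    have e : φ = φε + mulS (fun x => 1 - cut ε⁻¹ γ x) (contDiff_const.sub (cut_smooth ε⁻¹ γ)) φ hφ' := by
      ext x; rw [SchwartzMap.add_apply, hφε, mulS_apply, mulS_apply]; ring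
    have h0 : u (mulS (fun x => 1 - cut ε⁻¹ γ x) (contDiff_const.sub (cut_smooth ε⁻¹ γ)) φ hφ') = 0 := by
      refine lemP u _ (mulS_cs _ _ _ _) fun x hx hxu => ?_
      have h1 : x ∈ tsupport ψ := by
        refine closure_mono ?_ (mulS_ts _ _ _ _ hx)
        intro y hy; simp only [Function.mem_support] at hy ⊢
        intro h0; exact hy (by rw [hφ, h0, mul_zero])
      have hc : Continuous fun y : Rd d => ‖y - γ‖ := by fun_prop
      have h2 : x ∈ {y : Rd d | ε ≤ ‖y - γ‖} := ts_sub (isClosed_le continuous_const hc)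
        (fun y hy => by
          simp only [mem_setOf_eq, not_le] at hy
          rw [cut_one (by positivity) (by rw [inv_inv]; exact hy.le), sub_self]) (mulS_ts' _ _ _ _ hx)
      rw [hsupp x h1 hxu] at h2
      simp at h2; linarith
    rw [e, map_add, h0, add_zero]
    refine (hC φε).trans ?_
    rw [mul_assoc]
    refine mul_le_mul_of_nonneg_left ?_ C.2
    refine Seminorm.finset_sup_apply_le (by positivity) ?_
    rintro ⟨k, n⟩ hkn
    have hn : n ≤ m := Finset.le_sup (f := Prod.snd) hkn
    have hk : k ≤ k0 := Finset.le_sup (f := Prod.fst) hkn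
    refine SchwartzMap.seminorm_le_bound ℂ k n _ (by positivity) fun x => ?_
    have ec : ⇑φε = fun x => cut ε⁻¹ γ x * v x ^ (m + 1) * ψ x := by
      ext x; rw [hφε, mulS_apply, hφ]; ring
    rcases le_or_gt ‖x - γ‖ (2 * ε) with hx | hx
    · have b := hB ε e0 e1 n hn x hx
      beta_reduce at b
      rw [← ec] at b
      have b2 : ‖iteratedFDeriv ℝ n φε x‖ ≤ B * ε := by
        have : ε ^ (0 + (m + 1) + 0) ≤ ε ^ n * ε := by
          rw [← pow_succ]; exact pow_le_pow_of_le_one e0.le e1 (by omega)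
        have hp : 0 < ε ^ n := by positivity
        refine le_of_mul_le_mul_left ?_ hp
        calc _ ≤ _ := b
          _ ≤ B * (ε ^ n * ε) := by gcongr
          _ = _ := by ring
      have hxn : ‖x‖ ≤ 1 + (‖γ‖ + 2) := by
        have := norm_sub_norm_le x γ; linarith
      calc ‖x‖ ^ k * _ ≤ (1 + (‖γ‖ + 2)) ^ k0 * (B * ε) := by
            refine mul_le_mul ?_ b2 (by positivity) (by positivity)
            calc ‖x‖ ^ k ≤ (1 + (‖γ‖ + 2)) ^ k := by gcongr
              _ ≤ _ := pow_le_pow_right₀ (by linarith [norm_nonneg γ]) hk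
        _ = _ := by ring
    · have : (⇑φε) =ᶠ[𝓝 x] fun _ => 0 := by
        have hc : Continuous fun y : Rd d => ‖y - γ‖ := by fun_prop
        filter_upwards [(hc.tendsto x).eventually_const_lt hx] with y hy
        rw [hφε, mulS_apply, cut_zero (by positivity) (by rw [inv_inv]; exact hy.le), zero_mul]
      rw [(this.iteratedFDeriv ℝ n).eq_of_nhds, iteratedFDeriv_zero_fun]
      simp; positivity
  have hlim : Tendsto (fun ε : ℝ => C * ((1 + (‖γ‖ + 2)) ^ k0 * B) * ε) (𝓝[>] 0) (𝓝 0) := by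
    have : Tendsto (fun ε : ℝ => C * ((1 + (‖γ‖ + 2)) ^ k0 * B) * ε) (𝓝 0) (𝓝 (C * ((1 + (‖γ‖ + 2)) ^ k0 * B) * 0)) :=
      tendsto_id.const_mul _
    rw [mul_zero] at this
    exact this.mono_left nhdsWithin_le_nhds
  have : ‖u φ‖ ≤ 0 := ge_of_tendsto hlim (by
    filter_upwards [Ioc_mem_nhdsGT (zero_lt_one' ℝ)] with ε hε
    exact key ε hε.1 hε.2)
  exact norm_le_zero_iff.1 this

end SuppL

section TrigR
open Filter Topology
open scoped ContDiff
variable {d : ℕ}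

def dl (a : ℕ → ℂ) (n : ℕ) : ℂ := a (n + 1) - a n

lemma dl_zero (p : ℕ) : ∀ (a : ℕ → ℂ) (C : ℝ), (∀ n, ‖a n‖ ≤ C) → (∀ n, dl^[p + 1] a n = 0) → ∀ n, dl a n = 0 := by
  induction p with
  | zero => intro a C _ h; exact h
  | succ p ih =>
    intro a C hC h
    have h1 := ih (dl a) (C + C) (fun n => (norm_sub_le _ _).trans (add_le_add (hC _) (hC _))) h
    have h2 : ∀ n, dl a n = dl a 0 := fun n => by
      induction n with
      | zero => rfl
      | succ n hn => rw [← hn]; exact sub_eq_zero.1 (h1 n)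
    have h3 : ∀ n : ℕ, a n = a 0 + n * dl a 0 := fun n => by
      induction n with
      | zero => simp
      | succ n hn =>
        have : a (n + 1) = a n + dl a n := by simp [dl]
        rw [this, h2, hn]; push_cast; ring
    have h4 : dl a 0 = 0 := by
      by_contra hne
      obtain ⟨n, hn⟩ := exists_nat_gt ((C + C) / ‖dl a 0‖)
      have hp : 0 < ‖dl a 0‖ := norm_pos_iff.2 hne
      rw [div_lt_iff₀ hp] at hn
      have : ‖(n : ℂ) * dl a 0‖ ≤ C + C := by
        have e : (n : ℂ) * dl a 0 = a n - a 0 := by rw [h3 n]; ring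
        rw [e]; exact (norm_sub_le _ _).trans (add_le_add (hC _) (hC _))
      rw [norm_mul, Complex.norm_natCast] at this
      linarith
    exact fun n => (h2 n).trans h4

lemma e2pi_nsmul (x h : Rd d) (n : ℕ) : e2pi x (n • h) = e2pi x h ^ n := by
  rw [e2pi_symm]
  induction n with
  | zero => simp [e2pi_zero]
  | succ n ih => rw [succ_nsmul, e2pi_add, ih, pow_succ, e2pi_symm h x]

lemma e2pi_smooth (h : Rd d) : ContDiff ℝ ∞ (fun x => e2pi x h) := (tg_e2pi h).1

lemma lemZ (u : TemperedDist d) (hb : ∀ ψ, ∃ C, ∀ t, ‖u (md t ψ)‖ ≤ C) (γ : Rd d) (ψ : 𝓢(Rd d, ℂ))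
    (hψ : HasCompactSupport ψ) (hs : ∀ x ∈ tsupport ψ, x ∈ tdSupport u → x = γ) (h : Rd d) :
    u (md h ψ) = u ψ * e2pi h γ := by
  obtain ⟨m, hm⟩ := lemZ1 u
  set A : 𝓢(Rd d, ℂ) →ₗ[ℂ] 𝓢(Rd d, ℂ) := e2pi (-γ) h • (md h).toLinearMap with hA
  have hAx : ∀ φ x, A φ x = (e2pi (-γ) h * e2pi x h) * φ x := fun φ x => by
    simp [hA, md_apply]; ring
  have hAn : ∀ n φ x, (A ^ n) φ x = (e2pi (-γ) h * e2pi x h) ^ n * φ x := fun n => by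
    induction n with
    | zero => simp
    | succ n ih => intro φ x; rw [pow_succ, Module.End.mul_apply, ih, hAx]; ring
  have hBn : ∀ n φ x, ((A - 1) ^ n) φ x = (e2pi (-γ) h * e2pi x h - 1) ^ n * φ x := fun n => by
    induction n with
    | zero => simp
    | succ n ih =>
      intro φ x; rw [pow_succ, Module.End.mul_apply, ih, LinearMap.sub_apply, SchwartzMap.sub_apply, hAx,
        Module.End.one_apply]; ring
  have hdl : ∀ j φ n, dl^[j] (fun n => u ((A ^ n) φ)) n = u ((A ^ n) (((A - 1) ^ j) φ)) := fun j => by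
    induction j with
    | zero => simp
    | succ j ih =>
      intro φ n
      rw [Function.iterate_succ_apply]
      have : dl (fun n => u ((A ^ n) φ)) = fun n => u ((A ^ n) ((A - 1) φ)) := by
        ext n; simp only [dl]; rw [← map_sub]; congr 1
        rw [pow_succ, Module.End.mul_apply, LinearMap.sub_apply, map_sub, Module.End.one_apply]
      rw [this, ih, pow_succ, Module.End.mul_apply]
  obtain ⟨C, hC⟩ := hb ψ
  have hz := dl_zero m (fun n => u ((A ^ n) ψ)) C (fun n => by
      have : (A ^ n) ψ = e2pi (-γ) h ^ n • md (n • h) ψ := by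
        ext x; rw [hAn, SchwartzMap.smul_apply, md_apply, e2pi_nsmul, smul_eq_mul]; ring
      rw [this, map_smul, norm_smul, norm_pow, e2pi_norm, one_pow, one_mul]; exact hC _)
    (fun n => by
      rw [hdl]
      have hsub : Function.support ((A ^ n) ψ) ⊆ Function.support ψ := fun x hx => by
        simp only [Function.mem_support] at hx ⊢
        intro h0; exact hx (by rw [hAn, h0, mul_zero])
      refine hm γ (fun x => e2pi (-γ) h * e2pi x h - 1) ((contDiff_const.mul (e2pi_smooth h)).sub contDiff_const)
        (by simp [e2pi_neg_mul]) ((A ^ n) ψ) _ (hψ.mono hsub)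
        (fun x hx => hs x (closure_mono hsub hx)) (fun x => ?_)
      rw [hAn, hBn, hAn]; ring) 0
  simp only [dl, zero_add, pow_one, pow_zero, Module.End.one_apply, sub_eq_zero] at hz
  rw [← hz, hA, LinearMap.smul_apply, map_smul, smul_eq_mul, e2pi_symm h γ]
  have := e2pi_neg_mul γ h
  simp only [ContinuousLinearMap.coe_coe]
  linear_combination (-(u (md h ψ))) * this

lemma trig_u (u : TemperedDist d) (hb : ∀ ψ, ∃ C, ∀ t, ‖u (md t ψ)‖ ≤ C) (Z : Finset (Rd d)) :
    ∀ (β : 𝓢(Rd d, ℂ)), HasCompactSupport β → (∀ x ∈ tsupport β, x ∈ tdSupport u → x ∈ Z) →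
    ∃ c : Rd d → ℂ, ∀ t, u (md t β) = ∑ γ ∈ Z, c γ * e2pi t γ := by
  classical
  induction Z using Finset.induction_on with
  | empty =>
    intro β hβ h
    refine ⟨0, fun t => ?_⟩
    have hsub : Function.support (md t β) ⊆ Function.support β := fun x hx => by
        simp only [Function.mem_support] at hx ⊢
        intro h0; exact hx (by rw [md_apply, h0, mul_zero])
    rw [Finset.sum_empty]
    exact lemP u _ (hβ.mono hsub) fun x hx hu => by simpa using h x (closure_mono hsub hx) hu
  | insert γ Z hγ ih =>
    intro β hβ h
    obtain ⟨r, r0, hr⟩ : ∃ r > 0, ∀ z ∈ Z, r < ‖z - γ‖ := by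
      have : ∀ᶠ r : ℝ in 𝓝[>] 0, ∀ z ∈ Z, r < ‖z - γ‖ := by
        rw [Filter.eventually_all_finset]
        intro z hz
        have : 0 < ‖z - γ‖ := norm_pos_iff.2 (sub_ne_zero.2 (by rintro rfl; exact hγ hz))
        exact (eventually_lt_nhds this).filter_mono nhdsWithin_le_nhds
      exact ((eventually_mem_nhdsWithin).and this).exists
    have s0 : 0 < 2 / r := by positivity
    have hc : Continuous fun y : Rd d => ‖y - γ‖ := by fun_prop
    set β1 := mulS _ (cut_smooth (2 / r) γ) β hβ with hβ1
    set β2 := mulS (fun x => 1 - cut (2 / r) γ x) (contDiff_const.sub (cut_smooth _ γ)) β hβ with hβ2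
    have e : β = β1 + β2 := by
      ext x; rw [SchwartzMap.add_apply, hβ1, hβ2, mulS_apply, mulS_apply]; ring
    obtain ⟨c, hcc⟩ := ih β2 (mulS_cs _ _ _ _) (fun x hx hu => by
      have h1 := h x (mulS_ts _ _ _ _ hx) hu
      have h2 : x ∈ {y : Rd d | (2 / r)⁻¹ ≤ ‖y - γ‖} := ts_sub (isClosed_le continuous_const hc)
        (fun y hy => by
          simp only [mem_setOf_eq, not_le] at hy
          rw [cut_one s0 hy.le, sub_self]) (mulS_ts' _ _ _ _ hx)
      rcases Finset.mem_insert.1 h1 with rfl | h1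
      · simp at h2; linarith
      · exact h1)
    have h1 := lemZ u hb γ β1 (mulS_cs _ _ _ _) (fun x hx hu => by
      have h1 := h x (mulS_ts _ _ _ _ hx) hu
      have h2 : x ∈ {y : Rd d | ‖y - γ‖ ≤ 2 * (2 / r)⁻¹} := ts_sub (isClosed_le hc continuous_const)
        (fun y hy => by
          simp only [mem_setOf_eq, not_le] at hy
          exact cut_zero s0 hy.le) (mulS_ts' _ _ _ _ hx)
      rcases Finset.mem_insert.1 h1 with rfl | h1
      · rfl
      · have := hr x h1
        simp only [mem_setOf_eq] at h2
        rw [inv_div] at h2; linarith)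
    refine ⟨fun z => if z = γ then u β1 else c z, fun t => ?_⟩
    rw [Finset.sum_insert hγ, e, map_add, map_add, h1, hcc]
    simp only [if_true]
    congr 1
    refine Finset.sum_congr rfl fun z hz => ?_
    rw [if_neg (by rintro rfl; exact hγ hz)]

lemma trig_f (f : TemperedDist d) (hb : ∀ ψ, ∃ C, ∀ t, ‖f (tr t ψ)‖ ≤ C) (Z : Finset (Rd d))
    (β : 𝓢(Rd d, ℂ)) (hβ : HasCompactSupport β) (h : ∀ x ∈ tsupport β, x ∈ tdSupport (fourierTD f) → x ∈ Z) :
    ∃ c : Rd d → ℂ, ∀ t, f (tr t (FT β)) = ∑ γ ∈ Z, c γ * e2pi t γ := by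
  have e : ∀ t ψ, fourierTD f (md t ψ) = f (tr t (FT ψ)) := fun t ψ => by
    rw [← FT_md]; rfl
  obtain ⟨c, hc⟩ := trig_u (fourierTD f) (fun ψ => by simpa only [e] using hb (FT ψ)) Z β hβ h
  exact ⟨c, fun t => by rw [← e, hc]⟩

end TrigR

section Asym
open Filter Topology LineDeriv
variable {d : ℕ}

lemma pd_md (i : Fin d) (h : Rd d) (ψ : 𝓢(Rd d, ℂ)) :
    lineDerivOpCLM ℂ 𝓢(Rd d, ℂ) (ee i) (md h ψ) =
      md h (lineDerivOpCLM ℂ 𝓢(Rd d, ℂ) (ee i) ψ + (2 * Real.pi * Complex.I * h i : ℂ) • ψ) := by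
  ext x
  have e : ⇑(md h ψ) = fun x => e2pi x h * ψ x := funext fun x => md_apply h ψ x
  have h1 : HasFDerivAt (fun x : Rd d => ⟪x, h⟫) ((innerSL ℝ).flip h) x := ((innerSL ℝ).flip h).hasFDerivAt
  have h2 : HasFDerivAt (fun x => e2pi x h) _ x :=
    ((Complex.ofRealCLM.hasFDerivAt.comp x h1).const_mul (((2 * Real.pi : ℝ) : ℂ) * Complex.I)).cexp
  have h3 := h2.mul (ψ.differentiable.differentiableAt (x := x)).hasFDerivAt
  have h4 : lineDerivOpCLM ℂ 𝓢(Rd d, ℂ) (ee i) (md h ψ) x = fderiv ℝ (md h ψ) x (ee i) := rfl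
  have hi : innerSL ℝ h (ee i) = h i := by simp [EuclideanSpace.inner_single_right]
  rw [h4, show ⇑(md h ψ) = (fun x => e2pi x h) * ⇑ψ from e, h3.fderiv, md_apply]
  change _ = e2pi x h * (fderiv ℝ ψ x (ee i) + (2 * Real.pi * Complex.I * h i : ℂ) * ψ x)
  simp [hi, e2pi]
  ring

def Qp (s : Rd d) (n : ℕ) (Φ : ℝ → 𝓢(Rd d, ℂ)) (lead : 𝓢(Rd d, ℂ)) : Prop :=
  ∃ q : ℕ → 𝓢(Rd d, ℂ), ∀ S : ℝ, Φ S = md (-(S • s)) ((S : ℂ) ^ n • lead + ∑ l ∈ Finset.range n, (S : ℂ) ^ l • q l)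

abbrev cpi : ℂ := -(2 * Real.pi * Complex.I)

lemma Qp.step {s : Rd d} {n : ℕ} {Φ : ℝ → 𝓢(Rd d, ℂ)} {lead : 𝓢(Rd d, ℂ)} (h : Qp s n Φ lead) (i : Fin d) :
    Qp s (n + 1) (fun S => lineDerivOpCLM ℂ 𝓢(Rd d, ℂ) (ee i) (Φ S)) ((cpi * s i) • lead) := by
  obtain ⟨q, hq⟩ := h
  set D := lineDerivOpCLM ℂ 𝓢(Rd d, ℂ) (ee i)
  refine ⟨fun l => (if l < n then D (q l) else D lead) + (if l = 0 then 0 else (cpi * s i) • q (l - 1)), fun S => ?_⟩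
  beta_reduce
  rw [hq, pd_md]
  congr 1
  have e1 : ∑ l ∈ Finset.range (n + 1), (S : ℂ) ^ l • (if l < n then D (q l) else D lead) =
      ∑ l ∈ Finset.range n, (S : ℂ) ^ l • D (q l) + (S : ℂ) ^ n • D lead := by
    rw [Finset.sum_range_succ, if_neg (lt_irrefl n)]
    congr 1
    exact Finset.sum_congr rfl fun l hl => by rw [if_pos (Finset.mem_range.1 hl)]
  have e2 : ∑ l ∈ Finset.range (n + 1), (S : ℂ) ^ l • (if l = 0 then 0 else (cpi * s i) • q (l - 1)) =
      (S * (cpi * s i)) • ∑ l ∈ Finset.range n, (S : ℂ) ^ l • q l := by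
    rw [Finset.sum_range_succ', Finset.smul_sum]
    simp [smul_smul]
    exact Finset.sum_congr rfl fun l hl => by congr 1; ring
  simp only [smul_add, Finset.sum_add_distrib, e1, e2, map_add, map_sum, map_smul]
  have e3 : (2 * Real.pi * Complex.I * ((-(S • s)) i : ℝ) : ℂ) = S * (cpi * s i) := by
    simp; ring
  have e4 : (S : ℂ) ^ (n + 1) • (cpi * s i) • lead = (S * (cpi * s i)) • (S : ℂ) ^ n • lead := by
    simp only [smul_smul]; congr 1; ring
  rw [e3, e4]
  abel

lemma Qp_DS (s : Rd d) (k : Fin d → ℕ) (φ : 𝓢(Rd d, ℂ)) :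
    Qp s (∑ i, k i) (fun S => DS k (md (-(S • s)) φ)) ((cpi ^ (∑ i, k i) * monom k s) • φ) := by
  have h1 : ∀ (i : Fin d) (j n : ℕ) (Φ : ℝ → 𝓢(Rd d, ℂ)) (lead : 𝓢(Rd d, ℂ)), Qp s n Φ lead →
      Qp s (j + n) (fun S => ((lineDerivOpCLM ℂ 𝓢(Rd d, ℂ) (ee i)) ^ j) (Φ S)) ((cpi ^ j * (s i : ℂ) ^ j) • lead) := by
    intro i j
    induction j with
    | zero => intro n Φ lead h; simpa using h
    | succ j ih =>
      intro n Φ lead h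
      have := (ih n Φ lead h).step i
      rw [smul_smul] at this
      have e : j + 1 + n = j + n + 1 := by ring
      rw [e]
      convert this using 1
      · ext S x; rw [pow_succ']; rfl
      · congr 1; ring
  have h2 : ∀ l : List (Fin d), Qp s (l.map k).sum
      (fun S => (l.map fun i => (lineDerivOpCLM ℂ 𝓢(Rd d, ℂ) (ee i)) ^ (k i)).prod (md (-(S • s)) φ))
      ((cpi ^ (l.map k).sum * (l.map fun i => (s i : ℂ) ^ k i).prod) • φ) := by
    intro l
    induction l with
    | nil => exact ⟨0, fun S => by simp⟩
    | cons i l ih =>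
      have := h1 i (k i) _ _ _ ih
      rw [smul_smul] at this
      simp only [List.map_cons, List.sum_cons, List.prod_cons]
      convert this using 1
      congr 1; rw [pow_add]; ring
  have := h2 (List.finRange d)
  rw [← Fin.sum_univ_def, ← Fin.prod_univ_def] at this
  simpa [monom, DS] using this

lemma LD0_bdd (p : Rd d → ℂ) (h : TB wt p) (ψ : 𝓢(Rd d, ℂ)) :
    ∃ C, 0 ≤ C ∧ ∀ t w, ‖LD0 p h (tr t (md w ψ))‖ ≤ C := by
  obtain ⟨M, hM⟩ := id h
  have hb : ∀ t w, ‖LD0 p h (tr t (md w ψ))‖ ≤ Wsn ψ * M := fun t w =>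
    hM.tsum_bd (md w ψ) (Wsn_nonneg ψ) (fun x => by
      rw [md_apply, norm_mul, e2pi_norm, one_mul]; exact wt_bound ψ x) t
  exact ⟨_, (norm_nonneg _).trans (hb 0 0), hb⟩

lemma asym_k (p : Rd d → ℂ) (h : TB wt p) (k : Fin d → ℕ) (n : ℕ) (hk : ∑ i, k i ≤ n) (s : Rd d) (φ : 𝓢(Rd d, ℂ)) :
    ∃ C, ∀ S : ℝ, 1 ≤ S → ∀ t, ‖((S : ℂ) ^ n)⁻¹ * LD p h k (tr t (md (-(S • s)) φ)) -
      (if ∑ i, k i = n then (-cpi) ^ n * monom k s else 0) * LD0 p h (tr t (md (-(S • s)) φ))‖ ≤ C / S := by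
  obtain ⟨q, hq⟩ := Qp_DS s k φ
  set m := ∑ i, k i with hm
  obtain ⟨C0, hC0, hb0⟩ := LD0_bdd p h ((cpi ^ m * monom k s) • φ)
  choose C hC hb using fun l => LD0_bdd p h (q l)
  refine ⟨C0 + ∑ l ∈ Finset.range m, C l, fun S hS t => ?_⟩
  have S0 : 0 < S := by linarith
  have Sc : (S : ℂ) ≠ 0 := by exact_mod_cast S0.ne'
  have key : ∀ l < n, ‖((S : ℂ) ^ n)⁻¹ * (S : ℂ) ^ l‖ ≤ 1 / S := fun l hl => by
    rw [norm_mul, norm_inv, norm_pow, norm_pow, Complex.norm_of_nonneg S0.le, inv_mul_eq_div,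
      div_le_div_iff₀ (by positivity) S0, one_mul, ← pow_succ]
    exact pow_le_pow_right₀ hS hl
  have hLD : LD p h k (tr t (md (-(S • s)) φ)) = (-1) ^ m * LD0 p h (tr t (DS k (md (-(S • s)) φ))) := by
    simp only [LD, ContinuousLinearMap.smul_apply, ContinuousLinearMap.comp_apply, DS_tr, smul_eq_mul]
    rfl
  rw [hLD, show DS k (md (-(S • s)) φ) = _ from hq S]
  set X := LD0 p h (tr t (md (-(S • s)) φ)) with hX
  set X0 := LD0 p h (tr t (md (-(S • s)) ((cpi ^ m * monom k s) • φ))) with hX0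
  have eX : X0 = (cpi ^ m * monom k s) * X := by rw [hX0, hX]; simp only [map_smul, smul_eq_mul]
  have hbX : ‖X0‖ ≤ C0 := hb0 _ _
  simp only [map_add, map_sum, map_smul, smul_eq_mul]
  rw [← hX, ← eX]
  have e : ((S : ℂ) ^ n)⁻¹ * ((-1) ^ m * ((S : ℂ) ^ m * X0 + ∑ l ∈ Finset.range m, (S : ℂ) ^ l * LD0 p h (tr t (md (-(S • s)) (q l)))))
      - (if m = n then (-cpi) ^ n * monom k s else 0) * X =
      (if m = n then 0 else (-1) ^ m * (((S : ℂ) ^ n)⁻¹ * (S : ℂ) ^ m) * X0) +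
        ∑ l ∈ Finset.range m, (-1) ^ m * (((S : ℂ) ^ n)⁻¹ * (S : ℂ) ^ l) * LD0 p h (tr t (md (-(S • s)) (q l))) := by
    rw [mul_add, mul_add, Finset.mul_sum, Finset.mul_sum]
    have : ∀ l, ((S : ℂ) ^ n)⁻¹ * ((-1) ^ m * ((S : ℂ) ^ l * LD0 p h (tr t (md (-(S • s)) (q l))))) =
      (-1) ^ m * (((S : ℂ) ^ n)⁻¹ * (S : ℂ) ^ l) * LD0 p h (tr t (md (-(S • s)) (q l))) := fun l => by ring
    simp only [this]
    split_ifs with hmn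
    · rw [← hmn, eX]
      have h5 : ((S : ℂ) ^ m)⁻¹ * (S : ℂ) ^ m = 1 := inv_mul_cancel₀ (pow_ne_zero _ Sc)
      have h6 : (-cpi) ^ m = (-1) ^ m * cpi ^ m := by rw [neg_pow]
      rw [h6]
      linear_combination ((-1) ^ m * (cpi ^ m * monom k s) * X) * h5
    · ring
  rw [e]
  refine (norm_add_le _ _).trans ?_
  rw [add_div, Finset.sum_div]
  refine add_le_add ?_ ((norm_sum_le _ _).trans (Finset.sum_le_sum fun l hl => ?_))
  · split_ifs with hmn
    · simp; positivity
    · rw [norm_mul, norm_mul, norm_pow, norm_neg, norm_one, one_pow, one_mul]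
      calc _ ≤ 1 / S * C0 := mul_le_mul (key m (by omega)) hbX (norm_nonneg _) (by positivity)
        _ = _ := by ring
  · rw [norm_mul, norm_mul, norm_pow, norm_neg, norm_one, one_pow, one_mul]
    have := Finset.mem_range.1 hl
    calc _ ≤ 1 / S * C l := mul_le_mul (key l (by omega)) (hb l _ _) (norm_nonneg _) (by positivity)
        _ = _ := by ring

end Asym

section TA
open Filter Topology
variable {d : ℕ}

def SC (g : Rd d → ℂ) (ψ : 𝓢(Rd d, ℂ)) (t : Rd d) : ℂ := ∑' x, g x * ψ (x - t)

lemma LD0_SC (g : Rd d → ℂ) (h : TB wt g) (ψ : 𝓢(Rd d, ℂ)) (t : Rd d) : LD0 g h (tr t ψ) = SC g ψ t := rfl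

lemma TB_sum {ι : Type*} {g : ι → Rd d → ℂ} (s : Finset ι) (h : ∀ i ∈ s, TB wt (g i)) :
    TB wt (fun x => ∑ i ∈ s, g i x) := by
  classical
  induction s using Finset.induction_on with
  | empty => exact ⟨0, fun t s => by simp⟩
  | insert i s hi ih =>
    simp only [Finset.sum_insert hi]
    exact (h i (Finset.mem_insert_self _ _)).add wt_nonneg (ih fun j hj => h j (Finset.mem_insert_of_mem hj))

def topc (I : Finset (Fin d → ℕ)) (n : ℕ) (p : (Fin d → ℕ) → Rd d → ℂ) (s : Rd d) : Rd d → ℂ :=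
  fun x => ∑ k ∈ I, (if ∑ i, k i = n then monom k s else 0) * p k x

structure Dat (d : ℕ) where
  f : TemperedDist d
  I : Finset (Fin d → ℕ)
  n : ℕ
  p : (Fin d → ℕ) → Rd d → ℂ
  hp : ∀ k, TB wt (p k)
  hf : f = ∑ k ∈ I, LD (p k) (hp k) k
  hn : ∀ k ∈ I, ∑ i, k i ≤ n
  Γ : Set (Rd d)
  hΓ : BoundedDensity Γ
  hsp : tdSupport (fourierTD f) ⊆ Γ

namespace Dat
variable (D : Dat d)

lemma top_TB (s : Rd d) : TB wt (topc D.I D.n D.p s) := TB_sum _ fun k _ => (D.hp k).smul _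

lemma bdd (ψ : 𝓢(Rd d, ℂ)) : ∃ C, ∀ t, ‖D.f (tr t ψ)‖ ≤ C := by
  choose C hC using fun k => LD_bdd (D.p k) (D.hp k) k ψ
  refine ⟨∑ k ∈ D.I, C k, fun t => ?_⟩
  rw [D.hf, ContinuousLinearMap.sum_apply]
  exact (norm_sum_le _ _).trans (Finset.sum_le_sum fun k _ => hC k t)

lemma asym (s : Rd d) (φ : 𝓢(Rd d, ℂ)) :
    ∃ C, ∀ S : ℝ, 1 ≤ S → ∀ t, ‖((-cpi) ^ D.n)⁻¹ * ((S : ℂ) ^ D.n)⁻¹ * D.f (tr t (md (-(S • s)) φ)) -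
      SC (topc D.I D.n D.p s) (md (-(S • s)) φ) t‖ ≤ C / S := by
  have h1 : ∀ k : D.I, ∃ C, _ := fun k => asym_k (D.p k) (D.hp k) k D.n (D.hn k k.2) s φ
  choose C hC using h1
  refine ⟨‖((-cpi) ^ D.n)⁻¹‖ * ∑ k, C k, fun S hS t => ?_⟩
  set ψ := md (-(S • s)) φ
  have hc : (-cpi) ^ D.n ≠ 0 := pow_ne_zero _ (by simp [cpi, Real.pi_ne_zero])
  have e : SC (topc D.I D.n D.p s) ψ t = ∑ k : D.I, (if ∑ i, k.1 i = D.n then monom k s else 0) * LD0 (D.p k) (D.hp k) (tr t ψ) := by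
    simp only [LD0_SC, SC, topc, ← tsum_mul_left]
    rw [Finset.sum_coe_sort D.I (fun k => ∑' x, (if ∑ i, k i = D.n then monom k s else 0) * (D.p k x * ψ (x - t))),
      ← Summable.tsum_finsetSum (fun k _ => ((D.hp k).summ ψ t).mul_left _)]
    congr 1; ext x
    rw [Finset.sum_mul]
    exact Finset.sum_congr rfl fun k _ => by ring
  have e2 : D.f (tr t ψ) = ∑ k : D.I, LD (D.p k) (D.hp k) k (tr t ψ) := by
    rw [D.hf, ContinuousLinearMap.sum_apply, ← Finset.sum_coe_sort]
  have e3 : ((-cpi) ^ D.n)⁻¹ * ((S : ℂ) ^ D.n)⁻¹ * D.f (tr t ψ) - SC (topc D.I D.n D.p s) ψ t =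
      ((-cpi) ^ D.n)⁻¹ * ∑ k : D.I, (((S : ℂ) ^ D.n)⁻¹ * LD (D.p k) (D.hp k) k (tr t ψ) -
      (if ∑ i, k.1 i = D.n then (-cpi) ^ D.n * monom k s else 0) * LD0 (D.p k) (D.hp k) (tr t ψ)) := by
    rw [e, e2, Finset.mul_sum, Finset.mul_sum, ← Finset.sum_sub_distrib]
    refine Finset.sum_congr rfl fun k _ => ?_
    split_ifs
    · have := inv_mul_cancel₀ hc
      linear_combination (-(monom k s * LD0 (D.p k) (D.hp k) (tr t ψ))) * this.symm
    · ring
  rw [e3, norm_mul, mul_div_assoc, Finset.sum_div]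
  gcongr
  exact (norm_sum_le _ _).trans (Finset.sum_le_sum fun k _ => hC k S hS t)

lemma TA (s : Rd d) (β : 𝓢(Rd d, ℂ)) (hβ : HasCompactSupport β) :
    ∃ C, ∀ S : ℝ, 1 ≤ S → ∀ Z : Finset (Rd d), (∀ x ∈ D.Γ, x - S • s ∈ tsupport β → x ∈ Z) →
      ∃ c : Rd d → ℂ, ∀ t, ‖∑ γ ∈ Z, c γ * e2pi t γ -
        SC (topc D.I D.n D.p s) (md (-(S • s)) (FT β)) t‖ ≤ C / S := by
  obtain ⟨C, hC⟩ := D.asym s (FT β)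
  refine ⟨C, fun S hS Z hZ => ?_⟩
  have hts : tsupport (tr (S • s) β) = (fun x => x - S • s) ⁻¹' tsupport β := by
    have e : ⇑(tr (S • s) β) = ⇑β ∘ Homeomorph.subRight (S • s) := rfl
    rw [e, tsupport_comp_eq_preimage]; rfl
  have hcs : HasCompactSupport (tr (S • s) β) := by
    have e : ⇑(tr (S • s) β) = ⇑β ∘ Homeomorph.subRight (S • s) := rfl
    rw [e]; exact hβ.comp_homeomorph _
  obtain ⟨c, hc⟩ := trig_f D.f D.bdd Z (tr (S • s) β) hcs (fun x hx hu => hZ x (D.hsp hu) (by rwa [hts] at hx))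
  refine ⟨fun γ => ((-cpi) ^ D.n)⁻¹ * ((S : ℂ) ^ D.n)⁻¹ * c γ, fun t => ?_⟩
  have := hC S hS t
  rw [← FT_tr] at this ⊢
  rw [hc, Finset.mul_sum] at this
  simpa only [mul_assoc] using this

end Dat

lemma approx_band (ψ0 : 𝓢(Rd d, ℂ)) {ε : ℝ} (hε : 0 < ε) :
    ∃ β : 𝓢(Rd d, ℂ), HasCompactSupport β ∧ Wsn (FT β - ψ0) ≤ ε := by
  obtain ⟨Ψ, hΨ, hT⟩ := cs_approx ((FourierTransform.fourierCLE ℂ 𝓢(Rd d, ℂ)).symm ψ0)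
  have h1 : Tendsto (fun n => FT (Ψ n)) atTop (𝓝 ψ0) := by
    have := ((FourierTransform.fourierCLE ℂ 𝓢(Rd d, ℂ)).continuous.tendsto _).comp hT
    rw [ContinuousLinearEquiv.apply_symm_apply] at this
    exact this
  have hW : Continuous fun ψ : 𝓢(Rd d, ℂ) => Wsn (ψ - ψ0) := by
    unfold Wsn
    refine continuous_const.mul (Continuous.comp ?_ (continuous_id.sub continuous_const))
    induction Finset.Iic (d + 1, 0) using Finset.induction_on with
    | empty => simpa using continuous_zero
    | insert a s _ hs =>
      simp only [Finset.sup_insert, Seminorm.coe_sup]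
      exact ((schwartz_withSeminorms ℂ (Rd d) ℂ).continuous_seminorm a).max hs
  have h2 := (hW.tendsto ψ0).comp h1
  have h3 : Wsn (ψ0 - ψ0) = 0 := by simp [Wsn]
  rw [h3] at h2
  obtain ⟨n, hn⟩ := (h2.eventually_lt_const hε).exists
  exact ⟨Ψ n, hΨ n, hn.le⟩

end TA

section Exact
open Filter Topology
variable {d : ℕ}
namespace Dat
variable (D : Dat d)

def HT : Set (Ultrafilter (Rd d)) := {𝒰 | ∀ γ ∈ D.Γ, Tendsto (fun τ => e2pi τ γ) 𝒰 (𝓝 1)}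

lemma HTadd : ∀ 𝒰 ∈ D.HT, ∀ 𝒱 ∈ D.HT, uadd 𝒰 𝒱 ∈ D.HT := fun 𝒰 hU 𝒱 hV γ hγ =>
  tendsto_uadd (g := fun x => e2pi x γ) (fun x => by
    simp only [e2pi_add]; simpa using (hV γ hγ).const_mul (e2pi x γ)) (hU γ hγ)

lemma HTneg : ∀ 𝒱 : Ultrafilter (Rd d), uadd (𝒱.map Neg.neg) 𝒱 ∈ D.HT := fun 𝒱 γ hγ => by
  obtain ⟨l, hl⟩ := ultra_bdd 𝒱 (fun x => (e2pi_norm x γ).le)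
  obtain ⟨l', hl'⟩ := ultra_bdd 𝒱 (fun x => (e2pi_norm (-x) γ).le)
  have h1 : l' * l = 1 := tendsto_nhds_unique (hl'.mul hl) (by
    simp only [e2pi_neg_mul]; exact tendsto_const_nhds)
  refine tendsto_uadd (g := fun x => e2pi x γ * l) (fun x => by
    simp only [e2pi_add]; exact hl.const_mul _) ?_
  rw [← h1]
  exact Tendsto.mul_const l (tendsto_map'_iff.2 hl')

lemma near (a : Rd d → ℂ) {M : ℝ} (hM : TBle wt a M) (ψ ψ0 : 𝓢(Rd d, ℂ)) (t w : Rd d) (h0 : ψ0 0 = 1)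
    (h : ∀ y, y ≠ t → a y ≠ 0 → ψ0 (y - t) = 0) : ‖SC a (md w ψ) t - a t‖ ≤ Wsn (ψ - ψ0) * M := by
  have ht : TB wt a := ⟨M, hM⟩
  have e : a t = SC a (md w ψ0) t := by
    unfold SC
    rw [tsum_eq_single t]
    · rw [sub_self, md_apply, h0, e2pi_zero]; simp
    · intro y hy
      rw [md_apply]
      by_cases hay : a y = 0
      · rw [hay, zero_mul]
      · rw [h y hy hay]; simp
  rw [e, ← LD0_SC a ht, ← LD0_SC a ht, ← map_sub, ← map_sub, ← map_sub]
  exact hM.tsum_bd (md w (ψ - ψ0)) (Wsn_nonneg _) (fun x => by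
      rw [md_apply, norm_mul, e2pi_norm, one_mul]; exact wt_bound _ x) t

lemma fin_cover {G : Set (Rd d)} (hG : LocFinite G) (v : Rd d) {K : Set (Rd d)} (hK : IsCompact K) :
    ∃ Z : Finset (Rd d), (∀ x ∈ Z, x ∈ G) ∧ ∀ x ∈ G, x - v ∈ K → x ∈ Z := by
  obtain ⟨r, hr⟩ := hK.isBounded.subset_ball 0
  refine ⟨(hG v r).toFinset, fun x hx => ?_, fun x hx hK' => ?_⟩
  · simp only [Set.Finite.mem_toFinset] at hx; exact hx.1
  · simp only [Set.Finite.mem_toFinset]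
    refine ⟨hx, ?_⟩
    have := hr hK'
    simpa [dist_eq_norm] using this

lemma hex (s : Rd d) {Λ : Set (Rd d)} (hΛ : UniformlyDiscrete Λ)
    (h0 : ∀ x ∉ Λ, topc D.I D.n D.p s x = 0) (𝒰 : Ultrafilter (Rd d)) (hU : 𝒰 ∈ D.HT) (x : Rd d) :
    Tendsto (fun τ => topc D.I D.n D.p s (x + τ)) 𝒰 (𝓝 0) ∨
      Tendsto (fun τ => topc D.I D.n D.p s (x + τ)) 𝒰 (𝓝 (topc D.I D.n D.p s x)) := by
  set a := topc D.I D.n D.p s with ha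
  rcases 𝒰.em (fun τ => x + τ ∈ Λ) with hin | hout
  swap
  · left
    exact tendsto_const_nhds.congr' (by filter_upwards [hout] with τ hτ using (h0 _ hτ).symm)
  right
  obtain ⟨M, hM⟩ := D.top_TB s
  have hfin := hΛ.BD.1 x 1
  obtain ⟨η, hη, hsep⟩ := hΛ
  obtain ⟨r, r0, hrη, hr1, hr⟩ : ∃ r : ℝ, 0 < r ∧ r < η ∧ r < 1 ∧ ∀ z ∈ hfin.toFinset, z ≠ x → r < ‖z - x‖ := by
    have : ∀ᶠ r : ℝ in 𝓝[>] 0, ∀ z ∈ hfin.toFinset, z ≠ x → r < ‖z - x‖ := by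
      rw [Filter.eventually_all_finset]
      intro z hz
      by_cases hzx : z = x
      · exact Eventually.of_forall fun r h => absurd hzx h
      · have : 0 < ‖z - x‖ := norm_pos_iff.2 (sub_ne_zero.2 hzx)
        filter_upwards [(eventually_lt_nhds this).filter_mono nhdsWithin_le_nhds] with r hr _ using hr
    have h2 := (eventually_lt_nhds hη).filter_mono (nhdsWithin_le_nhds (s := Ioi 0))
    have h3 := (eventually_lt_nhds (zero_lt_one' ℝ)).filter_mono (nhdsWithin_le_nhds (s := Ioi 0))
    obtain ⟨r, a1, a2, a3, a4⟩ := ((eventually_mem_nhdsWithin).and (h2.and (h3.and this))).exists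
    exact ⟨r, a1, a2, a3, a4⟩
  have s0 : 0 < 2 / r := by positivity
  set ψ0 : 𝓢(Rd d, ℂ) := (cut_cs s0 0).toSchwartzMap (cut_smooth (2 / r) 0) with hψ0
  have p1 : ψ0 0 = 1 := cut_one s0 (by simp; positivity)
  have p2 : ∀ y, r ≤ ‖y‖ → ψ0 y = 0 := fun y hy => cut_zero s0 (by
    rw [inv_div, sub_zero]; linarith)
  have q1 : ∀ t ∈ Λ, ∀ y, y ≠ t → a y ≠ 0 → ψ0 (y - t) = 0 := fun t ht y hy hay => by
    have hyΛ : y ∈ Λ := by by_contra hn; exact hay (h0 y hn)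
    have := hsep y hyΛ t ht hy
    rw [dist_eq_norm] at this
    exact p2 _ (by linarith)
  have q2 : ∀ y, y ≠ x → a y ≠ 0 → ψ0 (y - x) = 0 := fun y hy hay => by
    have hyΛ : y ∈ Λ := by by_contra hn; exact hay (h0 y hn)
    apply p2
    by_contra! hlt
    have hb : y ∈ hfin.toFinset := by
      simp only [Set.Finite.mem_toFinset]
      exact ⟨hyΛ, by rw [mem_ball, dist_eq_norm]; linarith⟩
    exact absurd (hr y hb hy) (by linarith)
  have M0 : 0 ≤ M := by simpa using hM 0 ∅
  rw [Metric.tendsto_nhds]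
  intro ε hε
  obtain ⟨β, hβ, hW⟩ := approx_band ψ0 (ε := ε / (5 * (M + 1))) (by positivity)
  have hWM : Wsn (FT β - ψ0) * M ≤ ε / 5 := by
    calc _ ≤ ε / (5 * (M + 1)) * M := by gcongr
      _ ≤ ε / (5 * (M + 1)) * (M + 1) := by gcongr; linarith
      _ = _ := by field_simp
  obtain ⟨C, hC⟩ := D.TA s β hβ
  set S := max 1 (5 * |C| / ε) with hS
  have S1 : 1 ≤ S := le_max_left _ _
  have hCS : C / S ≤ ε / 5 := by
    have : 5 * |C| / ε ≤ S := le_max_right _ _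
    rw [div_le_iff₀ hε] at this
    rw [div_le_div_iff₀ (by linarith) (by norm_num)]
    nlinarith [le_abs_self C]
  obtain ⟨Z, hZ1, hZ2⟩ := fin_cover D.hΓ.1 (S • s) hβ.isCompact
  obtain ⟨c, hc⟩ := hC S S1 Z hZ2
  set E : Rd d → ℂ := fun t => ∑ γ ∈ Z, c γ * e2pi t γ with hE
  have hlim : Tendsto (fun τ => E (x + τ)) 𝒰 (𝓝 (E x)) := by
    simp only [hE]
    refine tendsto_finsetSum _ fun γ hγ => ?_
    simp only [e2pi_add]
    simpa using ((hU γ (hZ1 γ hγ)).const_mul (e2pi x γ)).const_mul (c γ)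
  filter_upwards [hin, (Metric.tendsto_nhds.1 hlim) (ε / 5) (by positivity)] with τ h1 h2
  have k1 := (near a hM (FT β) ψ0 (x + τ) (-(S • s)) p1 (q1 _ h1)).trans hWM
  have k2 := (near a hM (FT β) ψ0 x (-(S • s)) p1 q2).trans hWM
  have k3 := (hc (x + τ)).trans hCS
  have k4 := (hc x).trans hCS
  rw [dist_eq_norm] at h2 ⊢
  set A := SC a (md (-(S • s)) (FT β)) (x + τ)
  set B := SC a (md (-(S • s)) (FT β)) x
  have e : a (x + τ) - a x = -(A - a (x + τ)) - (E (x + τ) - A) + (E (x + τ) - E x) + (E x - B) + (B - a x) := by ring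
  rw [e]
  have t1 := norm_add_le (-(A - a (x + τ)) - (E (x + τ) - A) + (E (x + τ) - E x) + (E x - B)) (B - a x)
  have t2 := norm_add_le (-(A - a (x + τ)) - (E (x + τ) - A) + (E (x + τ) - E x)) (E x - B)
  have t3 := norm_add_le (-(A - a (x + τ)) - (E (x + τ) - A)) (E (x + τ) - E x)
  have t4 := norm_sub_le (-(A - a (x + τ))) (E (x + τ) - A)
  rw [norm_neg] at t4
  linarith

end Dat
end Exact

section Wsec
open Filter Topology ComplexConjugate
variable {d : ℕ}

def Wd (D : Rd d → ℝ) : Rd d → List (Rd d) → ℝ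
  | _, [] => 0
  | t, h :: hs => Wd D t hs + D (t + h) + Wd D (t + h) hs

lemma Wd_tendsto {ι : Type*} {l : Filter ι} {F : ι → Rd d → ℝ} {G : Rd d → ℝ}
    (h : ∀ t, Tendsto (fun i => F i t) l (𝓝 (G t))) (hs : List (Rd d)) :
    ∀ t, Tendsto (fun i => Wd (F i) t hs) l (𝓝 (Wd G t hs)) := by
  induction hs with
  | nil => intro t; exact tendsto_const_nhds
  | cons y hs ih => intro t; exact ((ih t).add (h _)).add (ih _)

lemma Wd_mono {F G : Rd d → ℝ} (h : ∀ t, F t ≤ G t) (hs : List (Rd d)) : ∀ t, Wd F t hs ≤ Wd G t hs := by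
  induction hs with
  | nil => intro t; exact le_rfl
  | cons y hs ih => intro t; exact add_le_add (add_le_add (ih t) (h _)) (ih _)

lemma Wd_nonneg {F : Rd d → ℝ} (h : ∀ t, 0 ≤ F t) (hs : List (Rd d)) : ∀ t, 0 ≤ Wd F t hs := by
  induction hs with
  | nil => intro t; exact le_rfl
  | cons y hs ih => intro t; exact add_nonneg (add_nonneg (ih t) (h _)) (ih _)

lemma Wd_add (F G : Rd d → ℝ) (hs : List (Rd d)) : ∀ t, Wd (fun t => F t + G t) t hs = Wd F t hs + Wd G t hs := by
  induction hs with
  | nil => intro t; simp [Wd]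
  | cons y hs ih => intro t; simp only [Wd, ih]; ring

lemma Wd_shift (F : Rd d → ℝ) (h : Rd d) (hs : List (Rd d)) : ∀ t, Wd (fun t => F (t + h)) t hs = Wd F (t + h) hs := by
  induction hs with
  | nil => intro t; rfl
  | cons y hs ih => intro t; simp only [Wd, ih, add_right_comm]

lemma Wd_bd (C : ℝ) (hs : List (Rd d)) : ∃ C', ∀ F : Rd d → ℝ, (∀ t, F t ≤ C) →
    ∀ t, Wd F t hs ≤ C' := by
  refine ⟨Wd (fun _ => C) 0 hs, fun F hF t => (Wd_mono hF hs t).trans (le_of_eq ?_)⟩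
  have := Wd_shift (fun _ : Rd d => C) t hs 0
  rw [zero_add] at this; exact this.symm

lemma Wd_sq {F : Rd d → ℝ} (h : ∀ t, 0 ≤ F t) (hs : List (Rd d)) :
    ∀ t, Wd F t hs ^ 2 ≤ 3 ^ hs.length * Wd (fun t => F t ^ 2) t hs := by
  induction hs with
  | nil => intro t; simp [Wd]
  | cons y hs ih =>
    intro t
    simp only [Wd, List.length_cons]
    have h1 := ih t
    have h2 := ih (t + y)
    have h3 : F (t + y) ^ 2 ≤ 3 ^ hs.length * F (t + y) ^ 2 :=
      le_mul_of_one_le_left (sq_nonneg _) (one_le_pow₀ (by norm_num))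
    set a := Wd F t hs; set b := F (t + y); set c := Wd F (t + y) hs
    rw [pow_succ]
    have hsq : (a + b + c) ^ 2 ≤ 3 * (a ^ 2 + b ^ 2 + c ^ 2) := by
      nlinarith [sq_nonneg (a - b), sq_nonneg (b - c), sq_nonneg (a - c)]
    refine hsq.trans (le_of_le_of_eq (mul_le_mul_of_nonneg_left (add_le_add (add_le_add h1 h3) h2) (by norm_num)) (by ring))

lemma Wd_trig (hs : List (Rd d)) : ∀ (Z : Finset (Rd d)) (c : Rd d → ℂ), Z.card ≤ hs.length → ∀ t,
    ‖∑ γ ∈ Z, c γ * e2pi t γ‖ ≤ Wd (fun t => ‖∑ γ ∈ Z, c γ * e2pi t γ‖) t hs := by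
  classical
  induction hs with
  | nil =>
    intro Z c h t
    have : Z = ∅ := by simpa using h
    simp [this, Wd]
  | cons y hs ih =>
    intro Z c h t
    rcases Z.eq_empty_or_nonempty with rfl | ⟨γ0, hγ0⟩
    · exact (by simp : ‖_‖ = (0:ℝ)).le.trans (Wd_nonneg (fun t => norm_nonneg _) _ _)
    set E : Rd d → ℂ := fun t => ∑ γ ∈ Z, c γ * e2pi t γ with hE
    set c' : Rd d → ℂ := fun γ => c γ * (e2pi (-y) γ0 * e2pi y γ - 1)
    have e : ∀ t, ∑ γ ∈ Z.erase γ0, c' γ * e2pi t γ = e2pi (-y) γ0 * E (t + y) - E t := fun t => by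
      have h0 : c' γ0 * e2pi t γ0 = 0 := by simp only [c']; rw [e2pi_neg_mul]; simp
      rw [Finset.sum_erase (f := fun γ => c' γ * e2pi t γ) Z h0]
      simp only [hE]
      rw [Finset.mul_sum, ← Finset.sum_sub_distrib]
      refine Finset.sum_congr rfl fun γ _ => ?_
      rw [e2pi_add]; simp only [c']; ring
    have h1 := ih (Z.erase γ0) c' (by rw [Finset.card_erase_of_mem hγ0]; simp at h; omega) t
    simp only [e] at h1
    have h2 : ∀ t, ‖e2pi (-y) γ0 * E (t + y) - E t‖ ≤ ‖E (t + y)‖ + ‖E t‖ := fun t =>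
      (norm_sub_le _ _).trans (by rw [norm_mul, e2pi_norm, one_mul])
    have h3 := Wd_mono h2 hs t
    rw [Wd_add, Wd_shift (fun t => ‖E t‖)] at h3
    have h4 : ‖E t‖ ≤ ‖E (t + y)‖ + ‖e2pi (-y) γ0 * E (t + y) - E t‖ := by
      have : E t = e2pi (-y) γ0 * E (t + y) - (e2pi (-y) γ0 * E (t + y) - E t) := by ring
      conv_lhs => rw [this]
      exact (norm_sub_le _ _).trans (by rw [norm_mul, e2pi_norm, one_mul])
    simp only [Wd]
    change ‖E t‖ ≤ Wd (fun t => ‖E t‖) t hs + ‖E (t + y)‖ + Wd (fun t => ‖E t‖) (t + y) hs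
    linarith

def mr (F : Rd d → ℝ) : ℝ := (mean d fun t => (F t : ℂ)).re

lemma mr_add (F G : Rd d → ℝ) : mr (fun t => F t + G t) = mr F + mr G := by
  unfold mr
  rw [← Complex.add_re, ← map_add]
  congr 2; ext t; simp

lemma mr_smul (c : ℝ) (F : Rd d → ℝ) : mr (fun t => c * F t) = c * mr F := by
  unfold mr
  have : (fun t => ((c * F t : ℝ) : ℂ)) = (c : ℂ) • fun t => (F t : ℂ) := by ext t; simp
  rw [this, map_smul, smul_eq_mul, Complex.re_ofReal_mul]

lemma mr_mono {F G : Rd d → ℝ} {C : ℝ} (hF : ∀ t, |F t| ≤ C) (hG : ∀ t, |G t| ≤ C) (h : ∀ t, F t ≤ G t) : mr F ≤ mr G := by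
  have h1 : mr (fun t => F t + (-1) * G t) ≤ 0 := mean_le _ ⟨C + C, fun t => by
    refine (abs_add_le _ _).trans (add_le_add (hF t) ?_)
    simpa using hG t⟩ 0 (fun t => by linarith [h t])
  rw [mr_add, mr_smul] at h1
  linarith

lemma mr_const (c : ℝ) : mr (fun _ : Rd d => c) = c := by
  apply le_antisymm (mean_le _ ⟨|c|, fun t => le_rfl⟩ c fun t => le_rfl)
  have : mr (fun _ : Rd d => (-1) * c) ≤ -c := mean_le _ ⟨|c|, fun t => by simp⟩ (-c) fun t => by simp
  rw [mr_smul] at this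
  change c ≤ mr _
  linarith

lemma mr_shift {F : Rd d → ℝ} {C : ℝ} (hF : ∀ t, |F t| ≤ C) (g : Rd d) : mr (fun t => F (g + t)) = mr F := by
  unfold mr
  rw [← mean_shift (fun t => (F t : ℂ)) ⟨C, fun t => by simpa using hF t⟩ g]
  simp only [add_comm]

lemma mr_Wd (F : Rd d → Rd d → ℝ) (hs : List (Rd d)) : ∀ t,
    mr (fun σ => Wd (F σ) t hs) = Wd (fun t => mr fun σ => F σ t) t hs := by
  induction hs with
  | nil => intro t; exact mr_const 0
  | cons y hs ih => intro t; simp only [Wd, mr_add, ih]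

def kap : ℕ → ℝ
  | 0 => 0
  | n + 1 => 2 * kap n + 1

lemma iter_mean {D : Rd d → ℝ} {C : ℝ} (hD : ∀ t, |D t| ≤ C) (N : ℕ) : ∀ (T : List (Rd d)) (X : ℝ),
    (∀ hs : List (Rd d), hs.length = N → X ≤ (T.map (fun t => Wd D t hs)).sum) → X ≤ T.length * kap N * mr D := by
  induction N with
  | zero =>
    intro T X h
    have := h [] rfl
    simpa [Wd, kap] using this
  | succ N ih =>
    intro T X h
    have h1 : ∀ y, X + (-1) * (T.map (fun t => D (t + y))).sum ≤ (2 * T.length) * kap N * mr D := fun y => by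
      have := ih (T ++ T.map (· + y)) (X + (-1) * (T.map (fun t => D (t + y))).sum) (fun hs hl => by
        have := h (y :: hs) (by simp [hl])
        simp only [Wd] at this
        rw [List.sum_map_add, List.sum_map_add] at this
        rw [List.map_append, List.sum_append, List.map_map]
        simp only [Function.comp_def]
        linarith)
      simpa [← two_mul] using this
    have h2 : ∀ T : List (Rd d), (∃ B, ∀ y, |(T.map (fun t => D (t + y))).sum| ≤ B) ∧
        mr (fun y => (T.map (fun t => D (t + y))).sum) = T.length * mr D := fun T => by
      induction T with
      | nil => exact ⟨⟨0, fun y => by simp⟩, by simpa using mr_const 0⟩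
      | cons t T ihT =>
        obtain ⟨⟨B, hB⟩, e⟩ := ihT
        refine ⟨⟨C + B, fun y => ?_⟩, ?_⟩
        · simp only [List.map_cons, List.sum_cons]
          exact (abs_add_le _ _).trans (add_le_add (hD _) (hB y))
        · simp only [List.map_cons, List.sum_cons, mr_add, e, mr_shift hD, List.length_cons]
          push_cast; ring
    obtain ⟨⟨B, hB⟩, e⟩ := h2 T
    have h3 : mr (fun y => X + (-1) * (T.map (fun t => D (t + y))).sum) ≤ (2 * T.length) * kap N * mr D :=
      mean_le _ ⟨|X| + B, fun y => (abs_add_le _ _).trans (add_le_add le_rfl (by simpa using hB y))⟩ _ h1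
    rw [mr_add, mr_smul, mr_const, e] at h3
    simp only [kap]
    linarith

lemma mean_e (z : Rd d) : mean d (fun σ => e2pi z σ) = if z = 0 then 1 else 0 := by
  split_ifs with hz
  · have e : (fun σ : Rd d => e2pi z σ) = fun _ => ((1 : ℝ) : ℂ) := by ext σ; rw [hz, e2pi_zero]; simp
    rw [e]
    have h1 := mr_const (d := d) 1
    have h2 := mean_conj (d := d) (fun _ => ((1 : ℝ) : ℂ))
    simp only [Complex.conj_ofReal] at h2
    apply Complex.ext
    · exact h1
    · exact Complex.conj_eq_iff_im.1 h2.symm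
  · have hz2 : (⟪z, z⟫ : ℝ) ≠ 0 := by simpa using hz
    set g : Rd d := (2 * ⟪z, z⟫ : ℝ)⁻¹ • z with hg
    have hgz : (⟪g, z⟫ : ℝ) = 1 / 2 := by
      rw [hg, inner_smul_left]; simp only [conj_trivial]; field_simp
    have he : e2pi g z = -1 := by
      unfold e2pi; rw [hgz, ← Complex.exp_pi_mul_I]; congr 1; push_cast; ring
    have h := mean_shift (fun σ => e2pi z σ) ⟨1, fun t => (e2pi_norm _ _).le⟩ g
    have e : (fun σ => e2pi z (σ + g)) = (-1 : ℂ) • fun σ => e2pi z σ := by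
      ext σ; rw [e2pi_symm, e2pi_add, he, e2pi_symm σ]; simp
    rw [e, map_smul, smul_eq_mul] at h
    linear_combination (-1 / 2 : ℂ) * h

lemma mean_sq_fin (c : Rd d → ℂ) (s : Finset (Rd d)) :
    mr (fun σ => ‖∑ y ∈ s, c y * e2pi y σ‖ ^ 2) = ∑ y ∈ s, ‖c y‖ ^ 2 := by
  classical
  unfold mr
  have e : (fun σ => ((‖∑ y ∈ s, c y * e2pi y σ‖ ^ 2 : ℝ) : ℂ)) =
      ∑ x ∈ s, ∑ y ∈ s, (c x * conj (c y)) • fun σ => e2pi (x - y) σ := by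
    ext σ
    rw [Complex.ofReal_pow, ← Complex.mul_conj', map_sum, Finset.sum_mul_sum, Finset.sum_apply]
    refine Finset.sum_congr rfl fun x _ => ?_
    rw [Finset.sum_apply]
    refine Finset.sum_congr rfl fun y _ => ?_
    have hc : conj (e2pi y σ) = e2pi (-y) σ := by
      unfold e2pi; rw [← Complex.exp_conj]; congr 1
      simp [inner_neg_left, Complex.conj_ofNat]
    rw [map_mul, hc, sub_eq_add_neg, Pi.smul_apply, e2pi_add, smul_eq_mul]; ring
  rw [e, map_sum]
  simp only [map_sum, map_smul, mean_e, sub_eq_zero, smul_eq_mul, mul_ite, mul_one, mul_zero]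
  have : ∀ x ∈ s, ∑ y ∈ s, (if x = y then c x * conj (c y) else 0) = ((‖c x‖ ^ 2 : ℝ) : ℂ) := fun x hx => by
    rw [Finset.sum_ite_eq s x, if_pos hx, Complex.mul_conj']; simp
  rw [Finset.sum_congr rfl this, ← Complex.ofReal_sum, Complex.ofReal_re]

lemma mean_sq {c : Rd d → ℂ} (hc : Summable fun y => ‖c y‖) :
    mr (fun σ => ‖∑' y, c y * e2pi y σ‖ ^ 2) = ∑' y, ‖c y‖ ^ 2 := by
  set M := ∑' y, ‖c y‖ with hM
  have M0 : 0 ≤ M := tsum_nonneg fun _ => norm_nonneg _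
  have hs : ∀ σ, Summable fun y => ‖c y * e2pi y σ‖ := fun σ => by simpa [e2pi_norm] using hc
  have b1 : ∀ σ, ‖∑' y, c y * e2pi y σ‖ ≤ M := fun σ =>
    (norm_tsum_le_tsum_norm (hs σ)).trans (by simp [e2pi_norm, hM])
  have b2 : ∀ (s : Finset (Rd d)) σ, ‖∑ y ∈ s, c y * e2pi y σ‖ ≤ M := fun s σ =>
    (norm_sum_le _ _).trans (by simpa [e2pi_norm] using hc.sum_le_tsum s (fun _ _ => norm_nonneg _))
  have b3 : ∀ (s : Finset (Rd d)) σ, ‖∑' y, c y * e2pi y σ - ∑ y ∈ s, c y * e2pi y σ‖ ≤ M - ∑ y ∈ s, ‖c y‖ := fun s σ => by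
    rw [← (hs σ).of_norm.sum_add_tsum_subtype_compl s, add_sub_cancel_left, hM, ← hc.sum_add_tsum_subtype_compl s, add_sub_cancel_left]
    refine (norm_tsum_le_tsum_norm ((hs σ).subtype _)).trans (by simp [e2pi_norm])
  have b4 : ∀ (s : Finset (Rd d)) σ, |‖∑' y, c y * e2pi y σ‖ ^ 2 - ‖∑ y ∈ s, c y * e2pi y σ‖ ^ 2| ≤
      (M - ∑ y ∈ s, ‖c y‖) * (M + M) := fun s σ => by
    rw [sq_sub_sq, abs_mul, mul_comm]
    refine mul_le_mul ((abs_norm_sub_norm_le _ _).trans (b3 s σ)) ?_ (abs_nonneg _) ((norm_nonneg _).trans (b3 s σ))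
    rw [abs_of_nonneg (by positivity)]
    exact add_le_add (b1 σ) (b2 s σ)
  have hl : Tendsto (fun s : Finset (Rd d) => (M - ∑ y ∈ s, ‖c y‖) * (M + M)) atTop (𝓝 0) := by
    have := (hc.hasSum.const_sub M).mul_const (M + M)
    rw [← hM, sub_self, zero_mul] at this; exact this
  have key : ∀ s : Finset (Rd d), |mr (fun σ => ‖∑' y, c y * e2pi y σ‖ ^ 2) - ∑ y ∈ s, ‖c y‖ ^ 2| ≤ (M - ∑ y ∈ s, ‖c y‖) * (M + M) := fun s => by
    rw [← mean_sq_fin, sub_eq_add_neg, ← neg_one_mul, ← mr_smul, ← mr_add]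
    have h1 := fun σ => abs_le.1 (b4 s σ)
    rw [abs_le]
    constructor
    · have := mr_mono (C := (M - ∑ y ∈ s, ‖c y‖) * (M + M)) (F := fun _ : Rd d => -((M - ∑ y ∈ s, ‖c y‖) * (M + M)))
        (G := fun σ => ‖∑' y, c y * e2pi y σ‖ ^ 2 + -1 * ‖∑ y ∈ s, c y * e2pi y σ‖ ^ 2)
        (fun σ => by rw [abs_neg, abs_of_nonneg ((abs_nonneg _).trans (b4 s 0))])
        (fun σ => by simpa [← sub_eq_add_neg] using b4 s σ) (fun σ => by linarith [(h1 σ).1])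
      rwa [mr_const] at this
    · exact mean_le _ ⟨_, fun σ => by simpa [← sub_eq_add_neg] using b4 s σ⟩ _ (fun σ => by linarith [(h1 σ).2])
  have hsq : Tendsto (fun s : Finset (Rd d) => ∑ y ∈ s, ‖c y‖ ^ 2) atTop (𝓝 (mr (fun σ => ‖∑' y, c y * e2pi y σ‖ ^ 2))) := by
    rw [tendsto_iff_norm_sub_tendsto_zero]
    refine squeeze_zero (fun _ => norm_nonneg _) (fun s => ?_) hl
    rw [norm_sub_rev]; exact key s
  have h : HasSum (fun y => ‖c y‖ ^ 2) (mr (fun σ => ‖∑' y, c y * e2pi y σ‖ ^ 2)) := hsq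
  exact h.tsum_eq.symm

end Wsec

section P17
open Filter Topology ComplexConjugate
variable {d : ℕ}

lemma wt_le_one (x : Rd d) : wt x ≤ 1 := inv_le_one_of_one_le₀ (one_le_pow₀ (by linarith [norm_nonneg x]))

lemma TBle.le_wt {g : Rd d → ℂ} {M : ℝ} (h : TBle wt g M) (x : Rd d) : ‖g x‖ ≤ M := by
  simpa [wt] using h x {x}

def omg (φ : 𝓢(Rd d, ℂ)) (x : Rd d) : ℝ := ‖φ x‖ ^ 2

lemma omg_le (φ : 𝓢(Rd d, ℂ)) (x : Rd d) : omg φ x ≤ Wsn φ ^ 2 * wt x := by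
  have h1 : ‖φ x‖ ≤ Wsn φ * wt x := wt_bound φ x
  have h2 : ‖φ x‖ ^ 2 ≤ (Wsn φ * wt x) ^ 2 := pow_le_pow_left₀ (norm_nonneg _) h1 2
  have h3 : wt x * wt x ≤ wt x * 1 := mul_le_mul_of_nonneg_left (wt_le_one x) (wt_nonneg x)
  unfold omg
  nlinarith [mul_le_mul_of_nonneg_left h3 (sq_nonneg (Wsn φ))]

lemma TBle.omg {g : Rd d → ℂ} {M : ℝ} (h : TBle wt g M) (φ : 𝓢(Rd d, ℂ)) : TBle (omg φ) g (Wsn φ ^ 2 * M) := fun t s => by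
  refine (Finset.sum_le_sum fun x _ => mul_le_mul_of_nonneg_left (omg_le φ (x - t)) (norm_nonneg (g x))).trans ?_
  refine le_trans (le_of_eq ?_) (mul_le_mul_of_nonneg_left (h t s) (sq_nonneg (Wsn φ)))
  rw [Finset.mul_sum]
  exact Finset.sum_congr rfl fun x _ => by ring

lemma TB.nsq {g : Rd d → ℂ} (h : TB wt g) : TB wt (fun x => ((nsq g x : ℝ) : ℂ)) := by
  obtain ⟨M, hM⟩ := id h
  refine TB.mono wt_nonneg (fun x => ?_) (h.smul (M : ℂ))
  have h1 := hM.le_wt x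
  rw [norm_mul, Complex.norm_real, Complex.norm_real]
  simp only [_root_.nsq, norm_pow, norm_norm]
  rw [pow_two]
  exact mul_le_mul_of_nonneg_right (h1.trans (le_abs_self _)) (norm_nonneg _)

namespace Dat
variable (D : Dat d)

def AP (s : Rd d) (β0 : 𝓢(Rd d, ℂ)) (G : Rd d → ℂ) : Prop :=
  ∀ σ : Rd d, ∃ C, ∀ S : ℝ, 1 ≤ S → ∀ Z : Finset (Rd d), (∀ x ∈ D.Γ, x - (S • s - σ) ∈ tsupport β0 → x ∈ Z) →
    ∃ c : Rd d → ℂ, ∀ t, ‖∑ γ ∈ Z, c γ * e2pi t γ - SC G (md (σ - S • s) (FT β0)) t‖ ≤ C / S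

lemma AP_top (s : Rd d) (β0 : 𝓢(Rd d, ℂ)) (hβ : HasCompactSupport β0) : D.AP s β0 (topc D.I D.n D.p s) := by
  intro σ
  have ec : ⇑(tr (-σ) β0) = ⇑β0 ∘ Homeomorph.subRight (-σ) := rfl
  obtain ⟨C, hC⟩ := D.TA s (tr (-σ) β0) (by rw [ec]; exact hβ.comp_homeomorph _)
  refine ⟨C, fun S hS Z hZ => ?_⟩
  obtain ⟨c, hc⟩ := hC S hS Z (fun x hx h => hZ x hx (by
    rw [ec, tsupport_comp_eq_preimage] at h
    have e : x - (S • s - σ) = x - S • s - -σ := by abel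
    rw [e]; exact h))
  refine ⟨c, fun t => ?_⟩
  have := hc t
  have e : md (-(S • s)) (FT (tr (-σ) β0)) = md (σ - S • s) (FT β0) := by
    ext x
    rw [FT_tr, md_apply, md_apply, md_apply, neg_neg, ← mul_assoc, e2pi_symm x, e2pi_symm x, ← e2pi_add, e2pi_symm _ x]
    congr 2; abel
  rwa [e] at this

lemma SC_add {G H : Rd d → ℂ} (hG : TB wt G) (hH : TB wt H) (ψ : 𝓢(Rd d, ℂ)) (t : Rd d) :
    SC (G + H) ψ t = SC G ψ t + SC H ψ t := by
  unfold SC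
  rw [← (hG.summ ψ t).tsum_add (hH.summ ψ t)]
  simp only [Pi.add_apply, add_mul]

lemma AP_shift {s : Rd d} {β0 : 𝓢(Rd d, ℂ)} {G : Rd d → ℂ} (h : D.AP s β0 G) (y : Rd d) :
    D.AP s β0 (fun x => G (x + y)) := fun σ => by
  obtain ⟨C, hC⟩ := h σ
  refine ⟨C, fun S hS Z hZ => ?_⟩
  obtain ⟨c, hc⟩ := hC S hS Z hZ
  refine ⟨fun γ => c γ * e2pi y γ, fun t => ?_⟩
  have := hc (t + y)
  have e : SC G (md (σ - S • s) (FT β0)) (t + y) = SC (fun x => G (x + y)) (md (σ - S • s) (FT β0)) t := by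
    unfold SC
    rw [← (Equiv.addRight y).tsum_eq]
    simp
  rw [e] at this
  simp only [e2pi_add] at this
  refine le_of_eq_of_le ?_ this
  congr 2
  exact Finset.sum_congr rfl fun γ _ => by ring

lemma AP_span {s : Rd d} {β0 : 𝓢(Rd d, ℂ)} {a : Rd d → ℂ} (ha : TB wt a) (h : D.AP s β0 a) {G : Rd d → ℂ}
    (hG : G ∈ Submodule.span ℂ (range fun y : Rd d => fun x => a (x + y))) : TB wt G ∧ D.AP s β0 G := by
  induction hG using Submodule.span_induction with
  | mem x hx =>
    obtain ⟨y, rfl⟩ := hx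
    obtain ⟨M, hM⟩ := ha
    exact ⟨⟨M, hM.shift y⟩, D.AP_shift h y⟩
  | zero =>
    refine ⟨⟨0, fun t s => by simp⟩, fun σ => ⟨0, fun S hS Z hZ => ⟨0, fun t => by simp [SC]⟩⟩⟩
  | add G H _ _ h1 h2 =>
    refine ⟨h1.1.add wt_nonneg h2.1, fun σ => ?_⟩
    obtain ⟨C, hC⟩ := h1.2 σ
    obtain ⟨C', hC'⟩ := h2.2 σ
    refine ⟨C + C', fun S hS Z hZ => ?_⟩
    obtain ⟨c, hc⟩ := hC S hS Z hZ
    obtain ⟨c', hc'⟩ := hC' S hS Z hZ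
    refine ⟨c + c', fun t => ?_⟩
    rw [SC_add h1.1 h2.1, add_div]
    simp only [Pi.add_apply, add_mul, Finset.sum_add_distrib]
    rw [add_sub_add_comm]
    exact (norm_add_le _ _).trans (add_le_add (hc t) (hc' t))
  | smul z G _ h1 =>
    refine ⟨h1.1.smul z, fun σ => ?_⟩
    obtain ⟨C, hC⟩ := h1.2 σ
    refine ⟨‖z‖ * C, fun S hS Z hZ => ?_⟩
    obtain ⟨c, hc⟩ := hC S hS Z hZ
    refine ⟨z • c, fun t => ?_⟩
    have e : SC (z • G) (md (σ - S • s) (FT β0)) t = z * SC G (md (σ - S • s) (FT β0)) t := by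
      unfold SC
      rw [← tsum_mul_left]
      simp only [Pi.smul_apply, smul_eq_mul, mul_assoc]
    rw [e]
    simp only [Pi.smul_apply, smul_eq_mul, mul_assoc, ← Finset.mul_sum]
    rw [← mul_sub, norm_mul, mul_div_assoc]
    exact mul_le_mul_of_nonneg_left (hc t) (norm_nonneg _)

lemma hA_main {s : Rd d} {β0 : 𝓢(Rd d, ℂ)} (hsup : tsupport β0 ⊆ ball 0 1) {N : ℕ}
    (hN : ∀ x : Rd d, (D.Γ ∩ ball x 1).ncard ≤ N) {G : Rd d → ℂ} (hG : TB wt G) (hAP : D.AP s β0 G) (t : Rd d) :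
    ∑' x, nsq G x * omg (FT β0) (x - t) ≤ 3 ^ N * kap N * JJ (omg (FT β0)) (nsq G) := by
  set φ := FT β0 with hφ
  obtain ⟨M, hM⟩ := id hG
  set 𝒮 : Ultrafilter ℝ := Ultrafilter.of atTop
  have h𝒮 : (𝒮 : Filter ℝ) ≤ atTop := Ultrafilter.of_le _
  choose u hu using fun y : Rd d => ultra_bdd (F := fun S : ℝ => e2pi y (-(S • s))) (C := 1) 𝒮 (fun S => (e2pi_norm _ _).le)
  have hu1 : ∀ y, ‖u y‖ = 1 := fun y => tendsto_nhds_unique (hu y).norm (by simp only [e2pi_norm]; exact tendsto_const_nhds)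
  have hsm0 : ∀ t, Summable fun y => ‖G (y + t) * φ y‖ := fun t => by
    have := hM.summ φ (Wsn_nonneg φ) (wt_bound φ) t
    rw [← (Equiv.addRight t).summable_iff] at this
    simpa [Function.comp_def] using this
  have hb0 : ∀ t, ∑' y, ‖G (y + t) * φ y‖ ≤ Wsn φ * M := fun t => by
    rw [← (Equiv.subRight t).tsum_eq]
    refine Real.tsum_le_of_sum_le (fun x => norm_nonneg _) fun s => ?_
    simpa using hM.sum_schw φ (Wsn_nonneg φ) (wt_bound φ) t s
  set cc : Rd d → Rd d → ℂ := fun t y => G (y + t) * u y * φ y with hcc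
  have hccn : ∀ t y, ‖cc t y‖ = ‖G (y + t) * φ y‖ := fun t y => by simp [hcc, hu1]
  have hsm : ∀ t, Summable fun y => ‖cc t y‖ := fun t => by simp only [hccn]; exact hsm0 t
  set B : Rd d → Rd d → ℂ := fun σ t => ∑' y, cc t y * e2pi y σ with hB
  have hBb : ∀ σ t, ‖B σ t‖ ≤ Wsn φ * M := fun σ t => by
    refine (norm_tsum_le_tsum_norm ?_).trans ?_
    · simpa [e2pi_norm] using hsm t
    · refine le_of_eq_of_le (tsum_congr fun y => ?_) (hb0 t)
      rw [norm_mul, e2pi_norm, mul_one, hccn]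
  have hlim : ∀ σ t, Tendsto (fun S : ℝ => SC G (md (σ - S • s) φ) t) 𝒮 (𝓝 (B σ t)) := fun σ t => by
    have e : ∀ S : ℝ, SC G (md (σ - S • s) φ) t = ∑' y, G (y + t) * (e2pi y σ * e2pi y (-(S • s)) * φ y) := fun S => by
      unfold SC
      rw [← (Equiv.addRight t).tsum_eq]
      refine tsum_congr fun y => ?_
      simp only [Equiv.coe_addRight, add_sub_cancel_right, md_apply]
      rw [e2pi_symm, sub_eq_add_neg, e2pi_add, e2pi_symm σ, e2pi_symm (-(S • s))]
    simp only [e]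
    refine tendsto_tsum_of_dominated_convergence (hsm0 t) (fun y => ?_) (Eventually.of_forall fun S y => ?_)
    · have := (((hu y).const_mul (e2pi y σ)).mul_const (φ y)).const_mul (G (y + t))
      refine this.congr' EventuallyEq.rfl |>.trans (le_of_eq ?_)
      simp only [hcc]; congr 1; ring
    · simp [e2pi_norm]
  have hW : ∀ hs : List (Rd d), hs.length = N → ∀ σ t, ‖B σ t‖ ≤ Wd (fun t => ‖B σ t‖) t hs := by
    intro hs hl σ t
    obtain ⟨C, hC⟩ := hAP σ
    have h1 : ∀ S : ℝ, ∃ E : Rd d → ℂ, 1 ≤ S → (∀ t, ‖E t‖ ≤ Wd (fun t => ‖E t‖) t hs) ∧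
        ∀ t, ‖E t - SC G (md (σ - S • s) φ) t‖ ≤ C / S := fun S => by
      by_cases hS : 1 ≤ S
      · have hfin := D.hΓ.1 (S • s - σ) 1
        obtain ⟨c, hc⟩ := hC S hS hfin.toFinset (fun x hx h => by
          have := hsup h
          simp only [Finite.mem_toFinset]
          exact ⟨hx, by simpa [dist_eq_norm] using this⟩)
        refine ⟨_, fun _ => ⟨Wd_trig hs hfin.toFinset c ?_, hc⟩⟩
        rw [hl, ← ncard_eq_toFinset_card _ hfin]; exact hN _
      · exact ⟨0, fun h => absurd h hS⟩
    choose E hE using h1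
    have hev : ∀ᶠ S : ℝ in 𝒮, 1 ≤ S := h𝒮 (eventually_ge_atTop 1)
    have hE1 : ∀ t, Tendsto (fun S => E S t) 𝒮 (𝓝 (B σ t)) := fun t => by
      have h0 : Tendsto (fun S => E S t - SC G (md (σ - S • s) φ) t) 𝒮 (𝓝 0) := by
        refine squeeze_zero_norm' (hev.mono fun S hS => (hE S hS).2 t) ?_
        exact (tendsto_const_nhds.div_atTop tendsto_id).mono_left h𝒮
      simpa using h0.add (hlim σ t)
    exact le_of_tendsto_of_tendsto (hE1 t).norm (Wd_tendsto (fun t => (hE1 t).norm) hs t)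
      (hev.mono fun S hS => (hE S hS).1 t)
  set Dg : Rd d → ℝ := fun t => ∑' x, nsq G x * omg φ (x - t) with hDg
  have hDB : ∀ t, mr (fun σ => ‖B σ t‖ ^ 2) = Dg t := fun t => by
    rw [mean_sq (hsm t), hDg]
    simp only
    rw [← (Equiv.addRight t).tsum_eq (fun x => nsq G x * omg φ (x - t))]
    refine tsum_congr fun y => ?_
    simp [hccn, omg, mul_pow]
  obtain ⟨M2, hM2⟩ : TB (omg φ) (fun x => ((nsq G x : ℝ) : ℂ)) := by
    obtain ⟨M', h'⟩ := hG.nsq; exact ⟨_, h'.omg φ⟩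
  have hω : ∀ x, 0 ≤ omg φ x := fun x => sq_nonneg _
  have hDgb : ∀ t, |Dg t| ≤ M2 := fun t => by
    have := hM2.tsum_le hω t
    rwa [SS_real, Complex.norm_real] at this
  have hJ : JJ (omg φ) (nsq G) = mr Dg := by
    unfold JJ II mr
    congr 2; ext t
    rw [SS_real]
  have key : ∀ hs : List (Rd d), hs.length = N → Dg t / 3 ^ N ≤ Wd Dg t hs := fun hs hl => by
    rw [div_le_iff₀ (by positivity), mul_comm]
    have h1 : ∀ σ, ‖B σ t‖ ^ 2 ≤ 3 ^ N * Wd (fun t => ‖B σ t‖ ^ 2) t hs := fun σ => by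
      have := Wd_sq (F := fun t => ‖B σ t‖) (fun _ => norm_nonneg _) hs t
      rw [hl] at this
      exact (pow_le_pow_left₀ (norm_nonneg _) (hW hs hl σ t) 2).trans this
    have hb2 : ∀ σ t, ‖B σ t‖ ^ 2 ≤ (Wsn φ * M) ^ 2 := fun σ t => pow_le_pow_left₀ (norm_nonneg _) (hBb σ t) 2
    obtain ⟨C', hC'⟩ := Wd_bd ((Wsn φ * M) ^ 2) hs
    have hWb : ∀ σ, |3 ^ N * Wd (fun t => ‖B σ t‖ ^ 2) t hs| ≤ max ((Wsn φ * M) ^ 2) (3 ^ N * C') := fun σ => by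
      rw [abs_of_nonneg (mul_nonneg (by positivity) (Wd_nonneg (fun _ => sq_nonneg _) _ _))]
      exact le_max_of_le_right (mul_le_mul_of_nonneg_left (hC' _ (hb2 σ) t) (by positivity))
    have h2 := mr_mono (fun σ => by
      rw [abs_of_nonneg (sq_nonneg _)]; exact le_max_of_le_left (hb2 σ t)) hWb h1
    rw [mr_smul, mr_Wd (fun σ t => ‖B σ t‖ ^ 2)] at h2
    simp only [hDB] at h2
    exact h2
  have := iter_mean hDgb N [t] (Dg t / 3 ^ N) (fun hs hl => by simpa using key hs hl)
  rw [div_le_iff₀ (by positivity)] at this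
  change Dg t ≤ _
  rw [hJ]
  refine this.trans (le_of_eq ?_)
  simp only [List.length_singleton, Nat.cast_one]; ring

lemma exists_bump (d : ℕ) : ∃ β0 : 𝓢(Rd d, ℂ), HasCompactSupport β0 ∧ tsupport β0 ⊆ ball 0 1 ∧ FT β0 0 = 1 := by
  let b : ContDiffBump (0 : Rd d) := ⟨1 / 4, 1 / 2, by norm_num, by norm_num⟩
  have hc : HasCompactSupport (fun x => ((b.normed volume x : ℝ) : ℂ)) :=
    b.hasCompactSupport_normed.comp_left (g := fun r : ℝ => (r : ℂ)) Complex.ofReal_zero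
  have hd : ContDiff ℝ (⊤ : ℕ∞) (fun x => ((b.normed volume x : ℝ) : ℂ)) :=
    Complex.ofRealCLM.contDiff.comp b.contDiff_normed
  refine ⟨hc.toSchwartzMap hd, hc, ?_, ?_⟩
  · change tsupport (fun x => ((b.normed volume x : ℝ) : ℂ)) ⊆ _
    refine (closure_mono (Function.support_comp_subset Complex.ofReal_zero _)).trans ?_
    have := b.tsupport_normed_eq (μ := volume)
    rw [tsupport] at this
    rw [this]
    exact closedBall_subset_ball (by norm_num)
  · rw [FT_apply]
    have : ∀ v, e2pi (-v) 0 * (hc.toSchwartzMap hd) v = ((b.normed volume v : ℝ) : ℂ) := fun v => by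
      rw [e2pi_symm, e2pi_zero, one_mul]; rfl
    simp only [this]
    exact (integral_ofReal (𝕜 := ℂ) (f := b.normed volume)).trans (by rw [b.integral_normed]; simp)

theorem crys_top {Λ : Set (Rd d)} (hΛ : UniformlyDiscrete Λ) (h0 : ∀ k, ∀ x ∉ Λ, D.p k x = 0) (s : Rd d) :
    topc D.I D.n D.p s ∈ Crys d := by
  obtain ⟨β0, hβ, hsup, h1⟩ := exists_bump d
  obtain ⟨N, hN⟩ := D.hΓ.2
  set a := topc D.I D.n D.p s with ha
  have ha0 : ∀ x ∉ Λ, a x = 0 := fun x hx => Finset.sum_eq_zero fun k _ => by rw [h0 k x hx, mul_zero]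
  have hsp : ∀ G ∈ Submodule.span ℂ (range fun y : Rd d => fun x => a (x + y)), TB wt G ∧ D.AP s β0 G :=
    fun G hG => D.AP_span (D.top_TB s) (D.AP_top s β0 hβ) hG
  have hω : ∀ x, 0 ≤ omg (FT β0) x := fun x => sq_nonneg _
  have hL2 : ∀ G ∈ Submodule.span ℂ (range fun y : Rd d => fun x => a (x + y)), TBr (omg (FT β0)) (nsq G) := fun G hG => by
    obtain ⟨M', h'⟩ := (hsp G hG).1.nsq; exact ⟨_, h'.omg _⟩
  let c : Setup d :=
    { ω := omg (FT β0)
      hω := hω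
      ω0 := by unfold omg; rw [h1]; simp
      ωsum := fun Y hY => by obtain ⟨M, h⟩ := TB_ud hY; exact ⟨_, h.omg _⟩
      VV := Submodule.span ℂ (range fun y : Rd d => fun x => a (x + y))
      hL2 := hL2
      hinv := fun g hg y => by
        have : Submodule.span ℂ (range fun y : Rd d => fun x => a (x + y)) ≤
            (Submodule.span ℂ (range fun y : Rd d => fun x => a (x + y))).comap (LinearMap.funLeft ℂ ℂ (fun x => x + y)) := by
          rw [Submodule.span_le]
          rintro _ ⟨z, rfl⟩
          refine Submodule.subset_span ⟨y + z, ?_⟩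
          ext x; simp [LinearMap.funLeft, add_assoc]
        exact this hg
      C1 := 3 ^ N * kap N
      hA := fun G hG t s' => by
        refine le_trans ?_ (D.hA_main hsup hN (hsp G hG).1 (hsp G hG).2 t)
        obtain ⟨M, hM⟩ := hL2 G hG
        have hs := (hM.summable hω t)
        have e : ∀ x, ‖((nsq G x : ℝ) : ℂ) * (omg (FT β0) (x - t) : ℂ)‖ = nsq G x * omg (FT β0) (x - t) := fun x => by
          rw [norm_mul, Complex.norm_real, Complex.norm_real, Real.norm_of_nonneg (hω _), Real.norm_of_nonneg (sq_nonneg _)]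
        simp only [e] at hs
        refine le_of_eq_of_le (Finset.sum_congr rfl fun x _ => ?_) (hs.sum_le_tsum s' (fun x _ => mul_nonneg (sq_nonneg _) (hω _)))
        rw [Complex.norm_real, Real.norm_of_nonneg (sq_nonneg _)] }
  exact c.crys hΛ a ha0 rfl D.HT D.HTadd D.HTneg (fun 𝒰 hU x => D.hex s hΛ ha0 𝒰 hU x)

end Dat
end P17

section P18
open Filter Topology ComplexConjugate Module
variable {d : ℕ}

lemma interp {V : Type*} [AddCommGroup V] [Module ℂ V] (W : Submodule ℂ V) (I : Finset (Fin d → ℕ))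
    (v : (Fin d → ℕ) → V) (h : ∀ s : Rd d, ∑ k ∈ I, monom k s • v k ∈ W) : ∀ k ∈ I, v k ∈ W := by
  classical
  intro k hk
  rw [← Submodule.Quotient.mk_eq_zero W, ← Module.forall_dual_apply_eq_zero_iff ℂ]
  intro l
  set P : MvPolynomial (Fin d) ℂ := ∑ k ∈ I, MvPolynomial.monomial (Finsupp.equivFunOnFinite.symm k) (l (Submodule.Quotient.mk (v k))) with hP
  have h0 : P = 0 := by
    refine MvPolynomial.funext_set (fun _ => range ((↑) : ℝ → ℂ)) (fun i => infinite_range_of_injective Complex.ofReal_injective) fun x hx => ?_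
    choose s hs using fun i => hx i (mem_univ i)
    have h1 := h (WithLp.toLp 2 s)
    rw [← Submodule.Quotient.mk_eq_zero W] at h1
    have h2 := congrArg l h1
    rw [← Submodule.mkQ_apply, map_sum, map_sum, map_zero] at h2
    rw [hP, map_sum, map_zero, ← h2]
    refine Finset.sum_congr rfl fun k _ => ?_
    rw [MvPolynomial.eval_monomial, map_smul, map_smul, smul_eq_mul, Submodule.mkQ_apply, mul_comm]
    congr 1
    rw [Finsupp.prod_fintype _ _ (by simp), monom]
    push_cast
    exact Finset.prod_congr rfl fun i _ => by simp [← hs]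
  have h1 := congrArg (MvPolynomial.coeff (Finsupp.equivFunOnFinite.symm k)) h0
  rw [hP, MvPolynomial.coeff_sum, Finset.sum_eq_single k] at h1
  · simpa using h1
  · intro k' _ hne
    rw [MvPolynomial.coeff_monomial, if_neg]
    exact fun h => hne (Finsupp.equivFunOnFinite.symm.injective h)
  · exact fun h => absurd hk h

lemma BoundedDensity.mono {A B : Set (Rd d)} (hB : BoundedDensity B) (h : A ⊆ B) : BoundedDensity A := by
  obtain ⟨h1, N, h2⟩ := hB
  exact ⟨fun x r => (h1 x r).subset (inter_subset_inter_left _ h), N, fun x =>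
    (ncard_le_ncard (inter_subset_inter_left _ h) (h1 x 1)).trans (h2 x)⟩

lemma BoundedDensity.union {A B : Set (Rd d)} (hA : BoundedDensity A) (hB : BoundedDensity B) : BoundedDensity (A ∪ B) := by
  obtain ⟨h1, N, h2⟩ := hA
  obtain ⟨h3, M, h4⟩ := hB
  refine ⟨fun x r => ?_, N + M, fun x => ?_⟩
  · rw [union_inter_distrib_right]; exact (h1 x r).union (h3 x r)
  · rw [union_inter_distrib_right]; exact (ncard_union_le _ _).trans (add_le_add (h2 x) (h4 x))

def BDS (d : ℕ) : Submodule ℂ (TemperedDist d) where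
  carrier := {u | BoundedDensity (tdSupport (fourierTD u))}
  zero_mem' := by
    refine ⟨fun x r => ?_, 0, fun x => ?_⟩ <;>
    · have : tdSupport (fourierTD (0 : TemperedDist d)) = ∅ := by
        ext y
        simp only [mem_empty_iff_false, iff_false]
        intro hy
        obtain ⟨φ, _, _, h⟩ := hy univ isOpen_univ trivial
        exact h rfl
      simp [this]
  add_mem' := by
    intro u v hu hv
    refine (hu.union hv).mono fun x hx => ?_
    by_contra hc
    simp only [tdSupport, mem_union, mem_setOf_eq, not_or, not_forall, not_exists, not_and, not_not] at hc
    obtain ⟨⟨U, hU, hxU, h1⟩, V, hV, hxV, h2⟩ := hc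
    obtain ⟨φ, hφ, hs, hne⟩ := hx (U ∩ V) (hU.inter hV) ⟨hxU, hxV⟩
    apply hne
    have e1 := h1 φ hφ (hs.trans inter_subset_left)
    have e2 := h2 φ hφ (hs.trans inter_subset_right)
    change fourierTD u φ + fourierTD v φ = 0
    rw [e1, e2, add_zero]
  smul_mem' := by
    intro c u hu
    refine BoundedDensity.mono hu fun x hx U hU hxU => ?_
    obtain ⟨φ, hφ, hs, hne⟩ := hx U hU hxU
    exact ⟨φ, hφ, hs, fun h => hne (by change c * fourierTD u φ = 0; rw [h, mul_zero])⟩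

lemma lat_ud (B : Basis (Fin d) ℝ (Rd d)) (v : Rd d) : UniformlyDiscrete {x | x - v ∈ latB B} := by
  set C : ℝ := 1 + ∑ i, ‖(B.coord i).toContinuousLinearMap‖ with hC
  have hC0 : 0 < C := by positivity
  refine ⟨C⁻¹, by positivity, fun x hx y hy hne => ?_⟩
  have hz : x - y ∈ latB B := by
    have := (latB B).sub_mem hx hy
    rwa [sub_sub_sub_cancel_right] at this
  rw [B.mem_span_iff_repr_mem ℤ] at hz
  obtain ⟨i, hi⟩ : ∃ i, B.repr (x - y) i ≠ 0 := by
    by_contra hc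
    push Not at hc
    exact hne (sub_eq_zero.1 (B.repr.map_eq_zero_iff.1 (Finsupp.ext hc)))
  obtain ⟨m, hm⟩ := hz i
  have h1 : 1 ≤ |B.repr (x - y) i| := by
    rw [← hm] at hi ⊢
    simp only [eq_intCast, ne_eq, Int.cast_eq_zero] at hi ⊢
    exact_mod_cast Int.one_le_abs hi
  have h2 : |B.repr (x - y) i| ≤ ‖(B.coord i).toContinuousLinearMap‖ * ‖x - y‖ :=
    (B.coord i).toContinuousLinearMap.le_opNorm (x - y)
  have h3 : ‖(B.coord i).toContinuousLinearMap‖ ≤ C := by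
    have := Finset.single_le_sum (f := fun i => ‖(B.coord i).toContinuousLinearMap‖) (fun _ _ => norm_nonneg _) (Finset.mem_univ i)
    simp only at this; linarith
  rw [dist_eq_norm, inv_le_iff_one_le_mul₀ hC0]
  nlinarith [mul_le_mul_of_nonneg_right h3 (norm_nonneg (x - y))]

lemma dual_ud (B : Basis (Fin d) ℝ (Rd d)) (w : Rd d) : UniformlyDiscrete {x | ∀ i, e2pi x (B i) = e2pi w (B i)} := by
  set C : ℝ := 1 + ∑ i, ‖B i‖ with hC
  have hC0 : 0 < C := by positivity
  refine ⟨C⁻¹, by positivity, fun x hx y hy hne => ?_⟩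
  have hz : ∀ i, ∃ m : ℤ, (⟪x - y, B i⟫ : ℝ) = m := fun i => by
    have h1 : e2pi (x - y) (B i) = 1 := by
      rw [sub_eq_add_neg, e2pi_add, hx i, ← hy i, mul_comm, e2pi_neg_mul]
    rw [e2pi, Complex.exp_eq_one_iff] at h1
    obtain ⟨m, hm⟩ := h1
    refine ⟨m, ?_⟩
    have hpi : ((2 * Real.pi : ℝ) : ℂ) * Complex.I ≠ 0 := by simp [Real.pi_ne_zero]
    have h2 : ((⟪x - y, B i⟫ : ℝ) : ℂ) = m := mul_left_cancel₀ hpi (by rw [hm]; push_cast; ring)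
    exact_mod_cast h2
  obtain ⟨i, hi⟩ : ∃ i, (⟪x - y, B i⟫ : ℝ) ≠ 0 := by
    by_contra hc
    push Not at hc
    exact hne (sub_eq_zero.1 (InnerProductSpace.ext_inner_right_basis B (fun i => by rw [hc i, inner_zero_left])))
  obtain ⟨m, hm⟩ := hz i
  have h1 : 1 ≤ |(⟪x - y, B i⟫ : ℝ)| := by
    rw [hm] at hi ⊢
    simp only [ne_eq, Int.cast_eq_zero] at hi
    exact_mod_cast Int.one_le_abs hi
  have h2 := abs_real_inner_le_norm (x - y) (B i)
  have h3 : ‖B i‖ ≤ C := by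
    have := Finset.single_le_sum (f := fun i => ‖B i‖) (fun _ _ => norm_nonneg _) (Finset.mem_univ i)
    linarith
  rw [dist_eq_norm, inv_le_iff_one_le_mul₀ hC0]
  nlinarith [mul_le_mul_of_nonneg_left h3 (norm_nonneg (x - y))]

lemma cgen_TB (B : Basis (Fin d) ℝ (Rd d)) (v w : Rd d) : TB wt (cgen B v w) :=
  TB_bdd (C := 1) (lat_ud B v) (fun x hx => if_neg hx) (fun x hx => by
    have hx' : x - v ∈ latB B := hx
    rw [cgen, if_pos hx', e2pi_norm])

def GS (d : ℕ) : Submodule ℂ (TemperedDist d) :=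
  Submodule.span ℂ {u | ∃ B v w k, u = LD (cgen B v w) (cgen_TB B v w) k}

lemma GS_le : GS d ≤ BDS d := by
  rw [GS, Submodule.span_le]
  rintro _ ⟨B, v, w, k, rfl⟩
  refine (dual_ud B w).BD.mono fun x hx => ?_
  by_contra hc
  simp only [mem_setOf_eq, not_forall] at hc
  obtain ⟨i, hi⟩ := hc
  set h := B i with hh
  have hU : IsOpen {y : Rd d | e2pi y h ≠ e2pi w h} := isOpen_ne_fun (e2pi_smooth h).continuous continuous_const
  obtain ⟨φ, hφ, hs, hne⟩ := hx _ hU hi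
  apply hne
  have hdiff : ContDiff ℝ (⊤ : ℕ∞) (fun y => φ y / (e2pi y h - e2pi w h)) := by
    rw [contDiff_iff_contDiffAt]
    intro y
    by_cases hy : y ∈ tsupport φ
    · simp only [div_eq_mul_inv]
      exact (φ.smooth ⊤).contDiffAt.mul ((((e2pi_smooth h).sub contDiff_const).contDiffAt (x := y)).inv (sub_ne_zero.2 (hs hy)))
    · refine (contDiffAt_const (c := (0 : ℂ))).congr_of_eventuallyEq ?_
      filter_upwards [notMem_tsupport_iff_eventuallyEq.1 hy] with z hz
      rw [hz]; simp
  have hcs : HasCompactSupport (fun y => φ y / (e2pi y h - e2pi w h)) := by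
    simp only [div_eq_mul_inv]; exact hφ.mul_right
  set β : 𝓢(Rd d, ℂ) := hcs.toSchwartzMap hdiff with hβ
  have e1 : φ = md h β - e2pi w h • β := by
    ext y
    rw [SchwartzMap.sub_apply, SchwartzMap.smul_apply, md_apply, smul_eq_mul, ← sub_mul]
    change φ y = (e2pi y h - e2pi w h) * (φ y / (e2pi y h - e2pi w h))
    by_cases hy : y ∈ tsupport φ
    · rw [mul_div_cancel₀ _ (sub_ne_zero.2 (hs hy))]
    · rw [image_eq_zero_of_notMem_tsupport hy]; simp
  have e2 : ∀ ψ : 𝓢(Rd d, ℂ), LD (cgen B v w) (cgen_TB B v w) k (tr h ψ) = e2pi w h * LD (cgen B v w) (cgen_TB B v w) k ψ := fun ψ => by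
    have h0 := LD_tr (cgen B v w) (cgen_TB B v w) k ψ 0
    have hz : tr 0 ψ = ψ := by ext y; simp
    rw [hz] at h0
    rw [LD_tr, h0, ← mul_assoc, mul_comm (e2pi w h), mul_assoc, ← tsum_mul_left (a := e2pi w h), ← (Equiv.addRight h).tsum_eq (fun x => cgen B v w x * DS k ψ (x - h))]
    congr 1
    refine tsum_congr fun y => ?_
    simp only [Equiv.coe_addRight, add_sub_cancel_right, sub_zero, ← mul_assoc]
    congr 1
    have hm : y + h - v ∈ latB B ↔ y - v ∈ latB B := by
      rw [add_sub_right_comm]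
      exact (latB B).add_mem_iff_left (Submodule.subset_span ⟨i, rfl⟩)
    unfold cgen
    by_cases hy : y - v ∈ latB B
    · rw [if_pos (hm.2 hy), if_pos hy, e2pi_add, e2pi_symm h w, mul_comm]
    · rw [if_neg (fun h => hy (hm.1 h)), if_neg hy, mul_zero]
  change LD (cgen B v w) (cgen_TB B v w) k (FT φ) = 0
  rw [e1, map_sub, map_sub, FT_md, e2, map_smul, map_smul, smul_eq_mul, sub_self]

lemma LD_GS {g : Rd d → ℂ} (hg : g ∈ Crys d) : TB wt g ∧ ∀ (h : TB wt g) k, LD g h k ∈ GS d := by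
  induction hg using Submodule.span_induction with
  | mem x hx =>
    obtain ⟨B, v, w, rfl⟩ := hx
    exact ⟨cgen_TB B v w, fun h k => Submodule.subset_span ⟨B, v, w, k, rfl⟩⟩
  | zero =>
    refine ⟨⟨0, fun t s => by simp⟩, fun h k => ?_⟩
    have : LD 0 h k = 0 := by ext ψ; rw [LD_apply]; simp
    rw [this]; exact Submodule.zero_mem _
  | add a b _ _ ha hb =>
    refine ⟨ha.1.add wt_nonneg hb.1, fun h k => ?_⟩
    have : LD (a + b) h k = LD a ha.1 k + LD b hb.1 k := by
      ext ψ
      rw [ContinuousLinearMap.add_apply, LD_apply, LD_apply, LD_apply, ← (LD_summ a ha.1 k ψ).tsum_add (LD_summ b hb.1 k ψ)]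
      simp only [Pi.add_apply, add_mul]
    rw [this]; exact Submodule.add_mem _ (ha.2 _ k) (hb.2 _ k)
  | smul c a _ ha =>
    refine ⟨ha.1.smul c, fun h k => ?_⟩
    have : LD (c • a) h k = c • LD a ha.1 k := by
      ext ψ
      rw [ContinuousLinearMap.smul_apply, LD_apply, LD_apply, smul_eq_mul, ← tsum_mul_left]
      simp only [Pi.smul_apply, smul_eq_mul, mul_assoc]
    rw [this]; exact Submodule.smul_mem _ _ (ha.2 _ k)

lemma all_crys {Λ : Set (Rd d)} (hΛ : UniformlyDiscrete Λ) (p : (Fin d → ℕ) → Rd d → ℂ) (h0 : ∀ k, ∀ x ∉ Λ, p k x = 0)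
    (hp : ∀ k, TB wt (p k)) (n : ℕ) : ∀ I : Finset (Fin d → ℕ), (∀ k ∈ I, ∑ i, k i < n) →
    ∑ k ∈ I, LD (p k) (hp k) k ∈ BDS d → ∀ k ∈ I, p k ∈ Crys d := by
  induction n with
  | zero => intro I hI _ k hk; exact absurd (hI k hk) (by simp)
  | succ n ih =>
    intro I hI hB
    let D : Dat d := ⟨_, I, n, p, hp, rfl, fun k hk => Nat.lt_succ_iff.1 (hI k hk), _, hB, subset_rfl⟩
    have h1 : ∀ k ∈ I, ∑ i, k i = n → p k ∈ Crys d := fun k hk hkn => by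
      have := interp (Crys d) I (fun k => if ∑ i, k i = n then p k else 0) (fun s => by
        have := D.crys_top hΛ h0 s
        convert this using 1
        ext x
        simp only [topc, Finset.sum_apply, D]
        refine Finset.sum_congr rfl fun k _ => ?_
        split_ifs <;> simp) k hk
      simpa [hkn] using this
    have h2 : ∑ k ∈ I with ∑ i, k i < n, LD (p k) (hp k) k ∈ BDS d := by
      have e := Finset.sum_filter_add_sum_filter_not I (fun k => ∑ i, k i < n) (fun k => LD (p k) (hp k) k)
      rw [← e] at hB
      refine (Submodule.add_mem_iff_left _ (Submodule.sum_mem _ fun k hk => ?_)).1 hB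
      rw [Finset.mem_filter] at hk
      exact GS_le ((LD_GS (h1 k hk.1 (by have := hI k hk.1; omega))).2 _ k)
    have h3 := ih _ (fun k hk => (Finset.mem_filter.1 hk).2) h2
    intro k hk
    by_cases hkn : ∑ i, k i < n
    · exact h3 k (Finset.mem_filter.2 ⟨hk, hkn⟩)
    · exact h1 k hk (by have := hI k hk; omega)

lemma GS_final {f : TemperedDist d} (hf : f ∈ GS d) :
    ∃ (J : ℕ) (L : Fin J → Set (Rd d)) (v : Fin J → Rd d)
      (n : ℕ) (kk : Fin n → (Fin d → ℕ)) (w : Fin n → Rd d) (cc : Fin J → Fin n → ℂ),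
      (∀ j, IsFullRankLattice (L j)) ∧
      ∀ φ : SchwartzMap (Rd d) ℂ, HasCompactSupport (⇑φ) →
        f φ = ∑ j, ∑' x : ((fun y => v j + y) '' (L j) : Set (Rd d)),
          ∑ i, cc j i * e2pi (x : Rd d) (w i) * dkDelta (kk i) (x : Rd d) φ := by
  obtain ⟨n, c, g, rfl⟩ := Submodule.mem_span_set'.1 hf
  choose B v w k hg using fun i => (g i).2
  refine ⟨n, fun j => latB (B j), v, n, k, w, fun j i => if i = j then c j else 0, fun j => latB_full _, fun φ _ => ?_⟩
  rw [ContinuousLinearMap.sum_apply]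
  refine Finset.sum_congr rfl fun j _ => ?_
  rw [ContinuousLinearMap.smul_apply, hg, LD_apply, smul_eq_mul, ← tsum_mul_left]
  rw [tsum_subtype ((fun y => v j + y) '' (latB (B j) : Set (Rd d)))
    (fun x => ∑ i, (if i = j then c j else 0) * e2pi x (w i) * dkDelta (k i) x φ)]
  refine tsum_congr fun x => ?_
  have hm : x ∈ (fun y => v j + y) '' (latB (B j) : Set (Rd d)) ↔ x - v j ∈ latB (B j) := by
    constructor
    · rintro ⟨y, hy, rfl⟩; simpa using hy
    · intro h; exact ⟨x - v j, h, by simp⟩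
  classical
  by_cases hx : x - v j ∈ latB (B j)
  · rw [indicator_of_mem (hm.2 hx), cgen, if_pos hx]
    simp [ite_mul, mul_assoc]
  · rw [indicator_of_notMem (fun h => hx (hm.1 h)), cgen, if_neg hx]; simp

end P18
/-- (Theorem 10, the main result.) Let
`f = Σ_{λ∈Λ} Σ_k p_k(λ) D^k δ_λ` be a tempered distribution on `ℝ^d` with
uniformly discrete support `Λ` and spectrum of bounded density, whose
coefficients satisfy `0 < c ≤ sup_k |p_k(λ)| ≤ C < ∞` on `Λ`. Then
`f = Σ_{j=1}^J Σ_{λ ∈ λ_j + L_j} Σ_{(k,ω)} c(j,k,ω) e^{2πi⟨λ,ω⟩} D^k δ_λ`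
for full-rank lattices `L_j`, points `λ_j`, a finite set of pairs `(k,ω)` and
complex numbers `c(j,k,ω)`. -/
theorem statement5 {d : ℕ} (f : TemperedDist d) (Λ : Set (Rd d)) (K : ℕ)
    (p : (Fin d → ℕ) → Rd d → ℂ)
    (hp0 : ∀ k ∉ mIdx d K, ∀ x, p k x = 0)
    (hsupp : ∀ k x, p k x ≠ 0 → x ∈ Λ)
    (hΛ : UniformlyDiscrete Λ)
    (hrep : ∀ φ : SchwartzMap (Rd d) ℂ, HasCompactSupport (⇑φ) →
      f φ = ∑' x : Rd d, ∑ k ∈ mIdx d K, p k x * dkDelta k x φ)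
    (hΓ : BoundedDensity (tdSupport (fourierTD f)))
    (c C : ℝ) (hc : 0 < c)
    (hbound : ∀ x ∈ Λ, (∃ k, c ≤ ‖p k x‖) ∧ ∀ k, ‖p k x‖ ≤ C) :
    ∃ (J : ℕ) (L : Fin J → Set (Rd d)) (v : Fin J → Rd d)
      (n : ℕ) (kk : Fin n → (Fin d → ℕ)) (w : Fin n → Rd d) (cc : Fin J → Fin n → ℂ),
      (∀ j, IsFullRankLattice (L j)) ∧
      ∀ φ : SchwartzMap (Rd d) ℂ, HasCompactSupport (⇑φ) →
        f φ = ∑ j, ∑' x : ((fun y => v j + y) '' (L j) : Set (Rd d)),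
          ∑ i, cc j i * e2pi (x : Rd d) (w i) * dkDelta (kk i) (x : Rd d) φ := by
  have h0 : ∀ k, ∀ x ∉ Λ, p k x = 0 := fun k x hx => by
    by_contra h; exact hx (hsupp k x h)
  have hp : ∀ k, TB wt (p k) := fun k => TB_bdd hΛ (h0 k) (fun x hx => (hbound x hx).2 k)
  have hf : f = ∑ k ∈ mIdx d K, LD (p k) (hp k) k := by
    rw [← sub_eq_zero]
    refine td_dense _ fun φ hφ => ?_
    rw [ContinuousLinearMap.sub_apply, ContinuousLinearMap.sum_apply, hrep φ hφ,
      Summable.tsum_finsetSum (fun k _ => LD_summ (p k) (hp k) k φ), sub_eq_zero]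
    exact Finset.sum_congr rfl fun k _ => (LD_apply _ _ _ _).symm
  have hC := all_crys hΛ p h0 hp (K + 1) (mIdx d K)
    (fun k hk => Nat.lt_succ_iff.2 (Finset.mem_filter.1 hk).2) (by rw [← hf]; exact hΓ)
  refine GS_final ?_
  rw [hf]
  exact Submodule.sum_mem _ fun k hk => (LD_GS (hC k hk)).2 _ k
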